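/- arXiv:1908.03384 — 2 statements merged into one kernel-verified Lean document; each statement's English description precedes it below -/
import Mathlib

section
/- Let n ≥ 2, 1 ≤ m < n, p,q ∈ [1,∞], A = [α₀,α_∞] ∈ ℝ², and assume one of: (p=q=1, α₀≥0, α_∞≤0), or p∈(1,∞), or (p=∞, q∈[1,∞), α₀+1/q<0), or (p=q=∞, α₀≤0). Let Y = L^{p,q;A}(0,∞) and define τ_m(f) = sup{ ‖∫_t^∞ h(s) s^{m/n−1} ds‖_Y : h ≥ 0 measurable with h^* = f^* }. Then τ_m is the optimal (largest) rearrangement-invariant domain norm for Y in the Hardy-type inequality, i.e. ‖∫_t^∞ f(s)s^{m/n−1}ds‖_Y ≤ τ_m(f) for all nonnegative measurable f, and τ_m ≤ C·ρ_X for any rearrangement-invariant norm ρ_X satisfying ‖∫_t^∞ f(s)s^{m/n−1}ds‖_Y ≤ C ρ_X(f) for all nonnegative measurable f; moreover τ_m is equivalent (with constants independent of f) to: the L^{1,1;A}-norm f ↦ ∫_0^∞ ℓ^A(t) f^*(t) dt if p = n/(n−m), q = 1, α₀ ≥ 0, α_∞ ≤ 0; the L^{np/(n+mp), q; A}-norm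 if p ∈ (n/(n−m), ∞); and the functional f ↦ ‖t^{−1/q} ℓ^A(t) ∫_t^∞ f^*(s) s^{m/n−1} ds‖_{L^q(0,∞)} if p = ∞ (with q∈[1,∞), α₀+1/q<0, or q=∞, α₀≤0). In particular, for A = [0,0]: if p = n/(n−m), q = 1 then τ_m is equivalent to the L^1-norm, and if p = q = ∞ (Y = L^∞) then τ_m is equivalent to the L^{n/m,1}-norm. Conversely, if p = n/(n−m) and α_∞ > 0, or p ∈ [1, n/(n−m)), then there is no rearrangement-invariant norm ρ_X on (0,∞) such that ‖∫_t^∞ f(s) s^{m/n−1} ds‖_Y ≤ C ρ_X(f) holds for some C and all nonnegative measurable f. -/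
open MeasureTheory Set Filter
open scoped ENNReal NNReal Topology

noncomputable section

/-- Lebesgue measure restricted to `(0,∞)`. -/
def mu0 : Measure ℝ := volume.restrict (Set.Ioi (0:ℝ))

/-- Decreasing rearrangement of an `ℝ≥0∞`-valued function w.r.t. a measure `μ`. -/
def rearrangement {α : Type*} [MeasurableSpace α] (μ : Measure α) (f : α → ℝ≥0∞) (t : ℝ) :
    ℝ≥0∞ :=
  sInf {l : ℝ≥0∞ | μ {x | l < f x} ≤ ENNReal.ofReal t}

/-- Decreasing rearrangement of a (nonnegative) function on `(0,∞)`. -/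
def rearr (f : ℝ → ℝ≥0∞) : ℝ → ℝ≥0∞ := rearrangement mu0 f

/-- The maximal rearrangement `f^{**}(t) = (1/t)∫_0^t f^*(s) ds`. -/
def doubleStar (f : ℝ → ℝ≥0∞) (t : ℝ) : ℝ≥0∞ :=
  (ENNReal.ofReal t)⁻¹ * ∫⁻ s in Set.Ioc (0:ℝ) t, rearr f s

/-- Rearrangement-invariant function norm on `(0,∞)` (axioms (P1)–(P6)). -/
structure IsRINorm (ρ : (ℝ → ℝ≥0∞) → ℝ≥0∞) : Prop where
  eq_zero_iff : ∀ f : ℝ → ℝ≥0∞, Measurable f → (ρ f = 0 ↔ f =ᵐ[mu0] 0)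
  smul : ∀ (c : ℝ≥0) (f : ℝ → ℝ≥0∞), Measurable f →
    ρ (fun t => (c : ℝ≥0∞) * f t) = c * ρ f
  triangle : ∀ f g : ℝ → ℝ≥0∞, Measurable f → Measurable g → ρ (f + g) ≤ ρ f + ρ g
  mono : ∀ f g : ℝ → ℝ≥0∞, Measurable f → Measurable g →
    (∀ᵐ t ∂mu0, f t ≤ g t) → ρ f ≤ ρ g
  fatou : ∀ (F : ℕ → ℝ → ℝ≥0∞) (f : ℝ → ℝ≥0∞), (∀ j, Measurable (F j)) → Measurable f →
    (∀ j t, F j t ≤ F (j + 1) t) → (∀ t, (⨆ j, F j t) = f t) → (⨆ j, ρ (F j)) = ρ f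
  indicator_lt_top : ∀ E : Set ℝ, MeasurableSet E → mu0 E < ∞ → ρ (E.indicator 1) < ∞
  local_L1 : ∀ E : Set ℝ, MeasurableSet E → mu0 E < ∞ → ∃ C : ℝ≥0∞, 0 < C ∧ C < ∞ ∧
    ∀ f : ℝ → ℝ≥0∞, Measurable f → (∫⁻ t in E, f t ∂mu0) ≤ C * ρ f
  rearr_inv : ∀ f g : ℝ → ℝ≥0∞, Measurable f → Measurable g → rearr f = rearr g → ρ f = ρ g

/-- The associate norm `ρ'`. -/
def associate (ρ : (ℝ → ℝ≥0∞) → ℝ≥0∞) (g : ℝ → ℝ≥0∞) : ℝ≥0∞ :=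
  ⨆ (f : ℝ → ℝ≥0∞) (_ : Measurable f) (_ : ρ f ≤ 1), ∫⁻ t, f t * g t ∂mu0

/-- The weighted Hardy-type operator `f ↦ (t ↦ ∫_t^∞ f(s) s^{m/n-1} ds)`. -/
def hardyOp (m n : ℕ) (f : ℝ → ℝ≥0∞) (t : ℝ) : ℝ≥0∞ :=
  ∫⁻ s in Set.Ioi t, f s * ENNReal.ofReal (s ^ ((m : ℝ)/(n : ℝ) - 1))

/-- The function `t ↦ t^{m/n-1} χ_{(1,∞)}(t)`. -/
def tailFun (m n : ℕ) (t : ℝ) : ℝ≥0∞ :=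
  ENNReal.ofReal (t ^ ((m : ℝ)/(n : ℝ) - 1)) * (Set.Ioi (1:ℝ)).indicator 1 t

/-- The functional `σ_m(f) = ρ'(t ↦ t^{m/n} f^{**}(t))`. -/
def sigmaFun (m n : ℕ) (ρ : (ℝ → ℝ≥0∞) → ℝ≥0∞) (f : ℝ → ℝ≥0∞) : ℝ≥0∞ :=
  associate ρ (fun t => ENNReal.ofReal (t ^ ((m : ℝ)/(n : ℝ))) * doubleStar f t)

/-- The optimal-domain functional `τ_m`. -/
def tauFun (m n : ℕ) (ρY : (ℝ → ℝ≥0∞) → ℝ≥0∞) (f : ℝ → ℝ≥0∞) : ℝ≥0∞ :=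
  ⨆ (h : ℝ → ℝ≥0∞) (_ : Measurable h) (_ : rearr h = rearr f), ρY (hardyOp m n h)

/-- The operator `T_α f(t) = t^{-α} sup_{t ≤ s} s^α f^*(s)`. -/
def supOp (α : ℝ) (f : ℝ → ℝ≥0∞) (t : ℝ) : ℝ≥0∞ :=
  ENNReal.ofReal (t ^ (-α)) * ⨆ (s : ℝ) (_ : t ≤ s), ENNReal.ofReal (s ^ α) * rearr f s

/-- `σ` is an optimal (smallest) rearrangement-invariant target norm for `ρX` in the
Hardy-type inequality `‖∫_t^∞ f(s) s^{m/n-1} ds‖_Y ≤ C ‖f‖_X`. -/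
def IsOptimalTargetNorm (m n : ℕ) (ρX σ : (ℝ → ℝ≥0∞) → ℝ≥0∞) : Prop :=
  (∃ C : ℝ≥0∞, 0 < C ∧ C < ∞ ∧
      ∀ f : ℝ → ℝ≥0∞, Measurable f → σ (hardyOp m n f) ≤ C * ρX f) ∧
  ∀ ρZ : (ℝ → ℝ≥0∞) → ℝ≥0∞, IsRINorm ρZ →
    (∃ C : ℝ≥0∞, 0 < C ∧ C < ∞ ∧
       ∀ f : ℝ → ℝ≥0∞, Measurable f → ρZ (hardyOp m n f) ≤ C * ρX f) →
    ∃ c : ℝ≥0∞, 0 < c ∧ c < ∞ ∧ ∀ f : ℝ → ℝ≥0∞, Measurable f → ρZ f ≤ c * σ f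

/-- There exists a rearrangement-invariant target norm for `ρX` in the Hardy-type
inequality. -/
def ExistsRITarget (m n : ℕ) (ρX : (ℝ → ℝ≥0∞) → ℝ≥0∞) : Prop :=
  ∃ (ρY : (ℝ → ℝ≥0∞) → ℝ≥0∞) (C : ℝ≥0∞), IsRINorm ρY ∧ 0 < C ∧ C < ∞ ∧
    ∀ f : ℝ → ℝ≥0∞, Measurable f → ρY (hardyOp m n f) ≤ C * ρX f

/-- There exists a rearrangement-invariant domain norm for `ρY` in the Hardy-type
inequality. -/
def ExistsRIDomain (m n : ℕ) (ρY : (ℝ → ℝ≥0∞) → ℝ≥0∞) : Prop :=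
  ∃ (ρX : (ℝ → ℝ≥0∞) → ℝ≥0∞) (C : ℝ≥0∞), IsRINorm ρX ∧ 0 < C ∧ C < ∞ ∧
    ∀ f : ℝ → ℝ≥0∞, Measurable f → ρY (hardyOp m n f) ≤ C * ρX f

/-- Two functionals are equivalent with constants independent of the function. -/
def EquivNorms (σ τ : (ℝ → ℝ≥0∞) → ℝ≥0∞) : Prop :=
  ∃ c C : ℝ≥0∞, 0 < c ∧ c < ∞ ∧ 0 < C ∧ C < ∞ ∧
    ∀ f : ℝ → ℝ≥0∞, Measurable f → c * σ f ≤ τ f ∧ τ f ≤ C * σ f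

/-- The decay condition defining `V_0^m X(ℝ^n)`: all derivatives of order `< m` have
finite-measure superlevel sets. -/
def DecaysAtInfinity (n m : ℕ) (u : EuclideanSpace ℝ (Fin n) → ℝ) : Prop :=
  ∀ k : ℕ, k < m → ∀ lam : ℝ, 0 < lam →
    volume {x : EuclideanSpace ℝ (Fin n) | lam < ‖iteratedFDeriv ℝ k u x‖} < ∞

/-- Broken logarithm `ℓ^{[a₀,a_∞]}`. -/
def ell (a0 ai : ℝ) (t : ℝ) : ℝ :=
  if t < 1 then (1 - Real.log t) ^ a0 else (1 + Real.log t) ^ ai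

/-- Doubly broken logarithm `ℓℓ^{[b₀,b_∞]}`. -/
def ell2 (b0 bi : ℝ) (t : ℝ) : ℝ :=
  if t < 1 then (1 + Real.log (1 - Real.log t)) ^ b0
  else (1 + Real.log (1 + Real.log t)) ^ bi

/-- Triply broken logarithm `ℓℓℓ^{[c₀,c_∞]}`. -/
def ell3 (c0 ci : ℝ) (t : ℝ) : ℝ :=
  if t < 1 then (1 + Real.log (1 + Real.log (1 - Real.log t))) ^ c0
  else (1 + Real.log (1 + Real.log (1 + Real.log t))) ^ ci

/-- `L^q`-functional (`q ∈ [1,∞]`) of an `ℝ≥0∞`-valued function over `S ⊆ ℝ`. -/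
def Lqnorm (q : ℝ≥0∞) (S : Set ℝ) (g : ℝ → ℝ≥0∞) : ℝ≥0∞ :=
  if q = ∞ then essSup g (volume.restrict S)
  else (∫⁻ t in S, g t ^ q.toReal) ^ (1 / q.toReal)

/-- Lorentz–Zygmund functional `‖f‖_{p,q;[a₀,a_∞]}`, parametrized by `pinv = 1/p`. -/
def LZnorm (pinv : ℝ) (q : ℝ≥0∞) (a0 ai : ℝ) (f : ℝ → ℝ≥0∞) : ℝ≥0∞ :=
  Lqnorm q (Set.Ioi 0)
    (fun t => ENNReal.ofReal (t ^ (pinv - q⁻¹.toReal) * ell a0 ai t) * rearr f t)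

/-- Generalized Lorentz–Zygmund functional with two tiers of logarithms. -/
def GLZnorm2 (pinv : ℝ) (q : ℝ≥0∞) (a0 ai b0 bi : ℝ) (f : ℝ → ℝ≥0∞) : ℝ≥0∞ :=
  Lqnorm q (Set.Ioi 0)
    (fun t => ENNReal.ofReal (t ^ (pinv - q⁻¹.toReal) * ell a0 ai t * ell2 b0 bi t) * rearr f t)

/-- Generalized Lorentz–Zygmund functional with three tiers of logarithms. -/
def GLZnorm3 (pinv : ℝ) (q : ℝ≥0∞) (a0 ai b0 bi c0 ci : ℝ) (f : ℝ → ℝ≥0∞) : ℝ≥0∞ :=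
  Lqnorm q (Set.Ioi 0)
    (fun t => ENNReal.ofReal
      (t ^ (pinv - q⁻¹.toReal) * ell a0 ai t * ell2 b0 bi t * ell3 c0 ci t) * rearr f t)

/-- Young function predicate. -/
structure IsYoung (A : ℝ → ℝ≥0∞) : Prop where
  map_zero : A 0 = 0
  convex : ∀ x y : ℝ, 0 ≤ x → 0 ≤ y → ∀ l : ℝ, 0 ≤ l → l ≤ 1 →
    A (l * x + (1 - l) * y) ≤ ENNReal.ofReal l * A x + ENNReal.ofReal (1 - l) * A y
  left_cont : ∀ x : ℝ, 0 < x → Filter.Tendsto A (nhdsWithin x (Set.Iio x)) (nhds (A x))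
  not_zero : ∃ x : ℝ, 0 < x ∧ A x ≠ 0
  not_top : ∃ x : ℝ, 0 < x ∧ A x ≠ ∞

/-- Canonical extension of a Young function to `ℝ≥0∞`-valued arguments. -/
def eext (A : ℝ → ℝ≥0∞) (x : ℝ≥0∞) : ℝ≥0∞ := if x = ∞ then ∞ else A x.toReal

/-- Luxemburg norm on `(0,∞)`. -/
def luxNorm (A : ℝ → ℝ≥0∞) (f : ℝ → ℝ≥0∞) : ℝ≥0∞ :=
  sInf {l : ℝ≥0∞ | l ≠ 0 ∧ (∫⁻ t in Set.Ioi (0:ℝ), eext A (f t / l)) ≤ 1}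

/-- Generalized (right-continuous) inverse of a nondecreasing `g : ℝ → ℝ≥0∞`. -/
def geninv (g : ℝ → ℝ≥0∞) (y : ℝ≥0∞) : ℝ≥0∞ :=
  ⨅ (s : ℝ) (_ : 0 ≤ s) (_ : y ≤ g s), ENNReal.ofReal s

/-- Young conjugate `Ã(t) = sup_{s ≥ 0} (st - A(s))`. -/
def conjY (A : ℝ → ℝ≥0∞) (t : ℝ) : ℝ≥0∞ :=
  ⨆ (s : ℝ) (_ : 0 ≤ s), (ENNReal.ofReal (s * t) - A s)

/-- `h_A(t) = sup_{0<s<∞} A^{-1}(st)/A^{-1}(s)`. -/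
def hYoung (A : ℝ → ℝ≥0∞) (t : ℝ) : ℝ≥0∞ :=
  ⨆ (s : ℝ) (_ : 0 < s), geninv A (ENNReal.ofReal (s * t)) / geninv A (ENNReal.ofReal s)

/-- The upper Boyd index `I_A = inf_{0<t<1} log t / log h_A(t)`. -/
def upperBoyd (A : ℝ → ℝ≥0∞) : ℝ :=
  sInf ((fun t => Real.log t / Real.log ((hYoung A t).toReal)) '' Set.Ioo (0:ℝ) 1)

/-- `H_m(t) = (∫_0^t (s/A(s))^{m/(n-m)} ds)^{(n-m)/n}`. -/
def Hm (m n : ℕ) (A : ℝ → ℝ≥0∞) (t : ℝ) : ℝ≥0∞ :=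
  (∫⁻ s in Set.Ioc (0:ℝ) t, (ENNReal.ofReal s / A s) ^ ((m : ℝ)/((n : ℝ) - (m : ℝ))))
    ^ (((n : ℝ) - (m : ℝ))/(n : ℝ))

/-- `H^∞ = lim_{t→∞} H_m(t)`. -/
def Hinfty (m n : ℕ) (A : ℝ → ℝ≥0∞) : ℝ≥0∞ := ⨆ t : ℝ, Hm m n A t

/-- `D_m`. -/
def Dm (m n : ℕ) (A : ℝ → ℝ≥0∞) (t : ℝ) : ℝ≥0∞ :=
  if ENNReal.ofReal t < Hinfty m n A then
    (ENNReal.ofReal t * A ((geninv (Hm m n A) (ENNReal.ofReal t)).toReal) /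
        geninv (Hm m n A) (ENNReal.ofReal t)) ^ ((n : ℝ)/((n : ℝ) - (m : ℝ)))
  else ∞

/-- `A_m(t) = ∫_0^t D_m(s)/s ds`. -/
def Am (m n : ℕ) (A : ℝ → ℝ≥0∞) (t : ℝ) : ℝ≥0∞ :=
  ∫⁻ s in Set.Ioc (0:ℝ) t, Dm m n A s / ENNReal.ofReal s

/-- `G_m(t) = t · inf_{0<s≤t} B^{-1}(s) s^{(m-n)/n}`. -/
def Gm (m n : ℕ) (B : ℝ → ℝ≥0∞) (t : ℝ) : ℝ≥0∞ :=
  ENNReal.ofReal t *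
    ⨅ (s : ℝ) (_ : 0 < s) (_ : s ≤ t),
      geninv B (ENNReal.ofReal s) * ENNReal.ofReal (s ^ (((m : ℝ) - (n : ℝ))/(n : ℝ)))

/-- `B_m(t) = ∫_0^t G_m^{-1}(s)/s ds`. -/
def Bm (m n : ℕ) (B : ℝ → ℝ≥0∞) (t : ℝ) : ℝ≥0∞ :=
  ∫⁻ s in Set.Ioc (0:ℝ) t, geninv (Gm m n B) (ENNReal.ofReal s) / ENNReal.ofReal s

/-- `A` dominates `B` near zero. -/
def DomNearZero (A B : ℝ → ℝ≥0∞) : Prop :=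
  ∃ c t0 : ℝ, 0 < c ∧ 0 < t0 ∧ ∀ t : ℝ, 0 ≤ t → t ≤ t0 → B t ≤ A (c * t)

/-- `A` dominates `B` near infinity. -/
def DomNearInfty (A B : ℝ → ℝ≥0∞) : Prop :=
  ∃ c t0 : ℝ, 0 < c ∧ 0 < t0 ∧ ∀ t : ℝ, t0 ≤ t → B t ≤ A (c * t)

def EquivNearZero (A B : ℝ → ℝ≥0∞) : Prop := DomNearZero A B ∧ DomNearZero B A

def EquivNearInfty (A B : ℝ → ℝ≥0∞) : Prop := DomNearInfty A B ∧ DomNearInfty B A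

/-- There exists an Orlicz target for the Hardy-type inequality with domain `L^A`. -/
def ExistsOrliczTarget (m n : ℕ) (A : ℝ → ℝ≥0∞) : Prop :=
  ∃ B : ℝ → ℝ≥0∞, IsYoung B ∧ ∃ C : ℝ≥0∞, 0 < C ∧ C < ∞ ∧
    ∀ f : ℝ → ℝ≥0∞, Measurable f → luxNorm B (hardyOp m n f) ≤ C * luxNorm A f

/-- There exists an Orlicz domain for the Hardy-type inequality with target `L^B`. -/
def ExistsOrliczDomain (m n : ℕ) (B : ℝ → ℝ≥0∞) : Prop :=
  ∃ A : ℝ → ℝ≥0∞, IsYoung A ∧ ∃ C : ℝ≥0∞, 0 < C ∧ C < ∞ ∧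
    ∀ f : ℝ → ℝ≥0∞, Measurable f → luxNorm B (hardyOp m n f) ≤ C * luxNorm A f

/-- `L^{A_m}` is the optimal (smallest) Orlicz target for `L^A`. -/
def IsOptimalOrliczTarget (m n : ℕ) (A B : ℝ → ℝ≥0∞) : Prop :=
  (∃ C : ℝ≥0∞, 0 < C ∧ C < ∞ ∧
      ∀ f : ℝ → ℝ≥0∞, Measurable f → luxNorm B (hardyOp m n f) ≤ C * luxNorm A f) ∧
  ∀ B' : ℝ → ℝ≥0∞, IsYoung B' →
    (∃ C : ℝ≥0∞, 0 < C ∧ C < ∞ ∧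
       ∀ f : ℝ → ℝ≥0∞, Measurable f → luxNorm B' (hardyOp m n f) ≤ C * luxNorm A f) →
    ∃ c : ℝ≥0∞, 0 < c ∧ c < ∞ ∧
      ∀ g : ℝ → ℝ≥0∞, Measurable g → luxNorm B' g ≤ c * luxNorm B g

/-- Model Young-function behaviour `t^p (1 - log t)^a` (near zero). -/
def modelZero (p a : ℝ) (t : ℝ) : ℝ≥0∞ := ENNReal.ofReal (t ^ p * (1 - Real.log t) ^ a)

/-- Model Young-function behaviour `t^p (1 + log t)^a` (near infinity). -/
def modelInf (p a : ℝ) (t : ℝ) : ℝ≥0∞ := ENNReal.ofReal (t ^ p * (1 + Real.log t) ^ a)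



lemma rearr_lt_iff_aux (f : ℝ → ℝ≥0∞) (l : ℝ≥0∞) (t : ℝ) :
    l < rearr f t ↔ ENNReal.ofReal t < mu0 {x | l < f x} := by
  constructor
  · intro h
    by_contra hc
    push Not at hc
    exact absurd (sInf_le (show l ∈ {l : ℝ≥0∞ | mu0 {x | l < f x} ≤ ENNReal.ofReal t} from hc))
      (not_le.mpr h)
  · intro h
    have hl : l < ∞ := by
      by_contra hc
      have : l = ∞ := by simpa using hc
      subst this
      simp at h
    obtain ⟨u, hu1, hu2, hu3⟩ := exists_seq_strictAnti_tendsto' hl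
    have hU : {x | l < f x} = ⋃ k, {x | u k < f x} := by
      ext x
      simp only [mem_ofPred_eq, mem_iUnion]
      constructor
      · intro hx
        exact ((tendsto_order.1 hu3).2 _ hx).exists
      · rintro ⟨k, hk⟩
        exact lt_trans (hu2 k).1 hk
    have hmono : Monotone (fun k => {x | u k < f x}) := by
      intro i j hij x hx
      exact lt_of_le_of_lt (hu1.antitone hij) hx
    rw [hU, hmono.measure_iUnion, lt_iSup_iff] at h
    obtain ⟨k, hk⟩ := h
    refine lt_of_lt_of_le (hu2 k).1 ?_
    refine le_sInf ?_
    intro b hb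
    by_contra hc
    push Not at hc
    have : mu0 {x | u k < f x} ≤ mu0 {x | b < f x} :=
      measure_mono (fun x hx => lt_trans hc hx)
    exact absurd (lt_of_lt_of_le hk (this.trans hb)) (lt_irrefl _)

lemma rearr_antitone (f : ℝ → ℝ≥0∞) : Antitone (rearr f) := by
  intro s t hst
  refine sInf_le_sInf ?_
  intro l hl
  exact le_trans hl (ENNReal.ofReal_le_ofReal hst)

lemma rearr_measurable (f : ℝ → ℝ≥0∞) : Measurable (rearr f) :=
  (rearr_antitone f).measurable

lemma vol_initial (M : ℝ≥0∞) : mu0 {t : ℝ | ENNReal.ofReal t < M} = M := by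
  unfold mu0
  rw [Measure.restrict_apply (measurableSet_lt (by fun_prop) measurable_const)]
  by_cases hM : M = ∞
  · subst hM
    have : {t : ℝ | ENNReal.ofReal t < ∞} ∩ Ioi 0 = Ioi 0 := by
      ext x; simp
    rw [this]; simp
  · have : {t : ℝ | ENNReal.ofReal t < M} ∩ Ioi 0 = Ioo 0 M.toReal := by
      ext x
      simp only [mem_inter_iff, mem_ofPred_eq, mem_Ioi, mem_Ioo]
      constructor
      · rintro ⟨h1, h2⟩
        exact ⟨h2, (ENNReal.ofReal_lt_iff_lt_toReal h2.le hM).1 h1⟩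
      · rintro ⟨h1, h2⟩
        exact ⟨(ENNReal.ofReal_lt_iff_lt_toReal h1.le hM).2 h2, h1⟩
    rw [this, Real.volume_Ioo]
    simp [hM]

lemma rearr_equimeas (f : ℝ → ℝ≥0∞) (l : ℝ≥0∞) :
    mu0 {x | l < rearr f x} = mu0 {x | l < f x} := by
  simp_rw [rearr_lt_iff_aux]
  exact vol_initial _

lemma rearr_congr {f g : ℝ → ℝ≥0∞} (h : ∀ l, mu0 {x | l < f x} = mu0 {x | l < g x}) :
    rearr f = rearr g := by
  funext t
  unfold rearr rearrangement
  simp_rw [h]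

lemma rearr_rearr (f : ℝ → ℝ≥0∞) : rearr (rearr f) = rearr f :=
  rearr_congr (rearr_equimeas f)

lemma equimeas_of_rearr_eq {f g : ℝ → ℝ≥0∞} (h : rearr f = rearr g) (l : ℝ≥0∞) :
    mu0 {x | l < f x} = mu0 {x | l < g x} := by
  rw [← rearr_equimeas f, h, rearr_equimeas]

lemma layer (x : ℝ≥0∞) :
    x = ∫⁻ l, {t : ℝ | ENNReal.ofReal t < x}.indicator (fun _ => (1:ℝ≥0∞)) l ∂mu0 := by
  rw [lintegral_indicator (measurableSet_lt (by fun_prop) measurable_const)]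
  simp [vol_initial]

instance : SFinite mu0 := by unfold mu0; infer_instance

lemma layer2 (h W : ℝ → ℝ≥0∞) (hh : Measurable h) (hW : Measurable W) :
    ∫⁻ s, h s * W s ∂mu0 = ∫⁻ l, ∫⁻ k, mu0 ({s | ENNReal.ofReal l < h s} ∩
      {s | ENNReal.ofReal k < W s}) ∂mu0 ∂mu0 := by
  have e : ∀ s, h s * W s = ∫⁻ l, ∫⁻ k,
      ({s | ENNReal.ofReal l < h s} ∩ {s | ENNReal.ofReal k < W s}).indicator
        (fun _ => (1:ℝ≥0∞)) s ∂mu0 ∂mu0 := by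
    intro s
    conv_lhs => rw [layer (h s), layer (W s)]
    rw [← lintegral_mul_const _ (measurable_const.indicator
      (measurableSet_lt (by fun_prop) measurable_const))]
    congr 1; funext l
    rw [← lintegral_const_mul _ (measurable_const.indicator
      (measurableSet_lt (by fun_prop) measurable_const))]
    congr 1; funext k
    by_cases h1 : ENNReal.ofReal l < h s <;> by_cases h2 : ENNReal.ofReal k < W s <;>
      simp [indicator, h1, h2]
  have hm3 : Measurable (fun z : (ℝ × ℝ) × ℝ =>
      ({s | ENNReal.ofReal z.1.2 < h s} ∩ {s | ENNReal.ofReal z.2 < W s}).indicator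
        (fun _ => (1:ℝ≥0∞)) z.1.1) := by
    have : MeasurableSet ({z : (ℝ × ℝ) × ℝ | ENNReal.ofReal z.1.2 < h z.1.1} ∩
        {z : (ℝ × ℝ) × ℝ | ENNReal.ofReal z.2 < W z.1.1}) :=
      (measurableSet_lt (by fun_prop) (by fun_prop)).inter
        (measurableSet_lt (by fun_prop) (by fun_prop))
    exact (measurable_const (a := (1:ℝ≥0∞))).indicator this
  simp_rw [e]
  rw [lintegral_lintegral_swap]
  · congr 1; funext l
    rw [lintegral_lintegral_swap]
    · congr 1; funext k
      rw [lintegral_indicator]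
      · simp
      · exact (measurableSet_lt (by fun_prop) (by fun_prop)).inter
          (measurableSet_lt (by fun_prop) (by fun_prop))
    · have : Measurable (fun z : ℝ × ℝ => (((z.1, l), z.2) : (ℝ × ℝ) × ℝ)) := by fun_prop
      exact (hm3.comp this).aemeasurable
  · exact (hm3.lintegral_prod_right').aemeasurable

/-- Hardy-Littlewood inequality with a nonincreasing weight. -/
lemma hardy_littlewood (h W : ℝ → ℝ≥0∞) (hh : Measurable h) (hWm : Measurable W)
    (hW : AntitoneOn W (Ioi 0)) :
    ∫⁻ s, h s * W s ∂mu0 ≤ ∫⁻ s, rearr h s * W s ∂mu0 := by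
  rw [layer2 h W hh hWm, layer2 _ W (rearr_measurable h) hWm]
  refine lintegral_mono fun l => lintegral_mono fun k => ?_
  set A := {s | ENNReal.ofReal l < rearr h s}
  set B := {s | ENNReal.ofReal k < W s}
  have hAB : A ∩ Ioi 0 ⊆ B ∨ B ∩ Ioi 0 ⊆ A := by
    by_contra hc
    push Not at hc
    obtain ⟨h1, h2⟩ := hc
    obtain ⟨x, ⟨hxA, hx0⟩, hxB⟩ := not_subset.1 h1
    obtain ⟨y, ⟨hyB, hy0⟩, hyA⟩ := not_subset.1 h2
    rcases le_total x y with hxy | hxy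
    · exact hxB (lt_of_lt_of_le hyB (hW hx0 hy0 hxy))
    · exact hyA (lt_of_lt_of_le hxA (rearr_antitone h hxy))
  have hmA : MeasurableSet A := measurableSet_lt measurable_const (rearr_measurable h)
  have hmB : MeasurableSet B := measurableSet_lt measurable_const hWm
  rcases hAB with hs | hs
  · calc _ ≤ mu0 {s | ENNReal.ofReal l < h s} := measure_mono inter_subset_left
      _ = mu0 A := (rearr_equimeas h _).symm
      _ ≤ mu0 (A ∩ B) := by
        unfold mu0
        rw [Measure.restrict_apply hmA, Measure.restrict_apply (hmA.inter hmB)]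
        exact measure_mono fun x hx => ⟨⟨hx.1, hs hx⟩, hx.2⟩
  · calc _ ≤ mu0 B := measure_mono inter_subset_right
      _ ≤ mu0 (A ∩ B) := by
        unfold mu0
        rw [Measure.restrict_apply hmB, Measure.restrict_apply (hmA.inter hmB)]
        exact measure_mono fun x hx => ⟨⟨hs hx, hx.1⟩, hx.2⟩

lemma hardyOp_antitone (m n : ℕ) (h : ℝ → ℝ≥0∞) : Antitone (hardyOp m n h) := by
  intro s t hst
  exact lintegral_mono_set (Ioi_subset_Ioi hst)

lemma rearr_hardyOp (m n : ℕ) (h : ℝ → ℝ≥0∞) {t : ℝ} (ht : 0 < t) :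
    rearr (hardyOp m n h) t = hardyOp m n h t := by
  apply le_antisymm
  · refine sInf_le ?_
    show mu0 _ ≤ _
    calc mu0 {x | hardyOp m n h t < hardyOp m n h x} ≤ mu0 (Iio t) := by
          refine measure_mono fun x hx => ?_
          by_contra hc
          exact absurd (hardyOp_antitone m n h (not_lt.1 hc)) (not_le.2 hx)
      _ = ENNReal.ofReal t := by
          unfold mu0
          rw [Measure.restrict_apply measurableSet_Iio, inter_comm, Ioi_inter_Iio]
          simp
  · refine le_sInf ?_
    intro l hl
    have hl : mu0 {x | l < hardyOp m n h x} ≤ ENNReal.ofReal t := hl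
    have key : ∀ s, t < s → hardyOp m n h s ≤ l := by
      intro s hs
      by_contra hc
      push Not at hc
      have : mu0 (Iic s) ≤ ENNReal.ofReal t := by
        refine le_trans (measure_mono fun x hx => ?_) hl
        exact lt_of_lt_of_le hc (hardyOp_antitone m n h hx)
      unfold mu0 at this
      rw [Measure.restrict_apply measurableSet_Iic, inter_comm, Ioi_inter_Iic] at this
      simp only [Real.volume_Ioc, sub_zero] at this
      rw [ENNReal.ofReal_le_ofReal_iff ht.le] at this
      linarith
    obtain ⟨u, hu1, hu2, hu3⟩ := exists_seq_strictAnti_tendsto t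
    have hU : Ioi t = ⋃ k, Ioi (u k) := by
      ext x
      simp only [mem_Ioi, mem_iUnion]
      constructor
      · intro hx
        exact ((tendsto_order.1 hu3).2 _ hx).exists
      · rintro ⟨k, hk⟩
        exact lt_trans (hu2 k) hk
    unfold hardyOp
    rw [hU, setLIntegral_iUnion_of_directed]
    · exact iSup_le fun k => key _ (hu2 k)
    · exact (directed_of_isDirected_le fun i j hij => Ioi_subset_Ioi (hu1.antitone hij))


lemma Lqnorm_eq (q : ℝ≥0∞) (hq : 1 ≤ q) (g : ℝ → ℝ≥0∞) :
    Lqnorm q (Ioi 0) g = eLpNorm g q mu0 := by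
  have hq0 : q ≠ 0 := (lt_of_lt_of_le one_pos hq).ne'
  unfold Lqnorm mu0
  split_ifs with h
  · subst h
    rw [eLpNorm_exponent_top]
    rfl
  · rw [eLpNorm_eq_lintegral_rpow_enorm_toReal hq0 h]
    rfl

lemma Lq_mono (q : ℝ≥0∞) (hq : 1 ≤ q) {g g' : ℝ → ℝ≥0∞} (h : ∀ t, 0 < t → g t ≤ g' t) :
    Lqnorm q (Ioi 0) g ≤ Lqnorm q (Ioi 0) g' := by
  rw [Lqnorm_eq q hq, Lqnorm_eq q hq]
  refine eLpNorm_mono_enorm_ae ?_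
  unfold mu0
  refine (ae_restrict_iff' measurableSet_Ioi).2 (Eventually.of_forall ?_)
  intro t ht
  exact h t ht

lemma Lq_congr (q : ℝ≥0∞) (hq : 1 ≤ q) {g g' : ℝ → ℝ≥0∞} (h : ∀ t, 0 < t → g t = g' t) :
    Lqnorm q (Ioi 0) g = Lqnorm q (Ioi 0) g' :=
  le_antisymm (Lq_mono q hq fun t ht => (h t ht).le) (Lq_mono q hq fun t ht => (h t ht).ge)

lemma Lq_const_mul (q : ℝ≥0∞) (hq : 1 ≤ q) (c : ℝ≥0∞) (hc : c ≠ ∞) (g : ℝ → ℝ≥0∞) :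
    Lqnorm q (Ioi 0) (fun t => c * g t) = c * Lqnorm q (Ioi 0) g := by
  have hq0 : q ≠ 0 := (lt_of_lt_of_le one_pos hq).ne'
  unfold Lqnorm
  split_ifs with h
  · exact ENNReal.essSup_const_mul
  · have hpos : 0 < q.toReal := ENNReal.toReal_pos hq0 h
    simp_rw [ENNReal.mul_rpow_of_nonneg _ _ hpos.le]
    rw [lintegral_const_mul' _ _ (ENNReal.rpow_ne_top_of_nonneg hpos.le hc),
      ENNReal.mul_rpow_of_nonneg _ _ (by positivity), ← ENNReal.rpow_mul]
    rw [mul_one_div_cancel hpos.ne', ENNReal.rpow_one]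

lemma Lq_add (q : ℝ≥0∞) (hq : 1 ≤ q) {g g' : ℝ → ℝ≥0∞} (hg : Measurable g)
    (hg' : Measurable g') :
    Lqnorm q (Ioi 0) (fun t => g t + g' t) ≤ Lqnorm q (Ioi 0) g + Lqnorm q (Ioi 0) g' := by
  simp_rw [Lqnorm_eq q hq]
  exact eLpNorm_add_le hg.aestronglyMeasurable hg'.aestronglyMeasurable hq

lemma Lq_sum (q : ℝ≥0∞) (hq : 1 ≤ q) {g : ℕ → ℝ → ℝ≥0∞} (hg : ∀ k, Measurable (g k)) (K : ℕ) :
    Lqnorm q (Ioi 0) (fun t => ∑ k ∈ Finset.range K, g k t)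
      ≤ ∑ k ∈ Finset.range K, Lqnorm q (Ioi 0) (g k) := by
  induction K with
  | zero =>
    simp only [Finset.range_zero, Finset.sum_empty]
    rw [Lqnorm_eq q hq]
    have : (fun _ : ℝ => (0:ℝ≥0∞)) = 0 := rfl
    rw [this, eLpNorm_zero]
  | succ K ih =>
    simp_rw [Finset.sum_range_succ]
    refine (Lq_add q hq (Finset.measurable_sum _ fun k _ => hg k) (hg K)).trans ?_
    gcongr

lemma Lq_iSup (q : ℝ≥0∞) (hq : 1 ≤ q) {G : ℕ → ℝ → ℝ≥0∞} (hG : ∀ k, Measurable (G k))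
    (hmono : Monotone G) (B : ℝ≥0∞) (hB : ∀ k, Lqnorm q (Ioi 0) (G k) ≤ B) :
    Lqnorm q (Ioi 0) (fun t => ⨆ k, G k t) ≤ B := by
  have hq0 : q ≠ 0 := (lt_of_lt_of_le one_pos hq).ne'
  unfold Lqnorm at *
  split_ifs at * with h
  · refine essSup_le_of_ae_le B ?_
    have : ∀ᵐ t ∂(volume.restrict (Ioi (0:ℝ))), ∀ k, G k t ≤ B := by
      rw [ae_all_iff]
      intro k
      filter_upwards [ae_le_essSup (f := G k) (μ := volume.restrict (Ioi (0:ℝ)))] with t ht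
      exact ht.trans (hB k)
    filter_upwards [this] with t ht
    exact iSup_le ht
  · have hpos : 0 < q.toReal := ENNReal.toReal_pos hq0 h
    rw [one_div, ENNReal.rpow_inv_le_iff hpos]
    have e : ∀ t, (⨆ k, G k t) ^ q.toReal = ⨆ k, G k t ^ q.toReal := fun t =>
      (ENNReal.orderIsoRpow q.toReal hpos).map_iSup _
    simp_rw [e]
    rw [lintegral_iSup (fun k => (hG k).pow_const _)]
    · refine iSup_le fun k => ?_
      rw [← ENNReal.rpow_inv_le_iff hpos, ← one_div]
      exact hB k
    · intro i j hij t
      exact ENNReal.rpow_le_rpow (hmono hij t) hpos.le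

lemma Lq_tsum (q : ℝ≥0∞) (hq : 1 ≤ q) {g : ℕ → ℝ → ℝ≥0∞} (hg : ∀ k, Measurable (g k)) :
    Lqnorm q (Ioi 0) (fun t => ∑' k, g k t) ≤ ∑' k, Lqnorm q (Ioi 0) (g k) := by
  simp_rw [ENNReal.tsum_eq_iSup_nat (f := fun k => g k _)]
  refine Lq_iSup q hq (G := fun K t => ∑ k ∈ Finset.range K, g k t)
    (fun K => Finset.measurable_sum _ fun k _ => hg k) ?_ _ ?_
  · intro i j hij t
    exact Finset.sum_le_sum_of_subset (Finset.range_mono hij)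
  · intro K
    exact (Lq_sum q hq hg K).trans (ENNReal.sum_le_tsum _)

lemma map_mu0 {c : ℝ} (hc : 0 < c) :
    Measure.map (fun t => c * t) mu0 = ENNReal.ofReal c⁻¹ • mu0 := by
  unfold mu0
  have h1 : Ioi (0:ℝ) = (fun t => c * t) ⁻¹' (Ioi 0) := by
    ext x; simp [hc]
  conv_lhs => rw [h1]
  rw [← Measure.restrict_map (by fun_prop) measurableSet_Ioi]
  have := Real.map_volume_mul_left hc.ne'
  have h2 : (fun t => c * t) = (c * ·) := rfl
  rw [h2, this, Measure.restrict_smul, abs_of_pos (inv_pos.2 hc)]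

lemma Lq_dil (q : ℝ≥0∞) (hq : 1 ≤ q) {g : ℝ → ℝ≥0∞} (hg : Measurable g) {c : ℝ} (hc : 0 < c) :
    Lqnorm q (Ioi 0) (fun t => g (c * t))
      = ENNReal.ofReal (c ^ (-q⁻¹.toReal)) * Lqnorm q (Ioi 0) g := by
  rw [Lqnorm_eq q hq, Lqnorm_eq q hq]
  have := eLpNorm_map_measure (μ := mu0) (f := fun t => c * t) (g := g) (p := q)
    hg.aestronglyMeasurable (by fun_prop)
  have h2 : (fun t => g (c * t)) = g ∘ (fun t => c * t) := rfl
  rw [h2, ← this, map_mu0 hc, eLpNorm_smul_measure_of_ne_zero]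
  · rw [smul_eq_mul, ENNReal.ofReal_rpow_of_pos (inv_pos.2 hc), one_div, Real.inv_rpow hc.le,
      Real.rpow_neg hc.le]
  · simpa using hc

lemma mu0_dil {g : ℝ → ℝ≥0∞} (hg : Measurable g) {c : ℝ} (hc : 0 < c) :
    ∫⁻ t, g (c * t) ∂mu0 = ENNReal.ofReal c⁻¹ * ∫⁻ t, g t ∂mu0 := by
  rw [← lintegral_map (f := g) hg (by fun_prop : Measurable fun t => c * t), map_mu0 hc,
    lintegral_smul_measure, smul_eq_mul]

lemma pow_compare {x y k a : ℝ} (hx : 1 ≤ x) (hy : 1 ≤ y) (hk : 1 ≤ k)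
    (h1 : y ≤ x * k) (h2 : x ≤ y * k) : y ^ a ≤ x ^ a * k ^ |a| := by
  have hx0 : 0 < x := by linarith
  have hy0 : 0 < y := by linarith
  have hk0 : 0 < k := by linarith
  rcases le_or_gt 0 a with ha | ha
  · rw [abs_of_nonneg ha, ← Real.mul_rpow hx0.le hk0.le]
    exact Real.rpow_le_rpow hy0.le h1 ha
  · rw [abs_of_neg ha]
    have := Real.rpow_le_rpow_of_nonpos hx0 h2 ha.le
    rw [Real.mul_rpow hy0.le hk0.le] at this
    calc y ^ a = y ^ a * k ^ a * k ^ (-a) := by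
          rw [mul_assoc, ← Real.rpow_add hk0]; simp
      _ ≤ _ := by gcongr

lemma ell_eq (a0 ai : ℝ) {t : ℝ} :
    ell a0 ai t = if t < 1 then (1 - Real.log t) ^ a0 else (1 + Real.log t) ^ ai := rfl

lemma ell_pos (a0 ai : ℝ) {t : ℝ} (ht : 0 < t) : 0 < ell a0 ai t := by
  unfold ell
  split_ifs with h
  · have := Real.log_neg ht h
    apply Real.rpow_pos_of_pos; linarith
  · have := Real.log_nonneg (not_lt.1 h)
    apply Real.rpow_pos_of_pos; linarith

/-- exponent controlling the dilation behaviour of `ell` -/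
def Mexp (a0 ai : ℝ) : ℕ := ⌈|a0| + |ai|⌉₊

lemma ell_dil (a0 ai : ℝ) {t c : ℝ} (ht : 0 < t) (hc : 0 < c) :
    ell a0 ai (c * t) ≤ ell a0 ai t * (1 + |Real.log c|) ^ (Mexp a0 ai) := by
  have hct : 0 < c * t := mul_pos hc ht
  have hk : 1 ≤ 1 + |Real.log c| := by linarith [abs_nonneg (Real.log c)]
  have hk0 : 0 < 1 + |Real.log c| := by linarith
  have hlog : Real.log (c * t) = Real.log c + Real.log t := Real.log_mul hc.ne' ht.ne'
  have hM : |a0| + |ai| ≤ (Mexp a0 ai : ℝ) := Nat.le_ceil _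
  have k1 : (1 + |Real.log c|) ^ |a0| ≤ (1 + |Real.log c|) ^ (Mexp a0 ai) := by
    rw [← Real.rpow_natCast]
    exact Real.rpow_le_rpow_of_exponent_le hk (by linarith [abs_nonneg ai])
  have k2 : (1 + |Real.log c|) ^ |ai| ≤ (1 + |Real.log c|) ^ (Mexp a0 ai) := by
    rw [← Real.rpow_natCast]
    exact Real.rpow_le_rpow_of_exponent_le hk (by linarith [abs_nonneg a0])
  have k3 : (1 + |Real.log c|) ^ |a0| * (1 + |Real.log c|) ^ |ai|
      ≤ (1 + |Real.log c|) ^ (Mexp a0 ai) := by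
    rw [← Real.rpow_natCast, ← Real.rpow_add hk0]
    exact Real.rpow_le_rpow_of_exponent_le hk hM
  have hc1 := le_abs_self (Real.log c)
  have hc2 := neg_abs_le (Real.log c)
  have hpos := ell_pos a0 ai ht
  rw [ell_eq] at hpos
  simp only [ell_eq]
  by_cases h1 : c * t < 1
  · have l1 := Real.log_neg hct h1
    by_cases h2 : t < 1
    · have l2 := Real.log_neg ht h2
      simp only [h1, h2, if_true] at hpos ⊢
      refine (pow_compare (k := 1 + |Real.log c|) (x := 1 - Real.log t) ?_ ?_ hk ?_ ?_).trans
        (mul_le_mul_of_nonneg_left k1 hpos.le)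
      · linarith
      · linarith
      · rw [hlog]; nlinarith
      · rw [hlog] at *; nlinarith
    · have l2 := Real.log_nonneg (not_lt.1 h2)
      simp only [h1, h2, if_true, if_false] at hpos ⊢
      have e1 : (1 - Real.log (c * t)) ^ a0 ≤ 1 ^ a0 * (1 + |Real.log c|) ^ |a0| :=
        pow_compare le_rfl (by linarith) hk (by linarith) (by nlinarith)
      have e2 : 1 ^ ai ≤ (1 + Real.log t) ^ ai * (1 + |Real.log c|) ^ |ai| :=
        pow_compare (by linarith) le_rfl hk (by nlinarith) (by linarith)
      rw [Real.one_rpow] at e1 e2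
      have : 0 ≤ (1 + |Real.log c|) ^ |a0| := by positivity
      nlinarith
  · have l1 := Real.log_nonneg (not_lt.1 h1)
    by_cases h2 : t < 1
    · have l2 := Real.log_neg ht h2
      simp only [h1, h2, if_true, if_false] at hpos ⊢
      have e1 : (1 + Real.log (c * t)) ^ ai ≤ 1 ^ ai * (1 + |Real.log c|) ^ |ai| :=
        pow_compare le_rfl (by linarith) hk (by linarith) (by nlinarith)
      have e2 : 1 ^ a0 ≤ (1 - Real.log t) ^ a0 * (1 + |Real.log c|) ^ |a0| :=
        pow_compare (by linarith) le_rfl hk (by nlinarith) (by linarith)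
      rw [Real.one_rpow] at e1 e2
      have : 0 ≤ (1 + |Real.log c|) ^ |ai| := by positivity
      nlinarith
    · have l2 := Real.log_nonneg (not_lt.1 h2)
      simp only [h1, h2, if_false] at hpos ⊢
      refine (pow_compare (k := 1 + |Real.log c|) (x := 1 + Real.log t) ?_ ?_ hk ?_ ?_).trans
        (mul_le_mul_of_nonneg_left k2 hpos.le)
      · linarith
      · linarith
      · rw [hlog]; nlinarith
      · rw [hlog] at *; nlinarith

lemma ell_measurable (a0 ai : ℝ) : Measurable (ell a0 ai) := by
  unfold ell
  refine Measurable.ite measurableSet_Iio ?_ ?_ <;> fun_prop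

/-- the Lorentz-Zygmund weight -/
def wt (r : ℝ) (q : ℝ≥0∞) (a0 ai : ℝ) (t : ℝ) : ℝ≥0∞ :=
  ENNReal.ofReal (t ^ (r - q⁻¹.toReal) * ell a0 ai t)

/-- weighted norm without rearrangement -/
def NN (r : ℝ) (q : ℝ≥0∞) (a0 ai : ℝ) (g : ℝ → ℝ≥0∞) : ℝ≥0∞ :=
  Lqnorm q (Ioi 0) (fun t => wt r q a0 ai t * g t)

lemma wt_measurable (r : ℝ) (q : ℝ≥0∞) (a0 ai : ℝ) : Measurable (wt r q a0 ai) := by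
  unfold wt
  have := ell_measurable a0 ai
  fun_prop

lemma wt_dil (r : ℝ) (q : ℝ≥0∞) (a0 ai : ℝ) {c t : ℝ} (hc : 0 < c) (ht : 0 < t) :
    wt r q a0 ai t ≤ ENNReal.ofReal (c ^ (-(r - q⁻¹.toReal)) *
      (1 + |Real.log c|) ^ (Mexp a0 ai)) * wt r q a0 ai (c * t) := by
  unfold wt
  rw [← ENNReal.ofReal_mul (by positivity)]
  refine ENNReal.ofReal_le_ofReal ?_
  have h := ell_dil a0 ai (t := c * t) (c := c⁻¹) (by positivity) (by positivity)
  rw [inv_mul_cancel_left₀ hc.ne', Real.log_inv, abs_neg] at h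
  rw [Real.mul_rpow hc.le ht.le]
  have e : c ^ (-(r - q⁻¹.toReal)) * c ^ (r - q⁻¹.toReal) = 1 := by
    rw [← Real.rpow_add hc]; simp
  calc t ^ (r - q⁻¹.toReal) * ell a0 ai t
      ≤ t ^ (r - q⁻¹.toReal) * (ell a0 ai (c * t) * (1 + |Real.log c|) ^ (Mexp a0 ai)) := by
        gcongr
    _ = (c ^ (-(r - q⁻¹.toReal)) * c ^ (r - q⁻¹.toReal)) * t ^ (r - q⁻¹.toReal)
        * (ell a0 ai (c * t) * (1 + |Real.log c|) ^ (Mexp a0 ai)) := by rw [e, one_mul]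
    _ = _ := by ring

lemma NN_dil (r : ℝ) (q : ℝ≥0∞) (hq : 1 ≤ q) (a0 ai : ℝ) {c : ℝ} (hc : 0 < c)
    {g : ℝ → ℝ≥0∞} (hg : Measurable g) :
    NN r q a0 ai (fun t => g (c * t)) ≤
      ENNReal.ofReal (c ^ (-r) * (1 + |Real.log c|) ^ (Mexp a0 ai)) * NN r q a0 ai g := by
  unfold NN
  set K : ℝ := c ^ (-(r - q⁻¹.toReal)) * (1 + |Real.log c|) ^ (Mexp a0 ai) with hK
  have h1 : Lqnorm q (Ioi 0) (fun t => wt r q a0 ai t * g (c * t)) ≤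
      Lqnorm q (Ioi 0) (fun t => ENNReal.ofReal K * (wt r q a0 ai (c * t) * g (c * t))) := by
    refine Lq_mono q hq fun t ht => ?_
    rw [← mul_assoc]
    gcongr
    exact wt_dil r q a0 ai hc ht
  refine h1.trans ?_
  rw [Lq_const_mul q hq _ ENNReal.ofReal_ne_top,
    Lq_dil q hq (g := fun t => wt r q a0 ai t * g t) ((wt_measurable r q a0 ai).mul hg) hc,
    ← mul_assoc, ← ENNReal.ofReal_mul (by positivity)]
  refine mul_le_mul' (ENNReal.ofReal_le_ofReal (le_of_eq ?_)) le_rfl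
  rw [hK]
  have : c ^ (-r) = c ^ (-(r - q⁻¹.toReal)) * c ^ (-q⁻¹.toReal) := by
    rw [← Real.rpow_add hc]; congr 1; ring
  rw [this]
  ring


lemma dyadic_low {φ : ℝ → ℝ≥0∞} (hφ : Antitone φ) {t : ℝ} (ht : 0 < t) :
    ∫⁻ s in Ioc 0 t, φ s ≤
      ∑' k : ℕ, ENNReal.ofReal ((1/2:ℝ) ^ (k+1) * t) * φ ((1/2:ℝ) ^ (k+1) * t) := by
  have hsub : Ioc 0 t ⊆ ⋃ k : ℕ, Ioc ((1/2:ℝ) ^ (k+1) * t) ((1/2:ℝ) ^ k * t) := by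
    intro x hx
    have h1 : 0 < x / t := div_pos hx.1 ht
    have h2 : x / t ≤ 1 := (div_le_one ht).2 hx.2
    obtain ⟨k, hk1, hk2⟩ := exists_nat_pow_near_of_lt_one h1 h2 (by norm_num : (0:ℝ) < 1/2)
      (by norm_num)
    refine mem_iUnion.2 ⟨k, ?_, ?_⟩
    · rwa [lt_div_iff₀ ht] at hk1
    · rwa [div_le_iff₀ ht] at hk2
  refine (lintegral_mono_set hsub).trans ((lintegral_iUnion_le _ _).trans ?_)
  refine ENNReal.tsum_le_tsum fun k => ?_
  calc ∫⁻ s in Ioc ((1/2:ℝ) ^ (k+1) * t) ((1/2:ℝ) ^ k * t), φ s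
      ≤ ∫⁻ s in Ioc ((1/2:ℝ) ^ (k+1) * t) ((1/2:ℝ) ^ k * t), φ ((1/2:ℝ) ^ (k+1) * t) :=
        setLIntegral_mono' measurableSet_Ioc fun s hs => hφ hs.1.le
    _ = _ := by
        rw [setLIntegral_const, Real.volume_Ioc, mul_comm]
        congr 2
        ring

lemma dyadic_high (m n : ℕ) (hn : 0 < n) (hmn : m < n) {φ : ℝ → ℝ≥0∞} (hφ : Antitone φ) {t : ℝ}
    (ht : 0 < t) :
    hardyOp m n φ t ≤
      ∑' k : ℕ, ENNReal.ofReal (((2:ℝ) ^ k * t) ^ ((m:ℝ)/n)) * φ ((2:ℝ) ^ k * t) := by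
  have hn' : (0:ℝ) < n := by exact_mod_cast hn
  have hθ : (m:ℝ)/n - 1 ≤ 0 := by
    rw [sub_nonpos, div_le_one hn']; exact_mod_cast hmn.le
  have hsub : Ioi t ⊆ ⋃ k : ℕ, Ico ((2:ℝ) ^ k * t) ((2:ℝ) ^ (k+1) * t) := by
    intro x hx
    have h2 : 1 ≤ x / t := (one_le_div ht).2 (le_of_lt hx)
    obtain ⟨k, hk1, hk2⟩ := exists_nat_pow_near h2 (by norm_num : (1:ℝ) < 2)
    refine mem_iUnion.2 ⟨k, ?_, ?_⟩
    · rwa [le_div_iff₀ ht] at hk1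
    · rwa [div_lt_iff₀ ht] at hk2
  unfold hardyOp
  refine (lintegral_mono_set hsub).trans ((lintegral_iUnion_le _ _).trans ?_)
  refine ENNReal.tsum_le_tsum fun k => ?_
  have hp : 0 < (2:ℝ) ^ k * t := by positivity
  calc ∫⁻ s in Ico ((2:ℝ) ^ k * t) ((2:ℝ) ^ (k+1) * t), φ s * ENNReal.ofReal (s ^ ((m:ℝ)/n - 1))
      ≤ ∫⁻ s in Ico ((2:ℝ) ^ k * t) ((2:ℝ) ^ (k+1) * t), φ ((2:ℝ) ^ k * t) *
          ENNReal.ofReal (((2:ℝ) ^ k * t) ^ ((m:ℝ)/n - 1)) :=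
        setLIntegral_mono' measurableSet_Ico fun s hs =>
          mul_le_mul' (hφ hs.1)
            (ENNReal.ofReal_le_ofReal (Real.rpow_le_rpow_of_nonpos hp hs.1 hθ))
    _ = _ := by
        rw [setLIntegral_const, Real.volume_Ico, mul_assoc, ← ENNReal.ofReal_mul (by positivity),
          mul_comm]
        congr 2
        have : (2:ℝ) ^ (k+1) * t - 2 ^ k * t = 2 ^ k * t := by ring
        rw [this, Real.rpow_sub_one hp.ne']
        field_simp

lemma wt_mul (b θ : ℝ) (q : ℝ≥0∞) (a0 ai : ℝ) {t : ℝ} (ht : 0 < t) :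
    wt b q a0 ai t * ENNReal.ofReal (t ^ θ) = wt (b + θ) q a0 ai t := by
  unfold wt
  have := ell_pos a0 ai ht
  rw [← ENNReal.ofReal_mul (by positivity)]
  congr 1
  have e : b + θ - q⁻¹.toReal = (b - q⁻¹.toReal) + θ := by ring
  rw [e, Real.rpow_add ht]
  ring

lemma sum_fin {x : ℝ} (hx0 : 0 < x) (hx1 : x < 1) (M : ℕ) :
    (∑' k : ℕ, ENNReal.ofReal (x ^ k * (1 + k) ^ M)) ≠ ∞ := by
  have h := summable_pow_mul_geometric_of_norm_lt_one M
    (r := x) (by rw [Real.norm_eq_abs, abs_of_pos hx0]; exact hx1)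
  have h2 := (summable_nat_add_iff (f := fun n : ℕ => (n:ℝ) ^ M * x ^ n) 1).2 h
  have h3 : Summable (fun k : ℕ => x ^ k * (1 + (k:ℝ)) ^ M) := by
    refine (h2.mul_left x⁻¹).congr ?_
    intro k
    push_cast
    rw [pow_succ]
    field_simp
    ring
  exact h3.tsum_ofReal_ne_top

lemma NN_tsum_dil (r : ℝ) (q : ℝ≥0∞) (hq : 1 ≤ q) (a0 ai : ℝ) {φ : ℝ → ℝ≥0∞}
    (hφ : Measurable φ) (d c : ℕ → ℝ) (hd : ∀ k, 0 < d k) (hc : ∀ k, 0 < c k) :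
    NN r q a0 ai (fun t => ∑' k, ENNReal.ofReal (d k) * φ (c k * t)) ≤
      (∑' k, ENNReal.ofReal (d k * (c k ^ (-r) * (1 + |Real.log (c k)|) ^ (Mexp a0 ai))))
        * NN r q a0 ai φ := by
  have h1 : NN r q a0 ai (fun t => ∑' k, ENNReal.ofReal (d k) * φ (c k * t)) =
      Lqnorm q (Ioi 0) (fun t => ∑' k, ENNReal.ofReal (d k) *
        (wt r q a0 ai t * φ (c k * t))) := by
    unfold NN
    congr 1
    funext t
    rw [← ENNReal.tsum_mul_left]
    congr 1; funext k
    ring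
  rw [h1, ← ENNReal.tsum_mul_right]
  have hw := wt_measurable r q a0 ai
  refine (Lq_tsum q hq (fun k => by fun_prop)).trans ?_
  refine ENNReal.tsum_le_tsum fun k => ?_
  rw [Lq_const_mul q hq _ ENNReal.ofReal_ne_top, ENNReal.ofReal_mul (hd k).le, mul_assoc]
  exact mul_le_mul' le_rfl (NN_dil r q hq a0 ai (hc k) hφ)

lemma NN_mono (r : ℝ) (q : ℝ≥0∞) (hq : 1 ≤ q) (a0 ai : ℝ) {g g' : ℝ → ℝ≥0∞}
    (h : ∀ t, 0 < t → g t ≤ g' t) : NN r q a0 ai g ≤ NN r q a0 ai g' :=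
  Lq_mono q hq fun t ht => mul_le_mul' le_rfl (h t ht)

lemma NN_shift (b θ : ℝ) (q : ℝ≥0∞) (hq : 1 ≤ q) (a0 ai : ℝ) (g : ℝ → ℝ≥0∞) :
    NN b q a0 ai (fun t => ENNReal.ofReal (t ^ θ) * g t) = NN (b + θ) q a0 ai g := by
  refine Lq_congr q hq fun t ht => ?_
  rw [← mul_assoc, wt_mul _ _ _ _ _ ht]

lemma log_pow_bound (j : ℕ) : |Real.log ((2:ℝ) ^ j)| ≤ j := by
  rw [Real.log_pow, abs_of_nonneg (by positivity)]
  have : Real.log 2 ≤ 1 := by linarith [Real.log_two_lt_d9]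
  nlinarith [(Nat.cast_nonneg j : (0:ℝ) ≤ j)]

/-- lower Hardy inequality -/
lemma hardy_low (b θ : ℝ) (hbθ : b + θ < 1) (q : ℝ≥0∞) (hq : 1 ≤ q) (a0 ai : ℝ) :
    ∃ C : ℝ≥0∞, C ≠ ∞ ∧ ∀ φ : ℝ → ℝ≥0∞, Antitone φ →
      NN b q a0 ai (fun t => ENNReal.ofReal (t ^ (θ - 1)) * ∫⁻ s in Ioc 0 t, φ s)
        ≤ C * NN (b + θ) q a0 ai φ := by
  set r := b + θ
  set x : ℝ := 2 ^ (r - 1)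
  have hx0 : 0 < x := by positivity
  have hx1 : x < 1 := Real.rpow_lt_one_of_one_lt_of_neg (by norm_num) (by linarith)
  refine ⟨∑' k : ℕ, ENNReal.ofReal (x ^ k * (1 + k) ^ (Mexp a0 ai)), sum_fin hx0 hx1 _, ?_⟩
  intro φ hφ
  have h1 : NN b q a0 ai (fun t => ENNReal.ofReal (t ^ (θ - 1)) * ∫⁻ s in Ioc 0 t, φ s) ≤
      NN b q a0 ai (fun t => ENNReal.ofReal (t ^ θ) *
        ∑' k : ℕ, ENNReal.ofReal ((1/2:ℝ) ^ (k+1)) * φ ((1/2:ℝ) ^ (k+1) * t)) := by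
    refine NN_mono _ _ hq _ _ fun t ht => ?_
    refine (mul_le_mul' le_rfl (dyadic_low hφ ht)).trans (le_of_eq ?_)
    rw [← ENNReal.tsum_mul_left, ← ENNReal.tsum_mul_left]
    congr 1; funext k
    rw [← mul_assoc, ← mul_assoc, ← ENNReal.ofReal_mul (by positivity),
      ← ENNReal.ofReal_mul (by positivity), Real.rpow_sub_one ht.ne']
    congr 2
    field_simp
  refine h1.trans ?_
  rw [NN_shift b θ q hq]
  refine (NN_tsum_dil r q hq a0 ai hφ.measurable _ _ (fun k => by positivity)
    (fun k => by positivity)).trans ?_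
  refine mul_le_mul' ?_ le_rfl
  have key : ∀ k : ℕ, (1/2:ℝ) ^ (k+1) * (((1/2:ℝ) ^ (k+1)) ^ (-r) *
      (1 + |Real.log ((1/2:ℝ) ^ (k+1))|) ^ (Mexp a0 ai)) ≤
      x ^ (k+1) * (1 + ((k+1 : ℕ):ℝ)) ^ (Mexp a0 ai) := by
    intro k
    have e : (1/2:ℝ) ^ (k+1) = ((2:ℝ) ^ (k+1))⁻¹ := by simp
    have e2 : x ^ (k+1) = ((2:ℝ) ^ (k+1)) ^ (r - 1) := by
      rw [← Real.rpow_natCast, ← Real.rpow_natCast, ← Real.rpow_mul (by norm_num),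
        ← Real.rpow_mul (by norm_num)]
      congr 1; ring
    have hp : (0:ℝ) < 2 ^ (k+1) := by positivity
    rw [e, e2, Real.log_inv, abs_neg, ← mul_assoc]
    have e3 : ((2:ℝ) ^ (k+1))⁻¹ * (((2:ℝ) ^ (k+1))⁻¹) ^ (-r) = ((2:ℝ) ^ (k+1)) ^ (r - 1) := by
      rw [Real.inv_rpow hp.le, Real.rpow_neg hp.le, inv_inv, Real.rpow_sub_one hp.ne']
      field_simp
    rw [e3]
    gcongr
    exact log_pow_bound (k+1)
  calc _ ≤ ∑' k : ℕ, ENNReal.ofReal (x ^ (k+1) * (1 + ((k+1 : ℕ):ℝ)) ^ (Mexp a0 ai)) :=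
        ENNReal.tsum_le_tsum fun k => ENNReal.ofReal_le_ofReal (key k)
    _ ≤ _ := ENNReal.tsum_comp_le_tsum_of_injective (add_left_injective 1)
        (fun k : ℕ => ENNReal.ofReal (x ^ k * (1 + (k:ℝ)) ^ (Mexp a0 ai)))

/-- upper Hardy inequality -/
lemma hardy_high (m n : ℕ) (hn : 0 < n) (hmn : m < n) (b : ℝ) (hb : 0 < b) (q : ℝ≥0∞)
    (hq : 1 ≤ q) (a0 ai : ℝ) :
    ∃ C : ℝ≥0∞, C ≠ ∞ ∧ ∀ φ : ℝ → ℝ≥0∞, Antitone φ →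
      NN b q a0 ai (hardyOp m n φ) ≤ C * NN (b + (m:ℝ)/n) q a0 ai φ := by
  set θ : ℝ := (m:ℝ)/n with hθ
  set r := b + θ with hr
  set x : ℝ := 2 ^ (-b)
  have hx0 : 0 < x := by positivity
  have hx1 : x < 1 := Real.rpow_lt_one_of_one_lt_of_neg (by norm_num) (by linarith)
  refine ⟨∑' k : ℕ, ENNReal.ofReal (x ^ k * (1 + k) ^ (Mexp a0 ai)), sum_fin hx0 hx1 _, ?_⟩
  intro φ hφ
  have h1 : NN b q a0 ai (hardyOp m n φ) ≤
      NN b q a0 ai (fun t => ENNReal.ofReal (t ^ θ) *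
        ∑' k : ℕ, ENNReal.ofReal (((2:ℝ) ^ k) ^ θ) * φ ((2:ℝ) ^ k * t)) := by
    refine NN_mono _ _ hq _ _ fun t ht => ?_
    refine (dyadic_high m n hn hmn hφ ht).trans (le_of_eq ?_)
    rw [← ENNReal.tsum_mul_left]
    congr 1; funext k
    rw [← mul_assoc, ← ENNReal.ofReal_mul (by positivity), Real.mul_rpow (by positivity) ht.le,
      mul_comm (t ^ θ)]
  refine h1.trans ?_
  rw [NN_shift b θ q hq]
  refine (NN_tsum_dil r q hq a0 ai hφ.measurable _ _ (fun k => by positivity)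
    (fun k => by positivity)).trans ?_
  refine mul_le_mul' ?_ le_rfl
  refine ENNReal.tsum_le_tsum fun k => ENNReal.ofReal_le_ofReal ?_
  have hp : (0:ℝ) < 2 ^ k := by positivity
  have e2 : x ^ k = ((2:ℝ) ^ k) ^ θ * ((2:ℝ) ^ k) ^ (-r) := by
    rw [← Real.rpow_add hp, ← Real.rpow_natCast, ← Real.rpow_natCast,
      ← Real.rpow_mul (by norm_num), ← Real.rpow_mul (by norm_num), hr]
    congr 1; ring
  rw [e2, ← mul_assoc]
  gcongr
  exact log_pow_bound k

/-- doubling lower bound -/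
lemma hardy_lower (m n : ℕ) (hn : 0 < n) (hmn : m < n) (b : ℝ) (q : ℝ≥0∞)
    (hq : 1 ≤ q) (a0 ai : ℝ) :
    ∃ C : ℝ≥0∞, C ≠ 0 ∧ C ≠ ∞ ∧ ∀ φ : ℝ → ℝ≥0∞, Antitone φ →
      NN (b + (m:ℝ)/n) q a0 ai φ ≤ C * NN b q a0 ai (hardyOp m n φ) := by
  have hn' : (0:ℝ) < n := by exact_mod_cast hn
  have hθ : (m:ℝ)/n - 1 ≤ 0 := by
    rw [sub_nonpos, div_le_one hn']; exact_mod_cast hmn.le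
  set θ : ℝ := (m:ℝ)/n with hθd
  set r := b + θ with hr
  set D : ℝ := (1/2:ℝ) ^ (-r) * (1 + |Real.log (1/2:ℝ)|) ^ (Mexp a0 ai) with hD
  have hD0 : 0 < D := by positivity
  set E : ℝ := (2:ℝ) ^ (1 - θ) with hE
  have hE0 : 0 < E := by positivity
  refine ⟨ENNReal.ofReal D * ENNReal.ofReal E, ?_, ?_, ?_⟩
  · simp [hD0, hE0]
  · exact ENNReal.mul_ne_top ENNReal.ofReal_ne_top ENNReal.ofReal_ne_top
  intro φ hφ
  have h0 := NN_dil r q hq a0 ai (c := 1/2) (by norm_num) (g := fun t => φ (2 * t))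
    (by have := hφ.measurable; fun_prop)
  have e0 : (fun t : ℝ => φ (2 * (1/2 * t))) = φ := by
    funext t; congr 1; ring
  simp only [e0] at h0
  refine h0.trans ?_
  rw [mul_assoc]
  refine mul_le_mul' le_rfl ?_
  rw [← NN_shift b θ q hq]
  have e1 : ENNReal.ofReal E * NN b q a0 ai (hardyOp m n φ) =
      NN b q a0 ai (fun t => ENNReal.ofReal E * hardyOp m n φ t) := by
    unfold NN
    rw [← Lq_const_mul q hq _ ENNReal.ofReal_ne_top]
    congr 1; funext t; ring
  rw [e1]
  refine NN_mono _ _ hq _ _ fun t ht => ?_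
  have h2 : φ (2 * t) * ENNReal.ofReal ((2 * t) ^ (θ - 1)) * ENNReal.ofReal t
      ≤ hardyOp m n φ t := by
    calc φ (2 * t) * ENNReal.ofReal ((2 * t) ^ (θ - 1)) * ENNReal.ofReal t
        = ∫⁻ s in Ioc t (2 * t), φ (2 * t) * ENNReal.ofReal ((2 * t) ^ (θ - 1)) := by
          rw [setLIntegral_const, Real.volume_Ioc]
          congr 2; ring
      _ ≤ ∫⁻ s in Ioc t (2 * t), φ s * ENNReal.ofReal (s ^ (θ - 1)) :=
          setLIntegral_mono' measurableSet_Ioc fun s hs =>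
            mul_le_mul' (hφ hs.2) (ENNReal.ofReal_le_ofReal
              (Real.rpow_le_rpow_of_nonpos (ht.trans hs.1) hs.2 hθ))
      _ ≤ _ := lintegral_mono_set Ioc_subset_Ioi_self
  refine le_trans (le_of_eq ?_) (mul_le_mul' le_rfl h2)
  rw [mul_assoc, ← ENNReal.ofReal_mul (by positivity), mul_comm (φ _), ← mul_assoc,
    ← ENNReal.ofReal_mul (by positivity)]
  congr 2
  rw [hE, Real.mul_rpow (by norm_num) ht.le, Real.rpow_sub_one ht.ne' θ]
  have : (2:ℝ) ^ (1 - θ) * 2 ^ (θ - 1) = 1 := by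
    rw [← Real.rpow_add (by norm_num)]; simp
  calc t ^ θ = (2 ^ (1 - θ) * 2 ^ (θ - 1)) * t ^ θ := by rw [this, one_mul]
    _ = _ := by field_simp


lemma LZ_hardy (m n : ℕ) (b : ℝ) (q : ℝ≥0∞) (hq : 1 ≤ q) (a0 ai : ℝ) (h : ℝ → ℝ≥0∞) :
    LZnorm b q a0 ai (hardyOp m n h) = NN b q a0 ai (hardyOp m n h) := by
  refine Lq_congr q hq fun t ht => ?_
  rw [rearr_hardyOp m n h ht]
  rfl

lemma LZ_eq (b : ℝ) (q : ℝ≥0∞) (a0 ai : ℝ) (h : ℝ → ℝ≥0∞) :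
    LZnorm b q a0 ai h = NN b q a0 ai (rearr h) := rfl

lemma hardyOp_HL (m n : ℕ) (hn : 0 < n) (hmn : m < n) {h : ℝ → ℝ≥0∞} (hh : Measurable h)
    {t : ℝ} (ht : 0 < t) :
    hardyOp m n h t ≤ ENNReal.ofReal (t ^ ((m:ℝ)/n - 1)) * (∫⁻ s in Ioc 0 t, rearr h s)
      + hardyOp m n (rearr h) t := by
  have hn' : (0:ℝ) < n := by exact_mod_cast hn
  have hθ : (m:ℝ)/n - 1 ≤ 0 := by
    rw [sub_nonpos, div_le_one hn']; exact_mod_cast hmn.le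
  set W : ℝ → ℝ≥0∞ := fun s => ENNReal.ofReal ((max s t) ^ ((m:ℝ)/n - 1)) with hW
  have hWm : Measurable W := by rw [hW]; fun_prop
  have hWa : AntitoneOn W (Ioi 0) := by
    intro x hx y hy hxy
    refine ENNReal.ofReal_le_ofReal (Real.rpow_le_rpow_of_nonpos ?_ (max_le_max_right t hxy) hθ)
    exact lt_max_of_lt_right ht
  have h1 : hardyOp m n h t ≤ ∫⁻ s, h s * W s ∂mu0 := by
    unfold hardyOp mu0
    calc _ = ∫⁻ s in Ioi t, h s * W s := by
          refine setLIntegral_congr_fun measurableSet_Ioi fun s hs => ?_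
          simp only [hW]
          rw [max_eq_left (le_of_lt hs)]
      _ ≤ _ := lintegral_mono_set (Ioi_subset_Ioi ht.le)
  refine h1.trans ((hardy_littlewood h W hh hWm hWa).trans (le_of_eq ?_))
  have hm := rearr_measurable h
  unfold mu0 hardyOp
  rw [← Ioc_union_Ioi_eq_Ioi ht.le, lintegral_union measurableSet_Ioi
    (Set.disjoint_left.2 fun x hx hx' => absurd hx.2 (not_le.2 hx'))]
  congr 1
  · rw [← lintegral_const_mul _ hm]
    refine setLIntegral_congr_fun measurableSet_Ioc fun s hs => ?_
    simp only [hW]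
    rw [max_eq_right hs.2, mul_comm]
  · refine setLIntegral_congr_fun measurableSet_Ioi fun s hs => ?_
    simp only [hW]
    rw [max_eq_left (le_of_lt hs)]

lemma tau_lower (m n : ℕ) (b : ℝ) (q : ℝ≥0∞) (hq : 1 ≤ q) (a0 ai : ℝ) (f : ℝ → ℝ≥0∞) :
    NN b q a0 ai (hardyOp m n (rearr f)) ≤ tauFun m n (LZnorm b q a0 ai) f := by
  rw [← LZ_hardy m n b q hq]
  unfold tauFun
  exact le_iSup₂_of_le (rearr f) (rearr_measurable f) (le_iSup_of_le (rearr_rearr f) le_rfl)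

lemma tau_upper (m n : ℕ) (hn : 0 < n) (hmn : m < n) (b : ℝ) (hb : b + (m:ℝ)/n < 1) (q : ℝ≥0∞)
    (hq : 1 ≤ q) (a0 ai : ℝ) :
    ∃ C : ℝ≥0∞, C ≠ ∞ ∧ ∀ f : ℝ → ℝ≥0∞, tauFun m n (LZnorm b q a0 ai) f ≤
      C * NN (b + (m:ℝ)/n) q a0 ai (rearr f) + NN b q a0 ai (hardyOp m n (rearr f)) := by
  obtain ⟨C, hC, H⟩ := hardy_low b ((m:ℝ)/n) hb q hq a0 ai
  refine ⟨C, hC, fun f => ?_⟩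
  unfold tauFun
  refine iSup₂_le fun h hh => iSup_le fun he => ?_
  rw [LZ_hardy m n b q hq]
  have hmono : Monotone (fun t : ℝ => ∫⁻ s in Ioc 0 t, rearr f s) := fun s t hst =>
    lintegral_mono_set (Ioc_subset_Ioc_right hst)
  have hm1 := hmono.measurable
  have hm2 := (hardyOp_antitone m n (rearr f)).measurable
  have hw := wt_measurable b q a0 ai
  calc NN b q a0 ai (hardyOp m n h)
      ≤ Lqnorm q (Ioi 0) (fun t => wt b q a0 ai t *
          (ENNReal.ofReal (t ^ ((m:ℝ)/n - 1)) * (∫⁻ s in Ioc 0 t, rearr f s)) +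
          wt b q a0 ai t * hardyOp m n (rearr f) t) := by
        refine Lq_mono q hq fun t ht => ?_
        rw [← mul_add, ← he]
        exact mul_le_mul' le_rfl (hardyOp_HL m n hn hmn hh ht)
    _ ≤ _ := Lq_add q hq (by fun_prop) (by fun_prop)
    _ ≤ _ := add_le_add (H _ (rearr_antitone f)) le_rfl

lemma item4 (m n : ℕ) (hn : 0 < n) (hmn : m < n) (b : ℝ) (hb0 : 0 < b) (hb : b + (m:ℝ)/n < 1)
    (q : ℝ≥0∞) (hq : 1 ≤ q) (a0 ai : ℝ) :
    EquivNorms (LZnorm (b + (m : ℝ)/(n : ℝ)) q a0 ai) (tauFun m n (LZnorm b q a0 ai)) := by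
  obtain ⟨C1, hC1, H1⟩ := tau_upper m n hn hmn b hb q hq a0 ai
  obtain ⟨C2, hC2, H2⟩ := hardy_high m n hn hmn b hb0 q hq a0 ai
  obtain ⟨C3, hC3, hC3', H3⟩ := hardy_lower m n hn hmn b q hq a0 ai
  refine ⟨C3⁻¹, C1 + C2 + 1, by simpa using hC3', by simpa [pos_iff_ne_zero] using hC3,
    by positivity, by simp [hC1, hC2, lt_top_iff_ne_top], fun f _ => ⟨?_, ?_⟩⟩
  · rw [LZ_eq, mul_comm, ← div_eq_mul_inv]
    refine ENNReal.div_le_of_le_mul ?_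
    rw [mul_comm]
    exact (H3 _ (rearr_antitone f)).trans (mul_le_mul' le_rfl (tau_lower m n b q hq a0 ai f))
  · refine (H1 f).trans ?_
    rw [LZ_eq, add_mul, add_mul]
    refine le_trans ?_ le_self_add
    exact add_le_add le_rfl (H2 _ (rearr_antitone f))

lemma item5 (m n : ℕ) (hn : 0 < n) (hmn : m < n)
    (q : ℝ≥0∞) (hq : 1 ≤ q) (a0 ai : ℝ) :
    EquivNorms (fun f => NN 0 q a0 ai (hardyOp m n (rearr f)))
      (tauFun m n (LZnorm 0 q a0 ai)) := by
  have hn' : (0:ℝ) < n := by exact_mod_cast hn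
  have hb : 0 + (m:ℝ)/n < 1 := by
    rw [zero_add, div_lt_one hn']; exact_mod_cast hmn
  obtain ⟨C1, hC1, H1⟩ := tau_upper m n hn hmn 0 hb q hq a0 ai
  obtain ⟨C3, hC3, hC3', H3⟩ := hardy_lower m n hn hmn 0 q hq a0 ai
  refine ⟨1, C1 * C3 + 1, by simp, by simp, by positivity, ?_, fun f _ => ⟨?_, ?_⟩⟩
  · simp [lt_top_iff_ne_top, ENNReal.mul_ne_top hC1 hC3']
  · simpa using tau_lower m n 0 q hq a0 ai f
  · refine (H1 f).trans ?_
    rw [add_mul, one_mul, mul_assoc]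
    exact add_le_add (mul_le_mul' le_rfl (H3 _ (rearr_antitone f))) le_rfl

lemma ell_antitone {a0 ai : ℝ} (h0 : 0 ≤ a0) (hi : ai ≤ 0) : AntitoneOn (ell a0 ai) (Ioi 0) := by
  intro x hx y hy hxy
  have hx : 0 < x := hx
  have hy : 0 < y := hy
  have hl := Real.log_le_log hx hxy
  unfold ell
  by_cases h1 : y < 1
  · have h2 : x < 1 := lt_of_le_of_lt hxy h1
    simp only [h1, h2, if_true]
    have := Real.log_neg hy h1
    exact Real.rpow_le_rpow (by linarith) (by linarith) h0
  · have l1 := Real.log_nonneg (not_lt.1 h1)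
    by_cases h2 : x < 1
    · have := Real.log_neg hx h2
      simp only [h1, h2, if_true, if_false]
      exact (Real.rpow_le_one_of_one_le_of_nonpos (by linarith) hi).trans
        (Real.one_le_rpow (by linarith) h0)
    · have := Real.log_nonneg (not_lt.1 h2)
      simp only [h1, h2, if_false]
      exact Real.rpow_le_rpow_of_nonpos (by linarith) (by linarith) hi

lemma Lq_one (g : ℝ → ℝ≥0∞) : Lqnorm 1 (Ioi 0) g = ∫⁻ t, g t ∂mu0 := by
  unfold Lqnorm mu0
  simp

/-- the kernel obtained after exchanging integrals -/
def VV (w : ℝ → ℝ≥0∞) (d : ℝ) (s : ℝ) : ℝ≥0∞ :=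
  (∫⁻ t, (Iio s).indicator w t ∂mu0) * ENNReal.ofReal (s ^ d)

lemma NN_one_hardy (m n : ℕ) (b a0 ai : ℝ) (h : ℝ → ℝ≥0∞) (hh : Measurable h) :
    NN b 1 a0 ai (hardyOp m n h) = ∫⁻ s, h s * VV (wt b 1 a0 ai) ((m:ℝ)/n - 1) s ∂mu0 := by
  have hw := wt_measurable b 1 a0 ai
  unfold NN
  rw [Lq_one]
  have e1 : ∀ᵐ t ∂mu0, wt b 1 a0 ai t * hardyOp m n h t =
      ∫⁻ s, (Iio s).indicator (wt b 1 a0 ai) t *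
        (h s * ENNReal.ofReal (s ^ ((m:ℝ)/n - 1))) ∂mu0 := by
    unfold mu0
    refine (ae_restrict_iff' measurableSet_Ioi).2 (Eventually.of_forall ?_)
    intro t ht
    unfold hardyOp
    have hI : Ioi t = Ioi t ∩ Ioi 0 := by
      rw [inter_eq_left.2 (Ioi_subset_Ioi (le_of_lt ht))]
    rw [← lintegral_const_mul _ (by fun_prop), hI, ← Measure.restrict_restrict measurableSet_Ioi,
      ← lintegral_indicator measurableSet_Ioi]
    congr 1; funext s
    by_cases hs : t < s <;> simp [indicator, hs]
  rw [lintegral_congr_ae e1, lintegral_lintegral_swap]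
  · congr 1; funext s
    rw [lintegral_mul_const _ (hw.indicator measurableSet_Iio)]
    unfold VV
    ring
  · have h1 : Measurable (fun z : ℝ × ℝ => (Iio z.2).indicator (wt b 1 a0 ai) z.1) := by
      have : MeasurableSet {z : ℝ × ℝ | z.1 < z.2} := measurableSet_lt measurable_fst measurable_snd
      exact (hw.comp measurable_fst).indicator this
    exact Measurable.aemeasurable (h1.mul (by fun_prop))

lemma VV_scale (w : ℝ → ℝ≥0∞) (hw : Measurable w) (d : ℝ) {s : ℝ} (hs : 0 < s) :
    VV w d s = ∫⁻ u, (Iio 1).indicator (fun u => w (s * u) * ENNReal.ofReal (s ^ (d + 1))) u ∂mu0 := by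
  unfold VV
  have h1 := mu0_dil (g := (Iio s).indicator w) (hw.indicator measurableSet_Iio) hs
  have e : ∫⁻ u, (Iio 1).indicator (fun u => w (s * u) * ENNReal.ofReal (s ^ (d + 1))) u ∂mu0 =
      (∫⁻ u, (Iio s).indicator w (s * u) ∂mu0) * ENNReal.ofReal (s ^ (d+1)) := by
    have hm : Measurable (fun u => (Iio s).indicator w (s * u)) :=
      (hw.indicator measurableSet_Iio).comp (by fun_prop : Measurable fun u : ℝ => s * u)
    rw [← lintegral_mul_const _ hm]
    congr 1; funext u
    have : s * u < s ↔ u < 1 := by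
      constructor <;> intro h <;> nlinarith
    by_cases hu : u < 1
    · simp [indicator, hu, this]
    · simp [indicator, hu, this]
  rw [e, h1, mul_comm (ENNReal.ofReal s⁻¹), mul_assoc, ← ENNReal.ofReal_mul (by positivity)]
  congr 2
  rw [Real.rpow_add_one hs.ne']
  field_simp

lemma VV_antitone (b a0 ai d : ℝ) (hbd : b + d = 0) (h0 : 0 ≤ a0) (hi : ai ≤ 0) :
    AntitoneOn (VV (wt b 1 a0 ai) d) (Ioi 0) := by
  intro x hx y hy hxy
  have hx : 0 < x := hx
  have hy : 0 < y := hy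
  have hw := wt_measurable b 1 a0 ai
  rw [VV_scale _ hw d hx, VV_scale _ hw d hy]
  unfold mu0
  refine setLIntegral_mono' measurableSet_Ioi fun u hu => ?_
  have hu : 0 < u := hu
  refine indicator_le_indicator ?_
  have e : ∀ s, 0 < s → wt b 1 a0 ai (s * u) * ENNReal.ofReal (s ^ (d + 1)) =
      ENNReal.ofReal (u ^ (b - 1) * ell a0 ai (s * u)) := by
    intro s hs
    have := ell_pos a0 ai (mul_pos hs hu)
    unfold wt
    rw [← ENNReal.ofReal_mul (by positivity)]
    congr 1
    have e2 : s ^ (b - 1) * s ^ (d + 1) = 1 := by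
      rw [← Real.rpow_add hs]
      have : b - 1 + (d + 1) = 0 := by linarith
      rw [this, Real.rpow_zero]
    simp only [inv_one, ENNReal.toReal_one]
    rw [Real.mul_rpow hs.le hu.le]
    linear_combination (u ^ (b - 1) * ell a0 ai (s * u)) * e2
  rw [e x hx, e y hy]
  refine ENNReal.ofReal_le_ofReal ?_
  have := ell_antitone h0 hi (show x * u ∈ Ioi 0 from mul_pos hx hu)
    (show y * u ∈ Ioi 0 from mul_pos hy hu) (by gcongr)
  gcongr

lemma VV_measurable (w : ℝ → ℝ≥0∞) (d : ℝ) : Measurable (VV w d) := by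
  unfold VV
  have h1 : Monotone (fun s : ℝ => ∫⁻ t, (Iio s).indicator w t ∂mu0) := fun x y hxy =>
    lintegral_mono fun t => indicator_le_indicator_of_subset (Iio_subset_Iio hxy) (fun _ => zero_le) t
  have := h1.measurable
  fun_prop

lemma item3 (m n : ℕ) (hn : 0 < n) (hmn : m < n) (a0 ai : ℝ) (h0 : 0 ≤ a0) (hi : ai ≤ 0) :
    EquivNorms (fun f => ∫⁻ t in Set.Ioi (0:ℝ), ENNReal.ofReal (ell a0 ai t) * rearr f t)
        (tauFun m n (LZnorm (1 - (m:ℝ)/n) 1 a0 ai)) := by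
  have hn' : (0:ℝ) < n := by exact_mod_cast hn
  have hθ : (m:ℝ)/n < 1 := by
    rw [div_lt_one hn']; exact_mod_cast hmn
  set b : ℝ := 1 - (m:ℝ)/n with hb
  obtain ⟨C2, hC2, H2⟩ := hardy_high m n hn hmn b (by linarith) 1 le_rfl a0 ai
  obtain ⟨C3, hC3, hC3', H3⟩ := hardy_lower m n hn hmn b 1 le_rfl a0 ai
  have hb1 : b + (m:ℝ)/n = 1 := by rw [hb]; ring
  rw [hb1] at H2 H3
  have e : ∀ f : ℝ → ℝ≥0∞, ∫⁻ t in Set.Ioi (0:ℝ), ENNReal.ofReal (ell a0 ai t) * rearr f t =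
      NN 1 1 a0 ai (rearr f) := by
    intro f
    unfold NN
    rw [Lq_one]
    unfold mu0 wt
    simp
  refine ⟨C3⁻¹, C2 + 1, by simpa using hC3', by simpa [pos_iff_ne_zero] using hC3,
    by positivity, by simp [hC2, lt_top_iff_ne_top], fun f _ => ⟨?_, ?_⟩⟩
  · simp only [e]
    rw [mul_comm, ← div_eq_mul_inv]
    refine ENNReal.div_le_of_le_mul ?_
    rw [mul_comm]
    exact (H3 _ (rearr_antitone f)).trans (mul_le_mul' le_rfl (tau_lower m n b 1 le_rfl a0 ai f))
  · simp only [e]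
    rw [add_mul]
    refine le_trans ?_ le_self_add
    refine le_trans ?_ (H2 _ (rearr_antitone f))
    unfold tauFun
    refine iSup₂_le fun h hh => iSup_le fun he => ?_
    rw [LZ_hardy m n b 1 le_rfl, NN_one_hardy _ _ _ _ _ h hh,
      NN_one_hardy _ _ _ _ _ _ (rearr_measurable f), ← he]
    exact hardy_littlewood h _ hh (VV_measurable _ _)
      (VV_antitone b a0 ai _ (by rw [hb]; ring) h0 hi)


lemma growth (δ ai : ℝ) (h : 0 < δ ∨ (δ = 0 ∧ 0 < ai)) :
    Tendsto (fun a : ℝ => a ^ δ * (1 + Real.log a) ^ ai) atTop atTop := by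
  have hlog : Tendsto (fun a : ℝ => 1 + Real.log a) atTop atTop :=
    tendsto_atTop_add_const_left _ _ Real.tendsto_log_atTop
  rcases h with h | ⟨h1, h2⟩
  · have h1 := (tendsto_exp_mul_div_rpow_atTop (-ai) δ h).comp hlog
    have h2 := h1.const_mul_atTop (Real.exp_pos (-δ))
    refine h2.congr' ?_
    filter_upwards [eventually_ge_atTop (1:ℝ)] with a ha
    have ha0 : 0 < a := by linarith
    have hl := Real.log_nonneg ha
    simp only [Function.comp]
    rw [Real.rpow_neg (by linarith), div_inv_eq_mul, ← mul_assoc, ← Real.exp_add,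
      Real.rpow_def_of_pos ha0]
    congr 2; ring
  · subst h1
    simpa [Function.comp_def] using (tendsto_rpow_atTop h2).comp hlog

lemma rearr_indicator_eq {E F : Set ℝ} (h : mu0 E = mu0 F) :
    rearr (E.indicator 1) = rearr (F.indicator 1) := by
  refine rearr_congr fun l => ?_
  have e : ∀ G : Set ℝ, {x | l < G.indicator (1 : ℝ → ℝ≥0∞) x} = if l < 1 then G else ∅ := by
    intro G
    ext x
    by_cases hx : x ∈ G <;> by_cases hl : l < 1 <;> simp [indicator, hx, hl]
  rw [e, e]
  split_ifs
  · exact h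
  · rfl

lemma mu0_Ioc {x y : ℝ} (hx : 0 ≤ x) : mu0 (Ioc x y) = ENNReal.ofReal (y - x) := by
  unfold mu0
  rw [Measure.restrict_apply measurableSet_Ioc, inter_eq_left.2, Real.volume_Ioc]
  exact fun z hz => lt_of_le_of_lt hx hz.1

lemma hardy_test (m n : ℕ) (hn : 0 < n) (hmn : m < n) (b : ℝ) (q : ℝ≥0∞) (hq : 1 ≤ q)
    (a0 ai : ℝ) : ∃ c : ℝ, 0 < c ∧ ∀ a : ℝ, 2 ≤ a →
      ENNReal.ofReal (c * (a ^ (b + (m:ℝ)/n - 1) * (1 + Real.log a) ^ ai)) ≤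
      NN b q a0 ai (hardyOp m n ((Ioc a (a+1)).indicator 1)) := by
  have hn' : (0:ℝ) < n := by exact_mod_cast hn
  have hθ : (m:ℝ)/n - 1 ≤ 0 := by
    rw [sub_nonpos, div_le_one hn']; exact_mod_cast hmn.le
  set θ : ℝ := (m:ℝ)/n with hθd
  set Q : ℝ := q⁻¹.toReal with hQ
  set K : ℝ := 2 ^ |b - Q| * 2 ^ (Mexp a0 ai) with hK
  have hK0 : 0 < K := by positivity
  refine ⟨K⁻¹ * 2 ^ (θ - 1) * (1/2) ^ Q, by positivity, fun a ha => ?_⟩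
  have ha0 : 0 < a := by linarith
  have hla : 0 ≤ Real.log a := Real.log_nonneg (by linarith)
  have hell : ell a0 ai a = (1 + Real.log a) ^ ai := by
    unfold ell; rw [if_neg (by linarith)]
  set D : ℝ := K⁻¹ * (a ^ (b - Q) * ell a0 ai a) * (2 * a) ^ (θ - 1) with hD
  have hea := ell_pos a0 ai ha0
  have hD0 : 0 < D := by positivity
  have h1 : ∀ t, 0 < t → (Ioc (a/2) a).indicator (fun _ => ENNReal.ofReal D) t ≤
      wt b q a0 ai t * hardyOp m n ((Ioc a (a+1)).indicator 1) t := by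
    intro t ht
    by_cases hta : t ∈ Ioc (a/2) a
    · rw [indicator_of_mem hta]
      have hw : ENNReal.ofReal (K⁻¹ * (a ^ (b - Q) * ell a0 ai a)) ≤ wt b q a0 ai t := by
        have hc : 0 < t / a := by positivity
        have hc1 : t / a ≤ 1 := (div_le_one ha0).2 hta.2
        have hc2 : 1/2 ≤ t / a := by
          rw [le_div_iff₀ ha0]; linarith [hta.1]
        have := wt_dil b q a0 ai hc ha0
        rw [div_mul_cancel₀ _ ha0.ne'] at this
        have hKle : (t/a) ^ (-(b - q⁻¹.toReal)) * (1 + |Real.log (t/a)|) ^ (Mexp a0 ai) ≤ K := by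
          rw [hK]
          have e1 : (t/a) ^ (-(b - q⁻¹.toReal)) ≤ 2 ^ |b - Q| := by
            rw [Real.rpow_neg hc.le, ← Real.inv_rpow hc.le]
            have i1 : 1 ≤ (t/a)⁻¹ := (one_le_inv₀ hc).2 hc1
            have i2 : (t/a)⁻¹ ≤ 2 := by
              rw [inv_le_comm₀ hc (by norm_num)]; linarith
            calc _ ≤ (t/a)⁻¹ ^ |b - Q| :=
                  Real.rpow_le_rpow_of_exponent_le i1 (le_abs_self _)
              _ ≤ _ := Real.rpow_le_rpow (by positivity) i2 (abs_nonneg _)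
          have e2 : |Real.log (t/a)| ≤ 1 := by
            rw [abs_of_nonpos (Real.log_nonpos hc.le hc1)]
            have := Real.log_le_log (by norm_num) hc2
            rw [one_div, Real.log_inv] at this
            linarith [Real.log_two_lt_d9]
          have e3 : 1 + |Real.log (t/a)| ≤ 2 := by linarith
          gcongr
        have h3 := this.trans (mul_le_mul' (ENNReal.ofReal_le_ofReal hKle) le_rfl)
        rw [ENNReal.ofReal_mul (by positivity), ENNReal.ofReal_inv_of_pos hK0, mul_comm,
          ← div_eq_mul_inv]
        refine ENNReal.div_le_of_le_mul ?_
        rw [mul_comm] at h3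
        exact h3
      have hh : ENNReal.ofReal ((2 * a) ^ (θ - 1)) ≤
          hardyOp m n ((Ioc a (a+1)).indicator 1) t := by
        calc ENNReal.ofReal ((2 * a) ^ (θ - 1))
            = ∫⁻ s in Ioc a (a+1), ENNReal.ofReal ((2 * a) ^ (θ - 1)) := by
              rw [setLIntegral_const, Real.volume_Ioc]; simp
          _ ≤ ∫⁻ s in Ioc a (a+1), (Ioc a (a+1)).indicator 1 s * ENNReal.ofReal (s ^ (θ - 1)) := by
              refine setLIntegral_mono' measurableSet_Ioc fun s hs => ?_
              rw [indicator_of_mem hs]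
              simp only [Pi.one_apply, one_mul]
              exact ENNReal.ofReal_le_ofReal
                (Real.rpow_le_rpow_of_nonpos (by linarith [hs.1]) (by linarith [hs.2]) hθ)
          _ ≤ _ := lintegral_mono_set fun s hs => lt_of_le_of_lt hta.2 hs.1
      rw [hD, ENNReal.ofReal_mul (by positivity)]
      exact mul_le_mul' hw hh
    · rw [indicator_of_notMem hta]; exact zero_le
  refine le_trans ?_ (Lq_mono q hq h1)
  have hmu : mu0 (Ioc (a/2) a) = ENNReal.ofReal (a/2) := by
    rw [mu0_Ioc (by linarith)]; congr 1; ring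
  rw [Lqnorm_eq q hq, eLpNorm_indicator_const' measurableSet_Ioc (by rw [hmu]; simpa using ha0)
    (lt_of_lt_of_le one_pos hq).ne', hmu, ENNReal.ofReal_rpow_of_pos (by positivity)]
  have : ‖ENNReal.ofReal D‖ₑ = ENNReal.ofReal D := rfl
  rw [this, ← ENNReal.ofReal_mul hD0.le]
  refine ENNReal.ofReal_le_ofReal (le_of_eq ?_)
  have hQ2 : 1 / q.toReal = Q := by rw [hQ, ENNReal.toReal_inv, one_div]
  rw [hD, hQ2, hell, Real.mul_rpow (by norm_num) ha0.le, div_eq_mul_inv a 2, mul_comm a,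
    Real.mul_rpow (by norm_num) ha0.le, one_div]
  have e : a ^ (b + θ - 1) = a ^ (b - Q) * a ^ (θ - 1) * a ^ Q := by
    rw [← Real.rpow_add ha0, ← Real.rpow_add ha0]; congr 1; ring
  rw [e]; ring

lemma item8 (m n : ℕ) (hn : 0 < n) (hmn : m < n) (b : ℝ) (q : ℝ≥0∞) (hq : 1 ≤ q)
    (a0 ai : ℝ) (h : 0 < b + (m:ℝ)/n - 1 ∨ (b + (m:ℝ)/n - 1 = 0 ∧ 0 < ai)) :
    ¬ ExistsRIDomain m n (LZnorm b q a0 ai) := by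
  rintro ⟨ρ, C, hρ, _, hC, H⟩
  obtain ⟨c, hc, Hc⟩ := hardy_test m n hn hmn b q hq a0 ai
  have hE : ∀ a : ℝ, 2 ≤ a → mu0 (Ioc a (a+1)) = 1 := by
    intro a ha
    rw [mu0_Ioc (by linarith)]; simp
  have hm : ∀ a : ℝ, Measurable ((Ioc a (a+1)).indicator (1 : ℝ → ℝ≥0∞)) := fun a =>
    measurable_one.indicator measurableSet_Ioc
  set B := C * ρ ((Ioc (2:ℝ) (2+1)).indicator 1) with hB
  have hBfin : B ≠ ∞ := ENNReal.mul_ne_top hC.ne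
    (hρ.indicator_lt_top _ measurableSet_Ioc (by rw [hE 2 le_rfl]; simp)).ne
  have key : ∀ a : ℝ, 2 ≤ a → c * (a ^ (b + (m:ℝ)/n - 1) * (1 + Real.log a) ^ ai) ≤ B.toReal := by
    intro a ha
    have h1 := H _ (hm a)
    rw [LZ_hardy m n b q hq, hρ.rearr_inv _ _ (hm a) (hm 2)
      (rearr_indicator_eq (by rw [hE a ha, hE 2 le_rfl]))] at h1
    exact (ENNReal.ofReal_le_iff_le_toReal hBfin).1 ((Hc a ha).trans h1)
  have ht := (growth _ ai h).const_mul_atTop hc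
  obtain ⟨a, ha1, ha2⟩ := ((ht.eventually_gt_atTop B.toReal).and (eventually_ge_atTop 2)).exists
  exact absurd (key a ha2) (not_le.2 ha1)

lemma item7_aux (m n : ℕ) (f : ℝ → ℝ≥0∞) :
    NN 0 ∞ 0 0 (hardyOp m n (rearr f)) =
      ∫⁻ t in Set.Ioi (0:ℝ), ENNReal.ofReal (t ^ ((m : ℝ)/(n : ℝ) - 1)) * rearr f t := by
  have e0 : ∫⁻ t in Set.Ioi (0:ℝ), ENNReal.ofReal (t ^ ((m : ℝ)/(n : ℝ) - 1)) * rearr f t =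
      hardyOp m n (rearr f) 0 := by
    unfold hardyOp
    simp_rw [mul_comm]
  have e1 : NN 0 ∞ 0 0 (hardyOp m n (rearr f)) =
      essSup (hardyOp m n (rearr f)) (volume.restrict (Ioi 0)) := by
    unfold NN Lqnorm
    simp only [if_true]
    congr 1; funext t
    simp [wt, ell]
  rw [e0, e1]
  apply le_antisymm
  · refine essSup_le_of_ae_le _ ?_
    refine (ae_restrict_iff' measurableSet_Ioi).2 (Eventually.of_forall ?_)
    intro t ht
    exact hardyOp_antitone m n _ (le_of_lt ht)
  · obtain ⟨u, hu1, hu2, hu3⟩ := exists_seq_strictAnti_tendsto (0:ℝ)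
    have hU : Ioi (0:ℝ) = ⋃ k, Ioi (u k) := by
      ext x
      simp only [mem_Ioi, mem_iUnion]
      constructor
      · intro hx
        exact ((tendsto_order.1 hu3).2 _ hx).exists
      · rintro ⟨k, hk⟩
        exact lt_trans (hu2 k) hk
    have e2 : hardyOp m n (rearr f) 0 = ⨆ k, hardyOp m n (rearr f) (u k) := by
      unfold hardyOp
      rw [hU, setLIntegral_iUnion_of_directed]
      exact (directed_of_isDirected_le fun i j hij => Ioi_subset_Ioi (hu1.antitone hij))
    rw [e2]
    refine iSup_le fun k => ?_
    by_contra hc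
    push Not at hc
    have h1 := ae_lt_of_essSup_lt hc
    rw [ae_restrict_iff' measurableSet_Ioi] at h1
    have h2 : volume (Ioc 0 (u k)) = 0 := by
      refine measure_mono_null ?_ h1
      intro x hx hx2
      exact absurd (hx2 hx.1) (not_lt.2 (hardyOp_antitone m n _ hx.2))
    rw [Real.volume_Ioc] at h2
    simp only [sub_zero, ENNReal.ofReal_eq_zero] at h2
    linarith [hu2 k]

lemma critical_exp (m n : ℕ) (hn : 0 < n) (hmn : m < n) :
    (n : ℝ≥0∞)/((n : ℝ≥0∞) - (m : ℝ≥0∞)) ≠ ∞ ∧ (n : ℝ≥0∞)/((n : ℝ≥0∞) - (m : ℝ≥0∞)) ≠ 0 ∧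
    ((n : ℝ≥0∞)/((n : ℝ≥0∞) - (m : ℝ≥0∞)))⁻¹.toReal = 1 - (m:ℝ)/n := by
  have hn' : (0:ℝ) < n := by exact_mod_cast hn
  have e : (n : ℝ≥0∞) - (m : ℝ≥0∞) = ((n - m : ℕ) : ℝ≥0∞) := by
    push_cast; rfl
  have h1 : n - m ≠ 0 := by omega
  rw [e]
  refine ⟨?_, ?_, ?_⟩
  · exact ENNReal.div_ne_top (by simp) (by exact_mod_cast h1)
  · exact ENNReal.div_ne_zero.2 ⟨by exact_mod_cast hn.ne', by simp⟩
  · rw [ENNReal.toReal_inv, ENNReal.toReal_div, inv_div]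
    simp only [ENNReal.toReal_natCast]
    rw [Nat.cast_sub hmn.le, sub_div, div_self hn'.ne']

/-- optimal rearrangement-invariant domain spaces for Lorentz–Zygmund
spaces. -/
theorem statement14 (n m : ℕ) (hn : 2 ≤ n) (hm : 1 ≤ m) (hmn : m < n)
    (p q : ℝ≥0∞) (a0 ai : ℝ) (hp : 1 ≤ p) (hq : 1 ≤ q)
    (hri : (p = 1 ∧ q = 1 ∧ 0 ≤ a0 ∧ ai ≤ 0) ∨ (1 < p ∧ p < ∞) ∨
      (p = ∞ ∧ q < ∞ ∧ a0 + q⁻¹.toReal < 0) ∨ (p = ∞ ∧ q = ∞ ∧ a0 ≤ 0)) :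
    (∀ f : ℝ → ℝ≥0∞, Measurable f →
      LZnorm p⁻¹.toReal q a0 ai (hardyOp m n f)
        ≤ tauFun m n (LZnorm p⁻¹.toReal q a0 ai) f)
    ∧
    (∀ ρX : (ℝ → ℝ≥0∞) → ℝ≥0∞, IsRINorm ρX → ∀ C : ℝ≥0∞,
      (∀ f : ℝ → ℝ≥0∞, Measurable f →
        LZnorm p⁻¹.toReal q a0 ai (hardyOp m n f) ≤ C * ρX f) →
      ∀ f : ℝ → ℝ≥0∞, Measurable f →
        tauFun m n (LZnorm p⁻¹.toReal q a0 ai) f ≤ C * ρX f)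
    ∧
    ((p = (n : ℝ≥0∞)/((n : ℝ≥0∞) - (m : ℝ≥0∞)) ∧ q = 1 ∧ 0 ≤ a0 ∧ ai ≤ 0) →
      EquivNorms (fun f => ∫⁻ t in Set.Ioi (0:ℝ), ENNReal.ofReal (ell a0 ai t) * rearr f t)
        (tauFun m n (LZnorm p⁻¹.toReal q a0 ai)))
    ∧
    (((n : ℝ≥0∞)/((n : ℝ≥0∞) - (m : ℝ≥0∞)) < p ∧ p < ∞ →
      EquivNorms (LZnorm (p⁻¹.toReal + (m : ℝ)/(n : ℝ)) q a0 ai)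
        (tauFun m n (LZnorm p⁻¹.toReal q a0 ai))))
    ∧
    ((p = ∞) →
      EquivNorms
        (fun f => Lqnorm q (Set.Ioi 0)
          (fun t => ENNReal.ofReal (t ^ (-(q⁻¹.toReal)) * ell a0 ai t) *
            hardyOp m n (rearr f) t))
        (tauFun m n (LZnorm p⁻¹.toReal q a0 ai)))
    ∧
    ((p = (n : ℝ≥0∞)/((n : ℝ≥0∞) - (m : ℝ≥0∞)) ∧ q = 1 ∧ a0 = 0 ∧ ai = 0) →
      EquivNorms (fun f => ∫⁻ t in Set.Ioi (0:ℝ), rearr f t)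
        (tauFun m n (LZnorm p⁻¹.toReal q a0 ai)))
    ∧
    ((p = ∞ ∧ q = ∞ ∧ a0 = 0 ∧ ai = 0) →
      EquivNorms
        (fun f => ∫⁻ t in Set.Ioi (0:ℝ), ENNReal.ofReal (t ^ ((m : ℝ)/(n : ℝ) - 1)) * rearr f t)
        (tauFun m n (LZnorm p⁻¹.toReal q a0 ai)))
    ∧
    (((p = (n : ℝ≥0∞)/((n : ℝ≥0∞) - (m : ℝ≥0∞)) ∧ 0 < ai) ∨
        p < (n : ℝ≥0∞)/((n : ℝ≥0∞) - (m : ℝ≥0∞))) →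
      ¬ ExistsRIDomain m n (LZnorm p⁻¹.toReal q a0 ai)) := by
  have hn0 : 0 < n := by omega
  have hn' : (0:ℝ) < n := by exact_mod_cast hn0
  obtain ⟨hP1, hP2, hP3⟩ := critical_exp m n hn0 hmn
  have hp0 : p ≠ 0 := (lt_of_lt_of_le one_pos hp).ne'
  refine ⟨?_, ?_, ?_, ?_, ?_, ?_, ?_, ?_⟩
  · intro f hf
    unfold tauFun
    exact le_iSup₂_of_le f hf (le_iSup_of_le rfl le_rfl)
  · intro ρX hρ C H f hf
    unfold tauFun
    refine iSup₂_le fun h hh => iSup_le fun he => ?_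
    rw [← hρ.rearr_inv h f hh hf he]
    exact H h hh
  · rintro ⟨h1, h2, h3, h4⟩
    subst h2
    rw [h1, hP3]
    exact item3 m n hn0 hmn a0 ai h3 h4
  · rintro ⟨h1, h2⟩
    refine item4 m n hn0 hmn _ ?_ ?_ q hq a0 ai
    · exact ENNReal.toReal_pos (ENNReal.inv_ne_zero.2 h2.ne) (ENNReal.inv_ne_top.2 hp0)
    · have := (ENNReal.toReal_lt_toReal (ENNReal.inv_ne_top.2 hp0)
        (ENNReal.inv_ne_top.2 hP2)).2 (ENNReal.inv_lt_inv.2 h1)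
      rw [hP3] at this
      linarith
  · intro h1
    have h2 := item5 m n hn0 hmn q hq a0 ai
    have e : p⁻¹.toReal = 0 := by simp [h1]
    rw [e]
    have e2 : (fun f : ℝ → ℝ≥0∞ => Lqnorm q (Set.Ioi 0)
          (fun t => ENNReal.ofReal (t ^ (-(q⁻¹.toReal)) * ell a0 ai t) *
            hardyOp m n (rearr f) t)) = fun f => NN 0 q a0 ai (hardyOp m n (rearr f)) := by
      unfold NN wt
      simp only [zero_sub]
    rw [e2]
    exact h2
  · rintro ⟨h1, h2, h3, h4⟩
    subst h2 h3 h4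
    rw [h1, hP3]
    have := item3 m n hn0 hmn 0 0 le_rfl le_rfl
    simpa [ell] using this
  · rintro ⟨h1, h2, h3, h4⟩
    subst h1 h2 h3 h4
    have h2 := item5 m n hn0 hmn ∞ hq 0 0
    simp only [item7_aux] at h2
    simpa using h2
  · intro h
    refine item8 m n hn0 hmn _ q hq a0 ai ?_
    rcases h with ⟨h1, h2⟩ | h1
    · right
      rw [h1, hP3]
      exact ⟨by ring, h2⟩
    · left
      have := (ENNReal.toReal_lt_toReal (ENNReal.inv_ne_top.2 hP2)
        (ENNReal.inv_ne_top.2 hp0)).2 (ENNReal.inv_lt_inv.2 h1)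
      rw [hP3] at this
      linarith

end
end

section
/- Let n ≥ 2 and 1 ≤ m < n, and let A be a Young function satisfying ∫_0 (s/A(s))^{m/(n−m)} ds < ∞ (convergence near zero). Define H_m(t) = ( ∫_0^t (s/A(s))^{m/(n−m)} ds )^{(n−m)/n} for t ≥ 0, H^∞ = lim_{t→∞} H_m(t), D_m(t) = ( t · A(H_m^{-1}(t)) / H_m^{-1}(t) )^{n/(n−m)} for 0 ≤ t < H^∞ and D_m(t) = ∞ for t ≥ H^∞, and A_m(t) = ∫_0^t D_m(s)/s ds. Then A_m is a Young function and L^{A_m}(0,∞) is the optimal (smallest) Orlicz target space for L^A(0,∞) in the Hardy-type inequality: there is C > 0 with ‖∫_t^∞ f(s) s^{m/n−1} ds‖_{L^{A_m}(0,∞)} ≤ C ‖f‖_{L^A(0,∞)} for all nonnegative measurable f on (0,∞), and whenever B is a Young function such that ‖∫_t^∞ f(s) s^{m/n−1} ds‖_{L^B(0,∞)} ≤ C' ‖f‖_{L^A(0,∞)} holds for some C' and all nonnegative measurable f, then L^{A_m}(0,∞) ⊆ L^B(0,∞) with a norm inequality ‖g‖_{L^B} ≤ c‖g‖_{L^{A_m}}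 for all g. Conversely, if ∫_0 (s/A(s))^{m/(n−m)} ds = ∞, then there exists no Young function B for which the Hardy-type inequality with domain L^A holds at all. -/
open MeasureTheory Set Filter
open scoped ENNReal NNReal Topology

noncomputable section

section

/-! ### Basic facts on Young functions -/

lemma young_scale {A : ℝ → ℝ≥0∞} (hA : IsYoung A) {l x : ℝ} (hl : 0 ≤ l) (hl1 : l ≤ 1)
    (hx : 0 ≤ x) : A (l * x) ≤ ENNReal.ofReal l * A x := by
  have := hA.convex x 0 hx le_rfl l hl hl1
  simpa [hA.map_zero] using this

lemma young_mono {A : ℝ → ℝ≥0∞} (hA : IsYoung A) {x y : ℝ} (hx : 0 ≤ x) (hxy : x ≤ y) :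
    A x ≤ A y := by
  rcases eq_or_lt_of_le (hx.trans hxy) with h | h
  · have : x = y := by linarith
    rw [this]
  · have h1 := young_scale hA (l := x / y) (x := y) (by positivity)
      ((div_le_one h).2 hxy) h.le
    rw [div_mul_cancel₀ _ h.ne'] at h1
    refine h1.trans ?_
    calc ENNReal.ofReal (x / y) * A y ≤ 1 * A y := by
          gcongr
          rw [← ENNReal.ofReal_one]
          exact ENNReal.ofReal_le_ofReal ((div_le_one h).2 hxy)
      _ = A y := one_mul _

/-- The quotient `A(s)/s` (measurable version). -/
def aa (A : ℝ → ℝ≥0∞) (s : ℝ) : ℝ≥0∞ := A (max s 0) / ENNReal.ofReal s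

lemma aa_pos_eq (A : ℝ → ℝ≥0∞) {s : ℝ} (hs : 0 < s) : aa A s = A s / ENNReal.ofReal s := by
  rw [aa, max_eq_left hs.le]

lemma mul_aa (A : ℝ → ℝ≥0∞) {s : ℝ} (hs : 0 < s) : ENNReal.ofReal s * aa A s = A s := by
  rw [aa_pos_eq A hs]
  exact ENNReal.mul_div_cancel (by simpa using hs) ENNReal.ofReal_ne_top

lemma aa_mono {A : ℝ → ℝ≥0∞} (hA : IsYoung A) {x y : ℝ} (hx : 0 < x) (hxy : x ≤ y) :
    aa A x ≤ aa A y := by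
  have hy : 0 < y := hx.trans_le hxy
  rw [aa_pos_eq A hx, aa_pos_eq A hy]
  have h1 := young_scale hA (l := x / y) (x := y) (by positivity)
      ((div_le_one hy).2 hxy) hy.le
  rw [div_mul_cancel₀ _ hy.ne', ENNReal.ofReal_div_of_pos hy] at h1
  have hx0 : ENNReal.ofReal x ≠ 0 := by simpa using hx
  refine ENNReal.div_le_of_le_mul ?_
  refine h1.trans (le_of_eq ?_)
  simp only [div_eq_mul_inv]
  ring

lemma aa_measurable {A : ℝ → ℝ≥0∞} (hA : IsYoung A) : Measurable (aa A) := by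
  have h1 : Monotone (fun s : ℝ => A (max s 0)) := fun x y hxy =>
    young_mono hA (le_max_right _ _) (max_le_max hxy le_rfl)
  exact h1.measurable.div ENNReal.measurable_ofReal

lemma eext_mono {A : ℝ → ℝ≥0∞} (hA : IsYoung A) : Monotone (eext A) := by
  intro x y hxy
  unfold eext
  by_cases hy : y = ∞
  · simp [hy]
  · have hx : x ≠ ∞ := ne_top_of_le_ne_top hy hxy
    rw [if_neg hy, if_neg hx]
    exact young_mono hA ENNReal.toReal_nonneg (ENNReal.toReal_mono hy hxy)

lemma eext_measurable {A : ℝ → ℝ≥0∞} (hA : IsYoung A) : Measurable (eext A) :=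
  (eext_mono hA).measurable

lemma eext_ofReal (A : ℝ → ℝ≥0∞) {x : ℝ} (hx : 0 ≤ x) : eext A (ENNReal.ofReal x) = A x := by
  unfold eext
  rw [if_neg ENNReal.ofReal_ne_top, ENNReal.toReal_ofReal hx]

/-- The integrand in `H_m`. -/
lemma hh_eq (A : ℝ → ℝ≥0∞) (q : ℝ) {s : ℝ} (hs : 0 < s) :
    (ENNReal.ofReal s / A s) ^ q = (aa A s)⁻¹ ^ q := by
  rw [aa_pos_eq A hs, ENNReal.inv_div (Or.inl ENNReal.ofReal_ne_top) (Or.inl (by simpa using hs))]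

/-! ### Luxemburg norms -/

lemma lux_le {A : ℝ → ℝ≥0∞} {f : ℝ → ℝ≥0∞} {l : ℝ≥0∞} (h0 : l ≠ 0)
    (h : (∫⁻ t in Set.Ioi (0:ℝ), eext A (f t / l)) ≤ 1) : luxNorm A f ≤ l :=
  sInf_le ⟨h0, h⟩

lemma lux_lt {A : ℝ → ℝ≥0∞} (hA : IsYoung A) {f : ℝ → ℝ≥0∞} {l : ℝ≥0∞}
    (h : luxNorm A f < l) : (∫⁻ t in Set.Ioi (0:ℝ), eext A (f t / l)) ≤ 1 := by
  obtain ⟨l', ⟨h0, h1⟩, hl⟩ := sInf_lt_iff.1 h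
  refine le_trans (lintegral_mono fun t => eext_mono hA ?_) h1
  exact ENNReal.div_le_div_left hl.le _

/-- modular criterion for comparison of Luxemburg norms -/
lemma lux_compare {A B : ℝ → ℝ≥0∞} {f g : ℝ → ℝ≥0∞} {C : ℝ≥0∞} (hC : C ≠ 0) (hC' : C ≠ ∞)
    (h : ∀ l : ℝ≥0∞, l ≠ 0 → l ≠ ∞ → (∫⁻ t in Set.Ioi (0:ℝ), eext A (f t / l)) ≤ 1 →
      (∫⁻ t in Set.Ioi (0:ℝ), eext B (g t / (C * l))) ≤ 1) :
    luxNorm B g ≤ C * luxNorm A f := by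
  have : luxNorm B g / C ≤ luxNorm A f := by
    refine le_sInf ?_
    rintro l ⟨h0, h1⟩
    refine ENNReal.div_le_of_le_mul ?_
    by_cases hl : l = ∞
    · rw [hl, ENNReal.top_mul hC]; exact le_top
    · rw [mul_comm]
      exact lux_le (mul_ne_zero hC h0) (h l h0 hl h1)
  rwa [ENNReal.div_le_iff_le_mul (Or.inl hC) (Or.inl hC'), mul_comm] at this

/-! ### Primitives -/

lemma cont_prim {h : ℝ → ℝ≥0∞} (hm : Measurable h)
    (hfin : ∀ t, (∫⁻ s in Ioc (0:ℝ) t, h s) ≠ ∞) :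
    Continuous (fun t : ℝ => ∫⁻ s in Ioc (0:ℝ) t, h s) := by
  set g : ℝ → ℝ := fun s => ((Ioi (0:ℝ)).indicator h s).toReal with hg
  have hmi : Measurable ((Ioi (0:ℝ)).indicator h) := hm.indicator measurableSet_Ioi
  have key : ∀ a b : ℝ, (∫⁻ s in Ioc a b, (Ioi (0:ℝ)).indicator h s) ≠ ∞ := by
    intro a b
    refine ne_top_of_le_ne_top (hfin b) ?_
    rw [lintegral_indicator measurableSet_Ioi, Measure.restrict_restrict measurableSet_Ioi]
    refine lintegral_mono_set ?_
    rintro x ⟨h1, h2⟩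
    exact ⟨h1, h2.2⟩
  have hint : ∀ a b : ℝ, IntegrableOn g (Ioc a b) := fun a b =>
    integrable_toReal_of_lintegral_ne_top hmi.aemeasurable (key a b)
  have hii : ∀ a b : ℝ, IntervalIntegrable g volume a b := fun a b => ⟨hint a b, hint b a⟩
  have hc := intervalIntegral.continuous_primitive hii 0
  have : (fun t : ℝ => ∫⁻ s in Ioc (0:ℝ) t, h s)
      = fun t => ENNReal.ofReal (∫ s in (0:ℝ)..t, g s) := by
    funext t
    rcases le_or_gt t 0 with ht | ht
    · rw [Ioc_eq_empty (by simpa using ht)]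
      have : (∫ s in (0:ℝ)..t, g s) = 0 := by
        rw [intervalIntegral.integral_of_ge ht, neg_eq_zero]
        refine integral_eq_zero_of_ae ?_
        refine (ae_restrict_iff' measurableSet_Ioc).2 (Eventually.of_forall ?_)
        intro x hx
        simp only [hg, Pi.zero_apply]
        rw [indicator_of_notMem (by simpa using hx.2)]
        simp
      rw [this]; simp
    · rw [intervalIntegral.integral_of_le ht.le,
        ofReal_integral_eq_lintegral_ofReal (hint 0 t) (Eventually.of_forall fun _ =>
          ENNReal.toReal_nonneg)]
      have hae : ∀ᵐ x ∂(volume.restrict (Ioc 0 t)), (Ioi (0:ℝ)).indicator h x < ∞ :=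
        ae_lt_top hmi (key 0 t)
      refine lintegral_congr_ae ?_
      filter_upwards [hae, ae_restrict_mem measurableSet_Ioc] with x hx hx'
      rw [hg]
      simp only
      rw [ENNReal.ofReal_toReal hx.ne, indicator_of_mem (show x ∈ Ioi (0:ℝ) from hx'.1)]
  rw [this]
  exact ENNReal.continuous_ofReal.comp hc

lemma lint_rpow {b c : ℝ} (hb : -1 < b) (hc : 0 ≤ c) :
    ∫⁻ s in Ioc (0:ℝ) c, ENNReal.ofReal (s ^ b) = ENNReal.ofReal (c ^ (b + 1) / (b + 1)) := by
  have h1 : IntervalIntegrable (fun s : ℝ => s ^ b) volume 0 c :=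
    intervalIntegral.intervalIntegrable_rpow' hb
  have h2 := integral_rpow (a := 0) (b := c) (r := b) (Or.inl hb)
  rw [intervalIntegral.integral_of_le hc, Real.zero_rpow (by linarith), sub_zero] at h2
  rw [← h2, ofReal_integral_eq_lintegral_ofReal h1.1]
  refine (ae_restrict_iff' measurableSet_Ioc).2 (Eventually.of_forall ?_)
  intro x hx
  exact Real.rpow_nonneg hx.1.le _

/-! ### Convex primitive of a monotone function is Young -/

lemma prim_convex {d : ℝ → ℝ≥0∞} (hd : MonotoneOn d (Ioi 0)) {x y l : ℝ} (hx : 0 ≤ x)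
    (hxy : x ≤ y) (hl : 0 ≤ l) (hl1 : l ≤ 1) :
    (∫⁻ s in Ioc (0:ℝ) (l * x + (1 - l) * y), d s) ≤
      ENNReal.ofReal l * (∫⁻ s in Ioc (0:ℝ) x, d s)
      + ENNReal.ofReal (1 - l) * (∫⁻ s in Ioc (0:ℝ) y, d s) := by
  set z := l * x + (1 - l) * y with hz
  have hxz : x ≤ z := by nlinarith
  have hzy : z ≤ y := by nlinarith
  rcases eq_or_lt_of_le (hx.trans hxz) with h0 | h0
  · rw [← h0]; simp
  have split : ∀ u v : ℝ, 0 ≤ u → u ≤ v → (∫⁻ s in Ioc (0:ℝ) v, d s)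
      = (∫⁻ s in Ioc (0:ℝ) u, d s) + ∫⁻ s in Ioc u v, d s := by
    intro u v hu huv
    rw [← Ioc_union_Ioc_eq_Ioc hu huv, lintegral_union measurableSet_Ioc]
    exact Set.disjoint_left.2 fun a ha hb => not_lt.2 ha.2 hb.1
  have hy' := split z y h0.le hzy
  have hz' := split x z hx hxz
  have hI : (∫⁻ s in Ioc x z, d s) ≤ d z * ENNReal.ofReal (z - x) := by
    calc (∫⁻ s in Ioc x z, d s) ≤ ∫⁻ s in Ioc x z, d z :=
          setLIntegral_mono' measurableSet_Ioc fun s hs => hd (hx.trans_lt hs.1) h0 hs.2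
      _ = _ := by rw [setLIntegral_const, Real.volume_Ioc]
  have hJ : d z * ENNReal.ofReal (y - z) ≤ (∫⁻ s in Ioc z y, d s) := by
    calc d z * ENNReal.ofReal (y - z) = ∫⁻ s in Ioc z y, d z := by
          rw [setLIntegral_const, Real.volume_Ioc]
      _ ≤ _ := setLIntegral_mono' measurableSet_Ioc fun s hs => hd h0 (h0.trans hs.1) hs.1.le
  have hsum : ENNReal.ofReal l + ENNReal.ofReal (1 - l) = 1 := by
    rw [← ENNReal.ofReal_add hl (by linarith)]; simp
  have hl' : 0 ≤ 1 - l := by linarith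
  have hIJ : ENNReal.ofReal l * (∫⁻ s in Ioc x z, d s)
      ≤ ENNReal.ofReal (1 - l) * (∫⁻ s in Ioc z y, d s) := by
    calc ENNReal.ofReal l * (∫⁻ s in Ioc x z, d s)
        ≤ ENNReal.ofReal l * (d z * ENNReal.ofReal (z - x)) := by gcongr
      _ = d z * ENNReal.ofReal (l * (z - x)) := by rw [ENNReal.ofReal_mul hl]; ring
      _ = d z * ENNReal.ofReal ((1 - l) * (y - z)) := by congr 2; rw [hz]; ring
      _ = ENNReal.ofReal (1 - l) * (d z * ENNReal.ofReal (y - z)) := by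
          rw [ENNReal.ofReal_mul hl']; ring
      _ ≤ _ := by gcongr
  rw [hy', hz']
  generalize (∫⁻ s in Ioc (0:ℝ) x, d s) = F at *
  generalize (∫⁻ s in Ioc x z, d s) = I at *
  generalize (∫⁻ s in Ioc z y, d s) = J at *
  calc F + I = (ENNReal.ofReal l + ENNReal.ofReal (1 - l)) * (F + I) := by rw [hsum, one_mul]
    _ = ENNReal.ofReal l * F + ENNReal.ofReal (1 - l) * (F + I) + ENNReal.ofReal l * I := by ring
    _ ≤ ENNReal.ofReal l * F + ENNReal.ofReal (1 - l) * (F + I)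
        + ENNReal.ofReal (1 - l) * J := by gcongr
    _ = _ := by ring

lemma prim_mono (d : ℝ → ℝ≥0∞) : Monotone (fun t : ℝ => ∫⁻ s in Ioc (0:ℝ) t, d s) :=
  fun _ _ h => lintegral_mono_set (Ioc_subset_Ioc_right h)

lemma prim_leftcont (d : ℝ → ℝ≥0∞) (x : ℝ) :
    Tendsto (fun t : ℝ => ∫⁻ s in Ioc (0:ℝ) t, d s) (𝓝[<] x)
      (𝓝 (∫⁻ s in Ioc (0:ℝ) x, d s)) := by
  have h := (prim_mono d).tendsto_nhdsLT x
  convert h using 2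
  apply le_antisymm
  · obtain ⟨u, hu1, hu2, hu3⟩ := exists_seq_strictMono_tendsto x
    have h1 : (∫⁻ s in Ioc (0:ℝ) x, d s) = (volume.withDensity d) (⋃ k, Ioc (0:ℝ) (u k)) := by
      rw [withDensity_apply _ (MeasurableSet.iUnion fun k => measurableSet_Ioc)]
      rw [← setLIntegral_congr (Ioo_ae_eq_Ioc (a := (0:ℝ)) (b := x))]
      congr 2
      ext y
      simp only [mem_Ioo, mem_iUnion, mem_Ioc]
      constructor
      · rintro ⟨h0, h2⟩
        obtain ⟨k, hk⟩ := ((hu3.eventually (lt_mem_nhds h2))).exists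
        exact ⟨k, h0, hk.le⟩
      · rintro ⟨k, h0, h2⟩
        exact ⟨h0, h2.trans_lt (hu2 k)⟩
    rw [h1, Monotone.measure_iUnion]
    · refine iSup_le fun k => ?_
      rw [withDensity_apply _ measurableSet_Ioc]
      exact le_sSup ⟨u k, hu2 k, rfl⟩
    · intro i j hij
      exact Ioc_subset_Ioc_right (hu1.monotone hij)
  · refine sSup_le ?_
    rintro _ ⟨t, ht, rfl⟩
    exact prim_mono d (le_of_lt ht)

lemma prim_young {d : ℝ → ℝ≥0∞} (hd : MonotoneOn d (Ioi 0))
    (h1 : ∃ x : ℝ, 0 < x ∧ (∫⁻ s in Ioc (0:ℝ) x, d s) ≠ 0)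
    (h2 : ∃ x : ℝ, 0 < x ∧ (∫⁻ s in Ioc (0:ℝ) x, d s) ≠ ∞) :
    IsYoung (fun t : ℝ => ∫⁻ s in Ioc (0:ℝ) t, d s) where
  map_zero := by simp
  convex := by
    intro x y hx hy l hl hl1
    rcases le_total x y with h | h
    · exact prim_convex hd hx h hl hl1
    · have := prim_convex hd (l := 1 - l) hy h (by linarith) (by linarith)
      rw [sub_sub_cancel] at this
      rw [add_comm (l * x), add_comm (ENNReal.ofReal l * _)]
      exact this
  left_cont := fun x _ => prim_leftcont d x
  not_zero := h1
  not_top := h2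

end

section

/-! ### The weight `s^{α-1}` -/

/-- The weight. -/
def ww (α s : ℝ) : ℝ≥0∞ := ENNReal.ofReal (s ^ (α - 1))

lemma ww_meas (α : ℝ) : Measurable (ww α) := by
  unfold ww
  fun_prop

/-- Relations between the exponents. -/
structure Expo (α p q : ℝ) : Prop where
  a0 : 0 < α
  a1 : α < 1
  hp : p * (1 - α) = 1
  hq : q = α * p

namespace Expo
variable {α p q : ℝ}
lemma p0 (h : Expo α p q) : 0 < p := by
  have := h.hp
  have h1 := h.a1
  by_contra hc
  nlinarith
lemma q0 (h : Expo α p q) : 0 < q := by rw [h.hq]; exact mul_pos h.a0 h.p0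
lemma pq (h : Expo α p q) : p = 1 + q := by have := h.hp; rw [h.hq]; linarith
end Expo

variable {α p q : ℝ}

lemma w_lt_iff (h : Expo α p q) {x s : ℝ} (hx : 0 < x) (hs : 0 < s) :
    x < s ^ (α - 1) ↔ s < x ^ (-p) := by
  have h1 : (x ^ (-p)) ^ (α - 1) = x := by
    rw [← Real.rpow_mul hx.le]
    have : -p * (α - 1) = 1 := by have := h.hp; linarith
    rw [this, Real.rpow_one]
  have h2 := Real.rpow_lt_rpow_iff_of_neg (x := x ^ (-p)) (y := s) (z := α - 1)
    (Real.rpow_pos_of_pos hx _) hs (by linarith [h.a1])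
  rw [h1] at h2
  exact h2

lemma W_set (h : Expo α p q) {x : ℝ} (hx : 0 < x) :
    {s : ℝ | 0 < s ∧ ENNReal.ofReal x < ww α s} = Ioo 0 (x ^ (-p)) := by
  ext s
  simp only [mem_ofPred_eq, mem_Ioo]
  refine and_congr_right fun hs => ?_
  rw [ww, ENNReal.ofReal_lt_ofReal_iff (Real.rpow_pos_of_pos hs _), w_lt_iff h hx hs]

lemma volW (h : Expo α p q) {X : ℝ≥0∞} (hX : X ≠ 0) :
    (∫⁻ s in Ioi (0:ℝ), if X < ww α s then 1 else 0) ≤ X ^ (-p) := by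
  by_cases ht : X = ∞
  · simp [ht]
  have hx : 0 < X.toReal := ENNReal.toReal_pos hX ht
  have hX' : X = ENNReal.ofReal X.toReal := (ENNReal.ofReal_toReal ht).symm
  have hms : MeasurableSet {s : ℝ | X < ww α s} := measurableSet_lt measurable_const (ww_meas α)
  have : (fun s : ℝ => if X < ww α s then (1:ℝ≥0∞) else 0)
      = {s : ℝ | X < ww α s}.indicator 1 := by
    funext s; simp [indicator_apply]
  rw [this, lintegral_indicator_one hms, Measure.restrict_apply hms]
  have h2 : {s : ℝ | X < ww α s} ∩ Ioi 0 = Ioo 0 (X.toReal ^ (-p)) := by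
    rw [← W_set h hx, ← hX']
    ext s; simp [and_comm]
  rw [h2, Real.volume_Ioo, sub_zero, ← ENNReal.ofReal_rpow_of_pos hx, ← hX']

lemma intW (h : Expo α p q) {X : ℝ≥0∞} (hX : X ≠ 0) :
    (∫⁻ s in Ioi (0:ℝ), if X < ww α s then ww α s else 0)
      ≤ ENNReal.ofReal (1 / α) * X ^ (-q) := by
  by_cases ht : X = ∞
  · simp [ht]
  have hx : 0 < X.toReal := ENNReal.toReal_pos hX ht
  have hX' : X = ENNReal.ofReal X.toReal := (ENNReal.ofReal_toReal ht).symm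
  have hms : MeasurableSet {s : ℝ | X < ww α s} := measurableSet_lt measurable_const (ww_meas α)
  have : (fun s : ℝ => if X < ww α s then ww α s else 0)
      = {s : ℝ | X < ww α s}.indicator (ww α) := by
    funext s; simp [indicator_apply]
  rw [this, lintegral_indicator hms, Measure.restrict_restrict hms]
  have h2 : {s : ℝ | X < ww α s} ∩ Ioi 0 = Ioo 0 (X.toReal ^ (-p)) := by
    rw [← W_set h hx, ← hX']
    ext s; simp [and_comm]
  have hσ : 0 ≤ X.toReal ^ (-p) := Real.rpow_nonneg hx.le _
  rw [h2, setLIntegral_congr Ioo_ae_eq_Ioc]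
  unfold ww
  rw [lint_rpow (by linarith [h.a0]) hσ]
  rw [sub_add_cancel, ← Real.rpow_mul hx.le]
  have : -p * α = -q := by rw [h.hq]; ring
  rw [this, div_eq_mul_inv, mul_comm, ENNReal.ofReal_mul (by have := h.a0; positivity),
    ← ENNReal.ofReal_rpow_of_pos hx, ← hX', one_div]

lemma intW_lower (h : Expo α p q) {X : ℝ≥0∞} (hX : X ≠ 0) (ht : X ≠ ∞) {t : ℝ} (ht0 : 0 ≤ t)
    (h2t : ENNReal.ofReal (2 * t) ≤ X ^ (-p)) :
    ENNReal.ofReal (1 / 2) * X ^ (-q) ≤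
    (∫⁻ s in Ioi t, if X < ww α s then ww α s else 0) := by
  have hx : 0 < X.toReal := ENNReal.toReal_pos hX ht
  have hX' : X = ENNReal.ofReal X.toReal := (ENNReal.ofReal_toReal ht).symm
  set x := X.toReal
  set σ := x ^ (-p) with hσd
  have hσ : 0 < σ := Real.rpow_pos_of_pos hx _
  have h2t' : 2 * t ≤ σ := by
    rw [hX', ENNReal.ofReal_rpow_of_pos hx] at h2t
    exact (ENNReal.ofReal_le_ofReal_iff hσ.le).1 h2t
  calc ENNReal.ofReal (1 / 2) * X ^ (-q)
      = ENNReal.ofReal (σ ^ (α - 1)) * ENNReal.ofReal (σ / 2) := by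
        rw [hX', ENNReal.ofReal_rpow_of_pos hx, ← ENNReal.ofReal_mul (by norm_num),
          ← ENNReal.ofReal_mul (Real.rpow_nonneg hσ.le _)]
        congr 1
        have e1 : σ ^ (α - 1) * σ = σ ^ α := by
          nth_rewrite 2 [← Real.rpow_one σ]
          rw [← Real.rpow_add hσ]; congr 1; ring
        have e2 : σ ^ α = x ^ (-q) := by
          rw [hσd, ← Real.rpow_mul hx.le]; congr 1; rw [h.hq]; ring
        rw [← e2, ← e1]; ring
    _ ≤ ∫⁻ s in Ioo t σ, ENNReal.ofReal (σ ^ (α - 1)) := by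
        rw [setLIntegral_const, Real.volume_Ioo]
        gcongr
        linarith
    _ ≤ ∫⁻ s in Ioo t σ, (if X < ww α s then ww α s else 0) := by
        refine setLIntegral_mono' measurableSet_Ioo fun s hs => ?_
        have hs0 : 0 < s := ht0.trans_lt hs.1
        have : s ∈ {s : ℝ | 0 < s ∧ ENNReal.ofReal x < ww α s} := by
          rw [W_set h hx]; exact ⟨hs0, hs.2⟩
        rw [hX', if_pos this.2, ww]
        refine ENNReal.ofReal_le_ofReal ?_
        exact Real.rpow_le_rpow_of_nonpos hs0 hs.2.le (by linarith [h.a1])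
    _ ≤ _ := lintegral_mono_set fun s hs => hs.1

/-- Hardy operator with parameter `α`. -/
def TT (α : ℝ) (f : ℝ → ℝ≥0∞) (t : ℝ) : ℝ≥0∞ := ∫⁻ s in Ioi t, f s * ww α s

lemma TT_le (h : Expo α p q) {g : ℝ → ℝ≥0∞} (hg1 : (∫⁻ s in Ioi (0:ℝ), g s) ≤ 1)
    {t : ℝ} (ht : 0 < t) : TT α g t ≤ ww α t := by
  calc TT α g t ≤ ∫⁻ s in Ioi t, g s * ww α t := by
        refine setLIntegral_mono' measurableSet_Ioi fun s hs => ?_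
        gcongr
        unfold ww
        exact ENNReal.ofReal_le_ofReal
          (Real.rpow_le_rpow_of_nonpos ht (le_of_lt hs) (by linarith [h.a1]))
    _ = (∫⁻ s in Ioi t, g s) * ww α t := lintegral_mul_const' _ _ ENNReal.ofReal_ne_top
    _ ≤ 1 * ww α t := by
        gcongr
        exact (lintegral_mono_set (Ioi_subset_Ioi ht.le)).trans hg1
    _ = _ := one_mul _

lemma TT_meas {f : ℝ → ℝ≥0∞} : Measurable (TT α f) := by
  have : Antitone (TT α f) := fun x y hxy => lintegral_mono_set (Ioi_subset_Ioi hxy)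
  exact this.measurable

lemma TT_strong (h : Expo α p q) {g : ℝ → ℝ≥0∞} (hg : Measurable g)
    (hg1 : (∫⁻ s in Ioi (0:ℝ), g s) ≤ 1) :
    (∫⁻ t in Ioi (0:ℝ), (TT α g t) ^ p) ≤ ENNReal.ofReal p := by
  have hwm := ww_meas α
  calc (∫⁻ t in Ioi (0:ℝ), (TT α g t) ^ p)
      ≤ ∫⁻ t in Ioi (0:ℝ), TT α g t * ENNReal.ofReal (t ^ (-α)) := by
        refine setLIntegral_mono' measurableSet_Ioi fun t ht => ?_
        have ht' : (0:ℝ) < t := ht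
        rw [h.pq, ENNReal.rpow_add_of_nonneg _ _ zero_le_one h.q0.le, ENNReal.rpow_one]
        gcongr
        refine (ENNReal.rpow_le_rpow (TT_le h hg1 ht') h.q0.le).trans ?_
        unfold ww
        rw [ENNReal.ofReal_rpow_of_nonneg (Real.rpow_nonneg ht'.le _) h.q0.le,
          ← Real.rpow_mul ht'.le]
        have : (α - 1) * q = -α := by
          rw [h.hq]; linear_combination (-α) * h.hp
        rw [this]
    _ = ∫⁻ t in Ioi (0:ℝ), ∫⁻ s in Ioi (0:ℝ),
          (if t < s then g s * ww α s * ENNReal.ofReal (t ^ (-α)) else 0) := by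
        refine setLIntegral_congr_fun measurableSet_Ioi fun t ht => ?_
        have ht' : (0:ℝ) < t := ht
        have e : (fun s : ℝ => if t < s then g s * ww α s * ENNReal.ofReal (t ^ (-α)) else 0)
            = (Ioi t).indicator (fun s => g s * ww α s * ENNReal.ofReal (t ^ (-α))) := by
          funext s; simp [indicator_apply]
        rw [e, lintegral_indicator measurableSet_Ioi, Measure.restrict_restrict measurableSet_Ioi,
          inter_eq_left.2 (Ioi_subset_Ioi ht'.le), lintegral_mul_const' _ _ ENNReal.ofReal_ne_top]
        rfl
    _ = ∫⁻ s in Ioi (0:ℝ), ∫⁻ t in Ioi (0:ℝ),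
          (if t < s then g s * ww α s * ENNReal.ofReal (t ^ (-α)) else 0) := by
        refine lintegral_lintegral_swap ?_
        refine Measurable.aemeasurable ?_
        refine Measurable.ite (measurableSet_lt measurable_fst measurable_snd) ?_ measurable_const
        fun_prop
    _ ≤ ∫⁻ s in Ioi (0:ℝ), g s * ENNReal.ofReal p := by
        refine setLIntegral_mono' measurableSet_Ioi fun s hs => ?_
        have hs' : (0:ℝ) < s := hs
        have e : (fun t : ℝ => if t < s then g s * ww α s * ENNReal.ofReal (t ^ (-α)) else 0)
            = (Iio s).indicator (fun t => g s * ww α s * ENNReal.ofReal (t ^ (-α))) := by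
          funext t; simp [indicator_apply]
        rw [e, lintegral_indicator measurableSet_Iio, Measure.restrict_restrict measurableSet_Iio,
          lintegral_const_mul _ (by fun_prop), mul_assoc]
        gcongr
        have : (∫⁻ t in Iio s ∩ Ioi 0, ENNReal.ofReal (t ^ (-α)))
            ≤ ∫⁻ t in Ioc (0:ℝ) s, ENNReal.ofReal (t ^ (-α)) :=
          lintegral_mono_set fun t ht => ⟨ht.2, ht.1.le⟩
        refine (mul_le_mul_right this _).trans ?_
        rw [lint_rpow (by linarith [h.a1]) hs'.le, ww,
          ← ENNReal.ofReal_mul (Real.rpow_nonneg hs'.le _)]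
        refine ENNReal.ofReal_le_ofReal (le_of_eq ?_)
        have e1 : s ^ (α - 1) * s ^ (-α + 1) = 1 := by
          rw [← Real.rpow_add hs']; ring_nf; exact Real.rpow_zero s
        have h1 : -α + 1 ≠ 0 := by linarith [h.a1]
        rw [← mul_div_assoc, e1, div_eq_iff h1]
        linarith [h.hp]
    _ = (∫⁻ s in Ioi (0:ℝ), g s) * ENNReal.ofReal p :=
        lintegral_mul_const' _ _ ENNReal.ofReal_ne_top
    _ ≤ 1 * ENNReal.ofReal p := by gcongr
    _ = _ := one_mul _

/-- The key estimate for truncated functions. -/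
lemma trunc_est (h : Expo α p q) {A : ℝ → ℝ≥0∞} (hA : IsYoung A)
    (hA0 : ∀ s : ℝ, 0 < s → A s ≠ 0) {f : ℝ → ℝ≥0∞} (hf : Measurable f)
    (hf1 : (∫⁻ s in Ioi (0:ℝ), eext A (f s)) ≤ 1) {r : ℝ} {K : ℝ≥0∞} (hK0 : K ≠ 0)
    (hKt : K ≠ ∞)
    (hK : (∫⁻ s in Ioc (0:ℝ) r, (aa A s)⁻¹ ^ q) ≤ K ^ p) :
    (∫⁻ s in Ioi (0:ℝ), min (f s) (ENNReal.ofReal r) * ww α s)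
      ≤ ENNReal.ofReal (1 + 1 / α) * K := by
  have hwm := ww_meas α
  have ham := aa_measurable hA
  have hms : MeasurableSet {z : ℝ × ℝ | ENNReal.ofReal z.2 < f z.1} :=
    measurableSet_lt (by fun_prop) (by fun_prop)
  have hms2 : MeasurableSet {z : ℝ × ℝ | K * aa A z.2 < ww α z.1} :=
    measurableSet_lt (by fun_prop) (by fun_prop)
  have step1 : ∀ s : ℝ, min (f s) (ENNReal.ofReal r) * ww α s ≤
      ∫⁻ l in Ioc (0:ℝ) r, (if ENNReal.ofReal l < f s then ww α s else 0) := by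
    intro s
    have hms3 : MeasurableSet {l : ℝ | ENNReal.ofReal l < f s} :=
      measurableSet_lt (by fun_prop) (by fun_prop)
    have e : (fun l : ℝ => if ENNReal.ofReal l < f s then ww α s else 0)
        = {l : ℝ | ENNReal.ofReal l < f s}.indicator (fun _ => ww α s) := by
      funext l; simp [indicator_apply]
    rw [e, lintegral_indicator hms3, Measure.restrict_restrict hms3, setLIntegral_const, mul_comm]
    gcongr
    set c := (min (f s) (ENNReal.ofReal r)).toReal with hc
    have hcne : min (f s) (ENNReal.ofReal r) ≠ ∞ :=
      ne_top_of_le_ne_top ENNReal.ofReal_ne_top (min_le_right _ _)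
    have hc' : min (f s) (ENNReal.ofReal r) = ENNReal.ofReal c := (ENNReal.ofReal_toReal hcne).symm
    rw [hc']
    calc ENNReal.ofReal c = volume (Ioo 0 c) := by rw [Real.volume_Ioo, sub_zero]
      _ ≤ _ := by
        refine measure_mono fun l hl => ?_
        have h1 : ENNReal.ofReal l < min (f s) (ENNReal.ofReal r) := by
          rw [hc']; exact (ENNReal.ofReal_lt_ofReal_iff (hl.1.trans hl.2)).2 hl.2
        obtain ⟨h2, h3⟩ := lt_min_iff.1 h1
        refine ⟨h2, hl.1, ?_⟩
        by_contra hcon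
        exact absurd h3 (not_lt.2 (ENNReal.ofReal_le_ofReal (not_le.1 hcon).le))
  have step2 : ∀ s : ℝ, (∫⁻ l in Ioc (0:ℝ) r, (if ENNReal.ofReal l < f s then ww α s else 0))
      ≤ (∫⁻ l in Ioc (0:ℝ) r, (if ENNReal.ofReal l < f s then K * aa A l else 0))
        + ∫⁻ l in Ioc (0:ℝ) r, (if K * aa A l < ww α s then ww α s else 0) := by
    intro s
    rw [← lintegral_add_left]
    · refine lintegral_mono fun l => ?_
      simp only
      split_ifs with h1 h2 h2
      · exact le_add_self
      · simpa using not_lt.1 h2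
      · simp
      · simp
    · refine Measurable.ite (measurableSet_lt (by fun_prop) (by fun_prop)) ?_ measurable_const
      fun_prop
  have step3 : ∀ s : ℝ, (∫⁻ l in Ioc (0:ℝ) r, (if ENNReal.ofReal l < f s then K * aa A l else 0))
      ≤ K * eext A (f s) := by
    intro s
    have e0 : (fun l : ℝ => if ENNReal.ofReal l < f s then K * aa A l else 0)
        = fun l => K * (if ENNReal.ofReal l < f s then aa A l else 0) := by
      funext l; split_ifs <;> simp
    rw [e0, lintegral_const_mul' _ _ hKt]
    gcongr
    by_cases hft : f s = ∞
    · simp [eext, hft]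
    rw [eext, if_neg hft]
    set c := (f s).toReal with hc
    have hc' : f s = ENNReal.ofReal c := (ENNReal.ofReal_toReal hft).symm
    rcases eq_or_lt_of_le (ENNReal.toReal_nonneg : 0 ≤ (f s).toReal) with h0 | h0
    · rw [← hc] at h0
      rw [hc', ← h0]; simp
    calc (∫⁻ l in Ioc (0:ℝ) r, (if ENNReal.ofReal l < f s then aa A l else 0))
        ≤ ∫⁻ l in Ioc (0:ℝ) r, (Ioo 0 c).indicator (fun _ => aa A c) l := by
          refine setLIntegral_mono' measurableSet_Ioc fun l hl => ?_
          split_ifs with h1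
          · rw [hc', ENNReal.ofReal_lt_ofReal_iff h0] at h1
            rw [indicator_of_mem (show l ∈ Ioo 0 c from ⟨hl.1, h1⟩)]
            exact aa_mono hA hl.1 h1.le
          · exact zero_le
      _ ≤ ∫⁻ l, (Ioo 0 c).indicator (fun _ => aa A c) l := setLIntegral_le_lintegral _ _
      _ = A c := by
          rw [lintegral_indicator measurableSet_Ioo, setLIntegral_const, Real.volume_Ioo, sub_zero,
            mul_comm, mul_aa A h0]
  calc (∫⁻ s in Ioi (0:ℝ), min (f s) (ENNReal.ofReal r) * ww α s)
      ≤ ∫⁻ s in Ioi (0:ℝ), (K * eext A (f s)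
        + ∫⁻ l in Ioc (0:ℝ) r, (if K * aa A l < ww α s then ww α s else 0)) := by
        refine lintegral_mono fun s => ?_
        exact (step1 s).trans ((step2 s).trans (add_le_add_left (step3 s) _))
    _ = K * (∫⁻ s in Ioi (0:ℝ), eext A (f s))
        + ∫⁻ s in Ioi (0:ℝ), ∫⁻ l in Ioc (0:ℝ) r, (if K * aa A l < ww α s then ww α s else 0) := by
        rw [lintegral_add_left, lintegral_const_mul' _ _ hKt]
        exact ((eext_measurable hA).comp hf).const_mul _
    _ = K * (∫⁻ s in Ioi (0:ℝ), eext A (f s))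
        + ∫⁻ l in Ioc (0:ℝ) r, ∫⁻ s in Ioi (0:ℝ), (if K * aa A l < ww α s then ww α s else 0) := by
        congr 1
        refine lintegral_lintegral_swap (Measurable.aemeasurable ?_)
        refine Measurable.ite hms2 ?_ measurable_const
        fun_prop
    _ ≤ K * 1 + ∫⁻ l in Ioc (0:ℝ) r, ENNReal.ofReal (1 / α) * K ^ (-q) * (aa A l)⁻¹ ^ q := by
        gcongr ?_ + ?_
        · gcongr
        · refine setLIntegral_mono' measurableSet_Ioc fun l hl => ?_
          have ha0 : aa A l ≠ 0 := by
            intro h0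
            have := mul_aa A hl.1
            rw [h0, mul_zero] at this
            exact hA0 l hl.1 this.symm
          refine (intW h (mul_ne_zero hK0 ha0)).trans (le_of_eq ?_)
          rw [mul_assoc, ENNReal.mul_rpow_of_ne_zero hK0 ha0, ENNReal.rpow_neg (aa A l),
            ENNReal.inv_rpow]
    _ = K + ENNReal.ofReal (1 / α) * K ^ (-q) * (∫⁻ l in Ioc (0:ℝ) r, (aa A l)⁻¹ ^ q) := by
        rw [mul_one, lintegral_const_mul _ (by fun_prop)]
    _ ≤ K + ENNReal.ofReal (1 / α) * K ^ (-q) * K ^ p := by gcongr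
    _ = _ := by
        rw [mul_assoc, ← ENNReal.rpow_add _ _ hK0 hKt, h.pq, neg_add_cancel_comm_assoc,
          ENNReal.rpow_one, ENNReal.ofReal_add zero_le_one (by have := h.a0; positivity),
          ENNReal.ofReal_one, add_mul, one_mul]

end

section

variable {α p q : ℝ}

lemma aa_ne_zero {A : ℝ → ℝ≥0∞} (hA0 : ∀ s : ℝ, 0 < s → A s ≠ 0) {l : ℝ} (hl : 0 < l) :
    aa A l ≠ 0 := by
  intro h0
  have := mul_aa A hl
  rw [h0, mul_zero] at this
  exact hA0 l hl this.symm

/-- Splitting of the Hardy operator at height `r`. -/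
lemma split_est (h : Expo α p q) {A : ℝ → ℝ≥0∞} (hA : IsYoung A)
    (hA0 : ∀ s : ℝ, 0 < s → A s ≠ 0) {f : ℝ → ℝ≥0∞} (hf : Measurable f)
    (hf1 : (∫⁻ s in Ioi (0:ℝ), eext A (f s)) ≤ 1) {r t : ℝ} (hr : 0 < r) (ht : 0 < t)
    {K : ℝ≥0∞} (hK0 : K ≠ 0) (hKt : K ≠ ∞)
    (hK : (∫⁻ s in Ioc (0:ℝ) r, (aa A s)⁻¹ ^ q) ≤ K ^ p) :
    ∃ R : ℝ≥0∞, TT α f t ≤ ENNReal.ofReal (1 + 1 / α) * K + R ∧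
      R * aa A r ≤ TT α (fun s => eext A (f s)) t := by
  have hwm := ww_meas α
  have hms : MeasurableSet {s : ℝ | ENNReal.ofReal r < f s} :=
    measurableSet_lt (by fun_prop) (by fun_prop)
  have hm1 : Measurable (fun s => min (f s) (ENNReal.ofReal r) * ww α s) := by fun_prop
  have hm2 : Measurable (fun s => (if ENNReal.ofReal r < f s then f s else 0) * ww α s) :=
    (Measurable.ite hms hf measurable_const).mul hwm
  refine ⟨∫⁻ s in Ioi t, (if ENNReal.ofReal r < f s then f s else 0) * ww α s, ?_, ?_⟩
  · refine le_trans ?_ (add_le_add_left ((lintegral_mono_set (Ioi_subset_Ioi ht.le)).trans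
      (trunc_est h hA hA0 hf hf1 hK0 hKt hK)) _)
    rw [← lintegral_add_left hm1]
    refine lintegral_mono fun s => ?_
    simp only
    rw [← add_mul]
    gcongr
    split_ifs with h1
    · exact le_add_self
    · simp [not_lt.1 h1]
  · rw [← lintegral_mul_const _ hm2]
    refine lintegral_mono fun s => ?_
    simp only
    rw [mul_right_comm]
    gcongr
    split_ifs with h1
    · by_cases hft : f s = ∞
      · simp [eext, hft]
      · rw [eext, if_neg hft]
        have hc' : f s = ENNReal.ofReal (f s).toReal := (ENNReal.ofReal_toReal hft).symm
        have h2 : r < (f s).toReal := (ENNReal.ofReal_lt_iff_lt_toReal hr.le hft).1 h1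
        rw [← mul_aa A (hr.trans h2), ← hc']
        gcongr
        exact aa_mono hA hr h2.le
    · simp

lemma pt_est (h : Expo α p q) {A : ℝ → ℝ≥0∞} (hA : IsYoung A)
    (hA0 : ∀ s : ℝ, 0 < s → A s ≠ 0) {f : ℝ → ℝ≥0∞} (hf : Measurable f)
    (hf1 : (∫⁻ s in Ioi (0:ℝ), eext A (f s)) ≤ 1) {r t : ℝ} (hr : 0 < r) (ht : 0 < t)
    {y : ℝ≥0∞} (hy0 : y ≠ 0) (hyt : y ≠ ∞)
    (hK : (∫⁻ s in Ioc (0:ℝ) r, (aa A s)⁻¹ ^ q) ≤ y ^ p) {C : ℝ} (hC : 2 * (1 + 1 / α) ≤ C)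
    (hu : TT α f t = ENNReal.ofReal C * y) :
    y * aa A r ≤ ENNReal.ofReal (2 / C) * TT α (fun s => eext A (f s)) t := by
  have hα := h.a0
  have hC0 : 0 < C := lt_of_lt_of_le (by positivity) hC
  obtain ⟨R, h1, h2⟩ := split_est h hA hA0 hf hf1 hr ht hy0 hyt hK
  rw [hu] at h1
  have h3 : ENNReal.ofReal (C / 2) * y + ENNReal.ofReal (C / 2) * y
      ≤ ENNReal.ofReal (C / 2) * y + R := by
    calc ENNReal.ofReal (C / 2) * y + ENNReal.ofReal (C / 2) * y = ENNReal.ofReal C * y := by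
          rw [← add_mul, ← ENNReal.ofReal_add (by positivity) (by positivity)]
          congr 2; ring
      _ ≤ _ := h1
      _ ≤ _ := by
          gcongr
          linarith
  have h4 := (ENNReal.add_le_add_iff_left (ENNReal.mul_ne_top ENNReal.ofReal_ne_top hyt)).1 h3
  calc y * aa A r = ENNReal.ofReal (2 / C) * (ENNReal.ofReal (C / 2) * y * aa A r) := by
        rw [← mul_assoc, ← mul_assoc, ← ENNReal.ofReal_mul (by positivity)]
        have : 2 / C * (C / 2) = 1 := by field_simp
        rw [this]; simp
    _ ≤ ENNReal.ofReal (2 / C) * (R * aa A r) := by gcongr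
    _ ≤ _ := by gcongr

lemma geninv_spec {H : ℝ → ℝ≥0∞} (hc : Continuous H) (hm : Monotone H) (h0 : H 0 = 0)
    {Y : ℝ≥0∞} (hY : 0 < Y) (hY' : Y < ⨆ t, H t) :
    ∃ r : ℝ, 0 < r ∧ geninv H Y = ENNReal.ofReal r ∧ H r = Y := by
  set S : Set ℝ := {s | 0 ≤ s ∧ Y ≤ H s} with hS
  have hne : S.Nonempty := by
    obtain ⟨t, ht⟩ := lt_iSup_iff.1 hY'
    exact ⟨max t 0, le_max_right _ _, ht.le.trans (hm (le_max_left _ _))⟩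
  have hcl : IsClosed S :=
    (isClosed_le continuous_const continuous_id).inter (isClosed_le continuous_const hc)
  have hbd : BddBelow S := ⟨0, fun s hs => hs.1⟩
  have hr := hcl.csInf_mem hne hbd
  set r := sInf S
  have hr0 : 0 < r := by
    rcases eq_or_lt_of_le hr.1 with h | h
    · have := hr.2
      rw [← h, h0] at this
      exact absurd hY (not_lt.2 this)
    · exact h
  refine ⟨r, hr0, ?_, ?_⟩
  · unfold geninv
    apply le_antisymm
    · exact iInf_le_of_le r (iInf_le_of_le hr.1 (iInf_le_of_le hr.2 le_rfl))
    · refine le_iInf fun s => le_iInf fun hs => le_iInf fun hs' => ?_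
      exact ENNReal.ofReal_le_ofReal (csInf_le hbd ⟨hs, hs'⟩)
  · refine le_antisymm ?_ hr.2
    have h1 : Tendsto H (𝓝[<] r) (𝓝 (H r)) := hc.continuousAt.tendsto.mono_left nhdsWithin_le_nhds
    refine le_of_tendsto h1 ?_
    filter_upwards [self_mem_nhdsWithin] with s hs
    by_contra hcon
    have hs2 : Y ≤ H s := (not_le.1 hcon).le
    have hs3 : 0 ≤ s := by
      by_contra hneg
      have := hm (not_le.1 hneg).le
      rw [h0] at this
      exact absurd hY (not_lt.2 (hs2.trans this))
    exact absurd hs (not_lt.2 (csInf_le hbd ⟨hs3, hs2⟩))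

lemma geninv_mono (H : ℝ → ℝ≥0∞) : Monotone (geninv H) := by
  intro x y hxy
  unfold geninv
  exact iInf_mono fun s => iInf_mono fun hs => le_iInf fun h => iInf_le_of_le (hxy.trans h) le_rfl

/-- primitive of the integrand -/
def GG (A : ℝ → ℝ≥0∞) (q t : ℝ) : ℝ≥0∞ := ∫⁻ s in Ioc (0:ℝ) t, (aa A s)⁻¹ ^ q

lemma GG_eq (A : ℝ → ℝ≥0∞) (q t : ℝ) :
    (∫⁻ s in Ioc (0:ℝ) t, (ENNReal.ofReal s / A s) ^ q) = GG A q t :=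
  setLIntegral_congr_fun measurableSet_Ioc fun _ hs => hh_eq A q hs.1

lemma GG_pos {A : ℝ → ℝ≥0∞} (hA : IsYoung A) (hq : 0 < q) (hfin : ∃ t0 : ℝ, 0 < t0 ∧ GG A q t0 < ∞) :
    ∀ s : ℝ, 0 < s → A s ≠ 0 := by
  obtain ⟨t0, ht0, hG⟩ := hfin
  intro s hs h0
  have hmin : 0 < min s t0 := lt_min hs ht0
  have : (∞ : ℝ≥0∞) ≤ GG A q t0 := by
    calc (∞ : ℝ≥0∞) = ∫⁻ _ in Ioc (0:ℝ) (min s t0), ∞ := by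
          rw [setLIntegral_const, Real.volume_Ioc, sub_zero, ENNReal.top_mul]
          simpa using hmin
      _ ≤ ∫⁻ x in Ioc (0:ℝ) (min s t0), (aa A x)⁻¹ ^ q := by
          refine setLIntegral_mono' measurableSet_Ioc fun x hx => ?_
          have : A x = 0 := le_antisymm ((young_mono hA hx.1.le
            (hx.2.trans (min_le_left _ _))).trans h0.le) zero_le
          rw [aa_pos_eq A hx.1, this]
          simp [hq]
      _ ≤ _ := lintegral_mono_set (Ioc_subset_Ioc_right (min_le_right _ _))
  exact absurd hG (not_lt.2 this)

lemma GG_fin {A : ℝ → ℝ≥0∞} (hA : IsYoung A) (hq : 0 < q)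
    (hfin : ∃ t0 : ℝ, 0 < t0 ∧ GG A q t0 < ∞) (t : ℝ) : GG A q t ≠ ∞ := by
  have hA0 := GG_pos hA hq hfin
  obtain ⟨t0, ht0, hG⟩ := hfin
  have h1 : GG A q t ≤ GG A q t0 + ∫⁻ s in Ioc t0 t, (aa A s)⁻¹ ^ q := by
    unfold GG
    refine le_trans (lintegral_mono_set (Ioc_subset_Ioc_union_Ioc (b := t0))) ?_
    exact lintegral_union_le _ _ _
  have h2 : (∫⁻ s in Ioc t0 t, (aa A s)⁻¹ ^ q) ≤ (aa A t0)⁻¹ ^ q * ENNReal.ofReal (t - t0) := by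
    rw [← Real.volume_Ioc, ← setLIntegral_const]
    refine setLIntegral_mono' measurableSet_Ioc fun x hx => ?_
    refine ENNReal.rpow_le_rpow (ENNReal.inv_le_inv.2 (aa_mono hA ht0 hx.1.le)) hq.le
  refine ne_top_of_le_ne_top ?_ (h1.trans (add_le_add_right h2 _))
  refine ENNReal.add_ne_top.2 ⟨hG.ne, ENNReal.mul_ne_top ?_ ENNReal.ofReal_ne_top⟩
  refine ENNReal.rpow_ne_top_of_nonneg hq.le ?_
  simpa using aa_ne_zero hA0 ht0

lemma GG_lower {A : ℝ → ℝ≥0∞} (hA : IsYoung A) (hq : 0 < q) {t : ℝ} :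
    (aa A t)⁻¹ ^ q * ENNReal.ofReal t ≤ GG A q t := by
  have : ENNReal.ofReal t = volume (Ioc 0 t) := by rw [Real.volume_Ioc, sub_zero]
  rw [this, ← setLIntegral_const]
  refine setLIntegral_mono' measurableSet_Ioc fun x hx => ?_
  exact ENNReal.rpow_le_rpow (ENNReal.inv_le_inv.2 (aa_mono hA hx.1 hx.2)) hq.le

lemma GG_cont {A : ℝ → ℝ≥0∞} (hA : IsYoung A) (hq : 0 < q)
    (hfin : ∃ t0 : ℝ, 0 < t0 ∧ GG A q t0 < ∞) : Continuous (GG A q) :=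
  cont_prim (by have := aa_measurable hA; fun_prop) (GG_fin hA hq hfin)

lemma expo_mn {m n : ℕ} (hm : 1 ≤ m) (hmn : m < n) :
    Expo ((m:ℝ)/n) ((n:ℝ)/((n:ℝ)-m)) ((m:ℝ)/((n:ℝ)-m)) := by
  have h1 : (0:ℝ) < m := by exact_mod_cast hm
  have h2 : (m:ℝ) < n := by exact_mod_cast hmn
  have h3 : (0:ℝ) < n := h1.trans h2
  have h4 : (0:ℝ) < (n:ℝ) - m := by linarith
  refine ⟨by positivity, (div_lt_one h3).2 h2, ?_, ?_⟩ <;> field_simp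

lemma Hm_eq (m n : ℕ) (A : ℝ → ℝ≥0∞) (t : ℝ) :
    Hm m n A t = GG A ((m:ℝ)/((n:ℝ)-m)) t ^ (((n:ℝ)-m)/n) := by
  rw [Hm, GG_eq]

/-- Everything about `H_m` that we need. -/
structure HData (m n : ℕ) (A : ℝ → ℝ≥0∞) : Prop where
  hA : IsYoung A
  hm : 1 ≤ m
  hmn : m < n
  fin : ∃ t0 : ℝ, 0 < t0 ∧ GG A ((m:ℝ)/((n:ℝ)-m)) t0 < ∞

namespace HData
variable {m n : ℕ} {A : ℝ → ℝ≥0∞}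

lemma expo (h : HData m n A) : Expo ((m:ℝ)/n) ((n:ℝ)/((n:ℝ)-m)) ((m:ℝ)/((n:ℝ)-m)) :=
  expo_mn h.hm h.hmn

lemma exp_pos (h : HData m n A) : (0:ℝ) < ((n:ℝ)-m)/n := by
  have h1 : (0:ℝ) < m := by exact_mod_cast h.hm
  have h2 : (m:ℝ) < n := by exact_mod_cast h.hmn
  have h3 : (0:ℝ) < n := h1.trans h2
  have h4 : (0:ℝ) < (n:ℝ) - m := by linarith
  positivity

lemma Hm_pow (h : HData m n A) (t : ℝ) :
    Hm m n A t ^ ((n:ℝ)/((n:ℝ)-m)) = GG A ((m:ℝ)/((n:ℝ)-m)) t := by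
  have h1 : (0:ℝ) < m := by exact_mod_cast h.hm
  have h2 : (m:ℝ) < n := by exact_mod_cast h.hmn
  have h3 : (0:ℝ) < n := h1.trans h2
  have h4 : (0:ℝ) < (n:ℝ) - m := by linarith
  rw [Hm_eq, ← ENNReal.rpow_mul]
  have : ((n:ℝ)-m)/n * ((n:ℝ)/((n:ℝ)-m)) = 1 := by field_simp
  rw [this, ENNReal.rpow_one]

lemma A0 (h : HData m n A) : ∀ s : ℝ, 0 < s → A s ≠ 0 := GG_pos h.hA h.expo.q0 h.fin

lemma Hm_cont (h : HData m n A) : Continuous (Hm m n A) := by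
  have : Hm m n A = fun t => GG A ((m:ℝ)/((n:ℝ)-m)) t ^ (((n:ℝ)-m)/n) := by
    funext t; exact Hm_eq m n A t
  rw [this]
  exact ENNReal.continuous_rpow_const.comp (GG_cont h.hA h.expo.q0 h.fin)

lemma Hm_mono (h : HData m n A) : Monotone (Hm m n A) := by
  intro x y hxy
  rw [Hm_eq, Hm_eq]
  exact ENNReal.rpow_le_rpow (prim_mono _ hxy) h.exp_pos.le

lemma Hm_zero (h : HData m n A) : Hm m n A 0 = 0 := by
  rw [Hm_eq, GG]
  simp [h.exp_pos]

lemma Hm_ne_top (h : HData m n A) (t : ℝ) : Hm m n A t ≠ ∞ := by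
  rw [Hm_eq]
  exact ENNReal.rpow_ne_top_of_nonneg h.exp_pos.le (GG_fin h.hA h.expo.q0 h.fin t)

lemma spec (h : HData m n A) {y : ℝ} (hy : 0 < y) (hy' : ENNReal.ofReal y < Hinfty m n A) :
    ∃ r : ℝ, 0 < r ∧ geninv (Hm m n A) (ENNReal.ofReal y) = ENNReal.ofReal r ∧
      Hm m n A r = ENNReal.ofReal y ∧
      Dm m n A y = (ENNReal.ofReal y * aa A r) ^ ((n:ℝ)/((n:ℝ)-m)) := by
  obtain ⟨r, hr, h1, h2⟩ := geninv_spec h.Hm_cont h.Hm_mono h.Hm_zero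
    (ENNReal.ofReal_pos.2 hy) hy'
  refine ⟨r, hr, h1, h2, ?_⟩
  rw [Dm, if_pos hy', h1, ENNReal.toReal_ofReal hr.le, mul_div_assoc, aa_pos_eq A hr]

lemma Dm_mono (h : HData m n A) :
    MonotoneOn (fun s => Dm m n A s / ENNReal.ofReal s) (Ioi 0) := by
  intro x hx y hy hxy
  have hx' : (0:ℝ) < x := hx
  have hy0 : (0:ℝ) < y := hy
  simp only
  by_cases hyH : ENNReal.ofReal y < Hinfty m n A
  · have hxH : ENNReal.ofReal x < Hinfty m n A := (ENNReal.ofReal_le_ofReal hxy).trans_lt hyH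
    obtain ⟨r, hr, h1, -, h3⟩ := h.spec hx' hxH
    obtain ⟨r', hr', h1', -, h3'⟩ := h.spec hy0 hyH
    have hrr : r ≤ r' := by
      have := geninv_mono (Hm m n A) (ENNReal.ofReal_le_ofReal hxy)
      rw [h1, h1'] at this
      exact (ENNReal.ofReal_le_ofReal_iff hr'.le).1 this
    have key : ∀ z : ℝ, 0 < z → ∀ b : ℝ≥0∞,
        (ENNReal.ofReal z * b) ^ ((n:ℝ)/((n:ℝ)-m)) / ENNReal.ofReal z
        = ENNReal.ofReal z ^ ((m:ℝ)/((n:ℝ)-m)) * b ^ ((n:ℝ)/((n:ℝ)-m)) := by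
      intro z hz b
      have hz0 : ENNReal.ofReal z ≠ 0 := by simpa using hz
      rw [ENNReal.mul_rpow_of_nonneg _ _ h.expo.p0.le, h.expo.pq,
        ENNReal.rpow_add _ _ hz0 ENNReal.ofReal_ne_top, ENNReal.rpow_one, mul_assoc,
        mul_comm, mul_div_assoc, ENNReal.div_self hz0 ENNReal.ofReal_ne_top, mul_one]
    rw [h3, h3', key x hx', key y hy0]
    gcongr ?_ * ?_
    · exact ENNReal.rpow_le_rpow (ENNReal.ofReal_le_ofReal hxy) h.expo.q0.le
    · exact ENNReal.rpow_le_rpow (aa_mono h.hA hr hrr) h.expo.p0.le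
  · have : Dm m n A y = ∞ := by rw [Dm, if_neg hyH]
    rw [this, ENNReal.top_div_of_ne_top ENNReal.ofReal_ne_top]
    exact le_top

lemma Am_le_Dm (h : HData m n A) {y : ℝ} (hy : 0 < y) : Am m n A y ≤ Dm m n A y := by
  have hy0 : ENNReal.ofReal y ≠ 0 := by simpa using hy
  calc Am m n A y ≤ ∫⁻ s in Ioc (0:ℝ) y, Dm m n A y / ENNReal.ofReal y :=
        setLIntegral_mono' measurableSet_Ioc fun s hs => h.Dm_mono hs.1 hy hs.2
    _ = _ := by
        rw [setLIntegral_const, Real.volume_Ioc, sub_zero,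
          ENNReal.div_mul_cancel hy0 ENNReal.ofReal_ne_top]

lemma Dm_le_Am (h : HData m n A) {y : ℝ} (hy : 0 < y) : Dm m n A y ≤ Am m n A (2 * y) := by
  have hy0 : ENNReal.ofReal y ≠ 0 := by simpa using hy
  calc Dm m n A y = ∫⁻ s in Ioc y (2 * y), Dm m n A y / ENNReal.ofReal y := by
        rw [setLIntegral_const, Real.volume_Ioc, two_mul, add_sub_cancel_right,
          ENNReal.div_mul_cancel hy0 ENNReal.ofReal_ne_top]
    _ ≤ ∫⁻ s in Ioc y (2 * y), Dm m n A s / ENNReal.ofReal s :=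
        setLIntegral_mono' measurableSet_Ioc fun s hs =>
          h.Dm_mono hy (hy.trans hs.1) hs.1.le
    _ ≤ _ := lintegral_mono_set (Ioc_subset_Ioc_left hy.le)

lemma Hm_pos (h : HData m n A) : ∃ x : ℝ, 0 < x ∧ A x ≠ ∞ ∧ 0 < Hm m n A x := by
  obtain ⟨x, hx, hxt⟩ := h.hA.not_top
  refine ⟨x, hx, hxt, ?_⟩
  rw [Hm_eq]
  have hat : aa A x ≠ ∞ := by
    rw [aa_pos_eq A hx]
    exact ENNReal.div_ne_top hxt (by simpa using hx)
  have h1 : 0 < GG A ((m:ℝ)/((n:ℝ)-m)) x := by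
    refine lt_of_lt_of_le ?_ (GG_lower h.hA h.expo.q0)
    refine ENNReal.mul_pos ?_ (by simpa using hx)
    rw [ne_eq, ENNReal.rpow_eq_zero_iff_of_pos h.expo.q0]
    simpa using hat
  have h2 := GG_fin h.hA h.expo.q0 h.fin x
  exact ENNReal.rpow_pos h1 h2

lemma young (h : HData m n A) : IsYoung (Am m n A) := by
  refine prim_young h.Dm_mono ?_ ?_
  · refine ⟨2 * 1, by norm_num, ?_⟩
    have : 0 < Dm m n A 1 := by
      by_cases hyH : ENNReal.ofReal 1 < Hinfty m n A
      · obtain ⟨r, hr, h1, -, h3⟩ := h.spec one_pos hyH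
        rw [h3]
        refine (ENNReal.rpow_eq_zero_iff_of_pos h.expo.p0).not.2 ?_ |> pos_iff_ne_zero.2
        exact mul_ne_zero (by simp) (aa_ne_zero h.A0 hr)
      · rw [Dm, if_neg hyH]; exact ENNReal.zero_lt_top
    exact (this.trans_le (h.Dm_le_Am one_pos)).ne'
  · obtain ⟨x, hx, hxt, hH⟩ := h.Hm_pos
    have hHt := h.Hm_ne_top x
    have hy : 0 < (Hm m n A x).toReal / 2 := half_pos (ENNReal.toReal_pos hH.ne' hHt)
    have hylt : ENNReal.ofReal ((Hm m n A x).toReal / 2) < Hm m n A x := by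
      rw [ENNReal.ofReal_lt_iff_lt_toReal hy.le hHt]
      linarith
    refine ⟨_, hy, ?_⟩
    refine ne_top_of_le_ne_top ?_ (h.Am_le_Dm hy)
    obtain ⟨r, hr, h1, h2, h3⟩ := h.spec hy (hylt.trans_le (le_iSup (Hm m n A) x))
    rw [h3]
    refine ENNReal.rpow_ne_top_of_nonneg h.expo.p0.le (ENNReal.mul_ne_top ENNReal.ofReal_ne_top ?_)
    have hrx : r ≤ x := by
      by_contra hcon
      have := h.Hm_mono (not_le.1 hcon).le
      rw [h2] at this
      exact absurd hylt (not_lt.2 this)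
    refine ne_top_of_le_ne_top ?_ (aa_mono h.hA hr hrx)
    rw [aa_pos_eq A hx]
    exact ENNReal.div_ne_top hxt (by simpa using hx)

/-- pointwise estimate -/
lemma Dm_pt (h : HData m n A) {f : ℝ → ℝ≥0∞} (hf : Measurable f)
    (hf1 : (∫⁻ s in Ioi (0:ℝ), eext A (f s)) ≤ 1) {C : ℝ} (hC : 2 * (1 + 1 / ((m:ℝ)/n)) ≤ C)
    {t : ℝ} (ht : 0 < t) :
    eext (Am m n A) (TT ((m:ℝ)/n) f t / ENNReal.ofReal C) ≤
      (ENNReal.ofReal (2 / C) * TT ((m:ℝ)/n) (fun s => eext A (f s)) t) ^ ((n:ℝ)/((n:ℝ)-m)) := by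
  have hα := h.expo.a0
  have hp := h.expo.p0
  have hq := h.expo.q0
  set α := (m:ℝ)/n
  set p := (n:ℝ)/((n:ℝ)-m) with hpd
  set q := (m:ℝ)/((n:ℝ)-m) with hqd
  have hC0 : 0 < C := lt_of_lt_of_le (by positivity) hC
  have hCe : ENNReal.ofReal C ≠ 0 := by simpa using hC0
  have hTt : TT α (fun s => eext A (f s)) t ≠ ∞ :=
    ne_top_of_le_ne_top ENNReal.ofReal_ne_top (TT_le h.expo hf1 ht)
  have hut : TT α f t ≠ ∞ := by
    obtain ⟨x, hx, hxt, hH⟩ := h.Hm_pos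
    obtain ⟨R, h1, h2⟩ := split_est h.expo h.hA h.A0 hf hf1 hx ht hH.ne' (h.Hm_ne_top x)
      (h.Hm_pow x).ge
    have hR : R ≠ ∞ := by
      rintro rfl
      rw [ENNReal.top_mul (aa_ne_zero h.A0 hx)] at h2
      exact hTt (top_le_iff.1 h2)
    exact ne_top_of_le_ne_top (ENNReal.add_ne_top.2
      ⟨ENNReal.mul_ne_top ENNReal.ofReal_ne_top (h.Hm_ne_top x), hR⟩) h1
  set Y := TT α f t / ENNReal.ofReal C with hY
  have hYt : Y ≠ ∞ := ENNReal.div_ne_top hut hCe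
  rw [eext, if_neg hYt]
  rcases eq_or_lt_of_le (ENNReal.toReal_nonneg : 0 ≤ Y.toReal) with h0 | h0
  · rw [← h0, Am]; simp
  have hYr : ENNReal.ofReal Y.toReal = Y := ENNReal.ofReal_toReal hYt
  have hY0 : Y ≠ 0 := fun hh => by rw [hh] at h0; simp at h0
  have hu : TT α f t = ENNReal.ofReal C * Y := by
    rw [hY, ENNReal.mul_div_cancel hCe ENNReal.ofReal_ne_top]
  have hpt : ∀ r : ℝ, 0 < r → Hm m n A r ≤ Y →
      Y * aa A r ≤ ENNReal.ofReal (2 / C) * TT α (fun s => eext A (f s)) t := by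
    intro r hr hH
    refine pt_est h.expo h.hA h.A0 hf hf1 hr ht hY0 hYt ?_ hC hu
    have := ENNReal.rpow_le_rpow hH hp.le
    rw [hpd, h.Hm_pow] at this
    exact this
  by_cases hYH : Y < Hinfty m n A
  · obtain ⟨r, hr, h1, h2, h3⟩ := h.spec h0 (by rw [hYr]; exact hYH)
    refine (h.Am_le_Dm h0).trans ?_
    rw [h3, hYr]
    exact ENNReal.rpow_le_rpow (hpt r hr (by rw [h2, hYr])) hp.le
  · exfalso
    have hall : ∀ r : ℝ, Hm m n A r ≤ Y := fun r => (le_iSup (Hm m n A) r).trans (not_lt.1 hYH)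
    set M := ENNReal.ofReal (2 / C) * TT α (fun s => eext A (f s)) t / Y with hM
    have hMt : M ≠ ∞ := ENNReal.div_ne_top (ENNReal.mul_ne_top ENNReal.ofReal_ne_top hTt) hY0
    have haM : ∀ r : ℝ, 0 < r → aa A r ≤ M := by
      intro r hr
      rw [hM, ENNReal.le_div_iff_mul_le (Or.inl hY0) (Or.inl hYt), mul_comm]
      exact hpt r hr (hall r)
    have hN0 : M⁻¹ ^ q ≠ 0 := by
      rw [ne_eq, ENNReal.rpow_eq_zero_iff_of_pos hq]; simpa using hMt
    have hb : ∀ k : ℕ, M⁻¹ ^ q * (k:ℝ≥0∞) ≤ Y ^ p := by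
      intro k
      rcases Nat.eq_zero_or_pos k with hk | hk
      · simp [hk]
      have hk' : (0:ℝ) < k := by exact_mod_cast hk
      have e1 := GG_lower (t := (k:ℝ)) h.hA hq
      rw [ENNReal.ofReal_natCast] at e1
      have e2 := ENNReal.rpow_le_rpow (hall k) hp.le
      rw [hpd, h.Hm_pow] at e2
      refine le_trans ?_ (e1.trans e2)
      gcongr
      exact haM k hk'
    have hYp : Y ^ p ≠ ∞ := ENNReal.rpow_ne_top_of_nonneg hp.le hYt
    obtain ⟨k, hk⟩ := ENNReal.exists_nat_gt (ENNReal.div_ne_top hYp hN0)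
    have hbk := hb k
    have hNt : M⁻¹ ^ q ≠ ∞ := by
      intro hh
      have := hb 1
      rw [hh, Nat.cast_one, mul_one, top_le_iff] at this
      exact hYp this
    rw [ENNReal.div_lt_iff (Or.inl hN0) (Or.inl hNt), mul_comm] at hk
    exact absurd hk (not_lt.2 hbk)

lemma hardy (h : HData m n A) : ∃ C : ℝ≥0∞, 0 < C ∧ C < ∞ ∧
          ∀ f : ℝ → ℝ≥0∞, Measurable f →
            luxNorm (Am m n A) (hardyOp m n f) ≤ C * luxNorm A f := by
  have hα := h.expo.a0
  have hp := h.expo.p0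
  set C : ℝ := 2 * (1 + 1 / ((m:ℝ)/n)) + 2 * ((n:ℝ)/((n:ℝ)-m)) with hC
  have hC0 : 0 < C := by positivity
  have hCe : ENNReal.ofReal C ≠ 0 := by simpa using hC0
  refine ⟨ENNReal.ofReal C, by simpa using hC0, ENNReal.ofReal_lt_top, ?_⟩
  intro f hf
  refine lux_compare hCe ENNReal.ofReal_ne_top ?_
  intro l hl0 hlt hint
  have hT : ∀ t, hardyOp m n f t / (ENNReal.ofReal C * l)
      = TT ((m:ℝ)/n) (fun s => f s / l) t / ENNReal.ofReal C := by
    intro t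
    have e1 : TT ((m:ℝ)/n) (fun s => f s / l) t = hardyOp m n f t / l := by
      unfold TT hardyOp ww
      simp only [div_eq_mul_inv]
      rw [← lintegral_mul_const' _ _ (ENNReal.inv_ne_top.2 hl0)]
      refine lintegral_congr fun s => ?_
      ring
    rw [e1]
    simp only [div_eq_mul_inv]
    rw [ENNReal.mul_inv (Or.inl hCe) (Or.inl ENNReal.ofReal_ne_top)]
    ring
  have hf' : Measurable (fun s => f s / l) := hf.div measurable_const
  have hle : 2 * (1 + 1 / ((m:ℝ)/n)) ≤ C := by rw [hC]; linarith
  calc (∫⁻ t in Set.Ioi (0:ℝ), eext (Am m n A) (hardyOp m n f t / (ENNReal.ofReal C * l)))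
      ≤ ∫⁻ t in Set.Ioi (0:ℝ), ENNReal.ofReal (2 / C) ^ ((n:ℝ)/((n:ℝ)-m)) *
        (TT ((m:ℝ)/n) (fun s => eext A (f s / l)) t) ^ ((n:ℝ)/((n:ℝ)-m)) := by
        refine setLIntegral_mono' measurableSet_Ioi fun t ht => ?_
        rw [hT, ← ENNReal.mul_rpow_of_nonneg _ _ hp.le]
        exact h.Dm_pt hf' hint hle ht
    _ = ENNReal.ofReal (2 / C) ^ ((n:ℝ)/((n:ℝ)-m)) * ∫⁻ t in Set.Ioi (0:ℝ),
        (TT ((m:ℝ)/n) (fun s => eext A (f s / l)) t) ^ ((n:ℝ)/((n:ℝ)-m)) :=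
        lintegral_const_mul' _ _ (ENNReal.rpow_ne_top_of_nonneg hp.le ENNReal.ofReal_ne_top)
    _ ≤ ENNReal.ofReal (2 / C) ^ (1:ℝ) * ENNReal.ofReal ((n:ℝ)/((n:ℝ)-m)) := by
        gcongr ?_ * ?_
        · refine ENNReal.rpow_le_rpow_of_exponent_ge ?_ ?_
          · rw [← ENNReal.ofReal_one]
            refine ENNReal.ofReal_le_ofReal ?_
            rw [div_le_one hC0]
            have : 0 < 1 / ((m:ℝ)/n) := by positivity
            linarith
          · rw [h.expo.pq]; linarith [h.expo.q0]
        · exact TT_strong h.expo ((eext_measurable h.hA).comp hf') hint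
    _ ≤ 1 := by
        rw [ENNReal.rpow_one, ← ENNReal.ofReal_mul (by positivity), ← ENNReal.ofReal_one]
        refine ENNReal.ofReal_le_ofReal ?_
        rw [div_mul_eq_mul_div, div_le_one hC0]
        have : 0 < 1 / ((m:ℝ)/n) := by positivity
        linarith

end HData

end

section

variable {α p q : ℝ}

lemma half_est {A : ℝ → ℝ≥0∞} (hA : IsYoung A) {S : Set ℝ} (hS : MeasurableSet S)
    (hS0 : S ⊆ Ioi 0) (hSt : volume S ≠ ∞) :
    eext A (volume S / 2) ≤ ∫⁻ l in S, aa A l := by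
  set c := (volume S).toReal with hc
  have hc' : volume S = ENNReal.ofReal c := (ENNReal.ofReal_toReal hSt).symm
  have hc0 : 0 ≤ c := ENNReal.toReal_nonneg
  have e2 : volume S / 2 = ENNReal.ofReal (c / 2) := by
    rw [hc', ENNReal.ofReal_div_of_pos two_pos]; simp
  rw [e2, eext_ofReal A (by positivity)]
  rcases eq_or_lt_of_le hc0 with h0 | h0
  · rw [← h0]; simp [hA.map_zero]
  have h1 : volume S ≤ volume (S ∩ Ioi (c / 2)) + ENNReal.ofReal (c / 2) := by
    calc volume S ≤ volume ((S ∩ Ioi (c / 2)) ∪ Ioc 0 (c / 2)) := by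
          refine measure_mono fun x hx => ?_
          rcases le_or_gt x (c / 2) with h | h
          · exact Or.inr ⟨hS0 hx, h⟩
          · exact Or.inl ⟨hx, h⟩
      _ ≤ _ := by
          refine (measure_union_le _ _).trans ?_
          rw [Real.volume_Ioc, sub_zero]
  have h2 : ENNReal.ofReal (c / 2) ≤ volume (S ∩ Ioi (c / 2)) := by
    rw [hc'] at h1
    have : ENNReal.ofReal c = ENNReal.ofReal (c / 2) + ENNReal.ofReal (c / 2) := by
      rw [← ENNReal.ofReal_add (by positivity) (by positivity)]; congr 1; ring
    rw [this] at h1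
    exact (ENNReal.add_le_add_iff_right ENNReal.ofReal_ne_top).1 h1
  calc A (c / 2) = aa A (c / 2) * ENNReal.ofReal (c / 2) := by
        rw [mul_comm, mul_aa A (by positivity)]
    _ ≤ aa A (c / 2) * volume (S ∩ Ioi (c / 2)) := by gcongr
    _ = ∫⁻ l in S ∩ Ioi (c / 2), aa A (c / 2) := by rw [setLIntegral_const]
    _ ≤ ∫⁻ l in S ∩ Ioi (c / 2), aa A l := by
        refine setLIntegral_mono' (hS.inter measurableSet_Ioi) fun l hl => ?_
        exact aa_mono hA (by positivity) (le_of_lt hl.2)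
    _ ≤ _ := lintegral_mono_set inter_subset_left

/-- The test function lemma. -/
lemma test_fun (h : Expo α p q) {A : ℝ → ℝ≥0∞} (hA : IsYoung A)
    (hA0 : ∀ s : ℝ, 0 < s → A s ≠ 0) {r : ℝ} (hr : 0 < r) (har : aa A r ≠ ∞)
    {Λ : Set ℝ} (hΛ : MeasurableSet Λ) (hΛr : Λ ⊆ Ioc 0 r)
    {K : ℝ≥0∞} (hK0 : K ≠ 0) (hKt : K ≠ ∞)
    (hK : (∫⁻ s in Λ, (aa A s)⁻¹ ^ q) = K ^ p)
    {B : ℝ → ℝ≥0∞} (hB : IsYoung B) {C L : ℝ≥0∞} (hCL : C * 2 < L)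
    (hin : ∀ f : ℝ → ℝ≥0∞, Measurable f → luxNorm B (TT α f) ≤ C * luxNorm A f) :
    eext B (K / 2 / L) ≤ 2 * (K * aa A r) ^ p := by
  have hwm := ww_meas α
  have ham := aa_measurable hA
  have hp := h.p0
  have ha0 : ∀ l ∈ Λ, aa A l ≠ 0 := fun l hl => aa_ne_zero hA0 (hΛr hl).1
  have hale : ∀ l ∈ Λ, aa A l ≤ aa A r := fun l hl => aa_mono hA (hΛr hl).1 (hΛr hl).2
  have hat : ∀ l ∈ Λ, aa A l ≠ ∞ := fun l hl => ne_top_of_le_ne_top har (hale l hl)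
  have hms2 : MeasurableSet {z : ℝ × ℝ | K * aa A z.2 < ww α z.1} :=
    measurableSet_lt (by fun_prop) (by fun_prop)
  set f : ℝ → ℝ≥0∞ := fun s => ∫⁻ l in Λ, (if K * aa A l < ww α s then 1 else 0) with hf
  have hfm : Measurable f := by
    refine Measurable.lintegral_prod_right' (f := fun z : ℝ × ℝ =>
      if K * aa A z.2 < ww α z.1 then (1:ℝ≥0∞) else 0) ?_
    exact Measurable.ite hms2 measurable_const measurable_const
  -- modular estimate
  have hmod1 : ∀ s : ℝ, eext A (f s / 2) ≤
      ∫⁻ l in Λ, (if K * aa A l < ww α s then aa A l else 0) := by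
    intro s
    have hms : MeasurableSet {l : ℝ | K * aa A l < ww α s} :=
      measurableSet_lt (by fun_prop) (by fun_prop)
    have e1 : f s = volume ({l : ℝ | K * aa A l < ww α s} ∩ Λ) := by
      have : (fun l : ℝ => if K * aa A l < ww α s then (1:ℝ≥0∞) else 0)
        = {l : ℝ | K * aa A l < ww α s}.indicator 1 := by
        funext l; simp [indicator_apply]
      simp only [hf]
      rw [this, lintegral_indicator_one hms, Measure.restrict_apply hms]
    have e2 : (∫⁻ l in Λ, (if K * aa A l < ww α s then aa A l else 0))
        = ∫⁻ l in {l : ℝ | K * aa A l < ww α s} ∩ Λ, aa A l := by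
      have : (fun l : ℝ => if K * aa A l < ww α s then aa A l else 0)
        = {l : ℝ | K * aa A l < ww α s}.indicator (aa A) := by
        funext l; simp [indicator_apply]
      rw [this, lintegral_indicator hms, Measure.restrict_restrict hms]
    rw [e1, e2]
    refine half_est hA (hms.inter hΛ) (fun l hl => (hΛr hl.2).1) ?_
    refine ne_top_of_le_ne_top (b := volume (Ioc 0 r)) ?_ (measure_mono fun l hl => hΛr hl.2)
    rw [Real.volume_Ioc]; exact ENNReal.ofReal_ne_top
  have hmod : (∫⁻ s in Ioi (0:ℝ), eext A (f s / 2)) ≤ 1 := by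
    calc (∫⁻ s in Ioi (0:ℝ), eext A (f s / 2))
        ≤ ∫⁻ s in Ioi (0:ℝ), ∫⁻ l in Λ, (if K * aa A l < ww α s then aa A l else 0) :=
          lintegral_mono hmod1
      _ = ∫⁻ l in Λ, ∫⁻ s in Ioi (0:ℝ), (if K * aa A l < ww α s then aa A l else 0) := by
          refine lintegral_lintegral_swap (Measurable.aemeasurable ?_)
          refine Measurable.ite hms2 ?_ measurable_const
          fun_prop
      _ ≤ ∫⁻ l in Λ, K ^ (-p) * (aa A l)⁻¹ ^ q := by
          refine setLIntegral_mono' hΛ fun l hl => ?_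
          have e : (fun s : ℝ => if K * aa A l < ww α s then aa A l else 0)
            = fun s => aa A l * (if K * aa A l < ww α s then 1 else 0) := by
            funext s; split_ifs <;> simp
          rw [e, lintegral_const_mul' _ _ (hat l hl)]
          refine (mul_le_mul_right (volW h (mul_ne_zero hK0 (ha0 l hl))) _).trans (le_of_eq ?_)
          rw [ENNReal.mul_rpow_of_ne_zero hK0 (ha0 l hl), mul_left_comm]
          congr 1
          nth_rewrite 1 [← ENNReal.rpow_one (aa A l)]
          rw [← ENNReal.rpow_add _ _ (ha0 l hl) (hat l hl), ENNReal.inv_rpow, ← ENNReal.rpow_neg]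
          congr 1
          rw [h.pq]; ring
      _ = K ^ (-p) * K ^ p := by
          rw [lintegral_const_mul _ (by fun_prop), hK]
      _ = 1 := by
          rw [← ENNReal.rpow_add _ _ hK0 hKt, neg_add_cancel, ENNReal.rpow_zero]
      _ ≤ 1 := le_rfl
  have hlux : luxNorm A f ≤ 2 := lux_le two_ne_zero hmod
  have hlux2 : luxNorm B (TT α f) < L := by
    refine lt_of_le_of_lt (hin f hfm) (lt_of_le_of_lt ?_ hCL)
    gcongr
  have hBint := lux_lt hB hlux2
  -- lower bound
  have hX0 : K * aa A r ≠ 0 := mul_ne_zero hK0 (aa_ne_zero hA0 hr)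
  have hXt : K * aa A r ≠ ∞ := ENNReal.mul_ne_top hKt har
  set τ := (K * aa A r) ^ (-p) with hτ
  have hτ0 : τ ≠ 0 := (ENNReal.rpow_pos (pos_iff_ne_zero.2 hX0) hXt).ne'
  have hτt : τ ≠ ∞ := by
    rw [hτ, ENNReal.rpow_neg, ne_eq, ENNReal.inv_eq_top, ENNReal.rpow_eq_zero_iff_of_pos hp]
    exact hX0
  have hlow : ∀ t : ℝ, 0 < t → ENNReal.ofReal (2 * t) ≤ τ → K / 2 ≤ TT α f t := by
    intro t ht h2t
    calc K / 2 = ENNReal.ofReal (1 / 2) * K ^ (-q) * K ^ p := by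
          rw [mul_assoc, ← ENNReal.rpow_add _ _ hK0 hKt, h.pq, neg_add_cancel_comm_assoc,
            ENNReal.rpow_one, ENNReal.ofReal_div_of_pos two_pos, mul_comm, div_eq_mul_inv]
          simp
      _ = ∫⁻ l in Λ, ENNReal.ofReal (1 / 2) * K ^ (-q) * (aa A l)⁻¹ ^ q := by
          rw [lintegral_const_mul _ (by fun_prop), hK]
      _ ≤ ∫⁻ l in Λ, ∫⁻ s in Ioi t, (if K * aa A l < ww α s then ww α s else 0) := by
          refine setLIntegral_mono' hΛ fun l hl => ?_
          refine le_trans (le_of_eq ?_) (intW_lower h (mul_ne_zero hK0 (ha0 l hl))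
            (ENNReal.mul_ne_top hKt (hat l hl)) ht.le (h2t.trans ?_))
          · rw [mul_assoc, ENNReal.mul_rpow_of_ne_zero hK0 (ha0 l hl), ENNReal.rpow_neg (aa A l),
              ENNReal.inv_rpow]
          · rw [hτ, ENNReal.rpow_neg, ENNReal.rpow_neg, ENNReal.inv_le_inv]
            refine ENNReal.rpow_le_rpow ?_ hp.le
            gcongr
            exact hale l hl
      _ = ∫⁻ s in Ioi t, ∫⁻ l in Λ, (if K * aa A l < ww α s then ww α s else 0) := by
          symm
          refine lintegral_lintegral_swap (Measurable.aemeasurable ?_)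
          refine Measurable.ite hms2 ?_ measurable_const
          fun_prop
      _ = TT α f t := by
          refine lintegral_congr fun s => ?_
          simp only [hf]
          have : ww α s ≠ ∞ := ENNReal.ofReal_ne_top
          rw [← lintegral_mul_const' _ _ this]
          refine lintegral_congr fun l => ?_
          split_ifs <;> simp
  set τ' := τ.toReal / 2 with hτ'
  have hτp : 0 < τ.toReal := ENNReal.toReal_pos hτ0 hτt
  have hfinal : eext B (K / 2 / L) * ENNReal.ofReal τ' ≤ 1 := by
    calc eext B (K / 2 / L) * ENNReal.ofReal τ' = ∫⁻ t in Ioc (0:ℝ) τ', eext B (K / 2 / L) := by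
          rw [setLIntegral_const, Real.volume_Ioc, sub_zero]
      _ ≤ ∫⁻ t in Ioc (0:ℝ) τ', eext B (TT α f t / L) := by
          refine setLIntegral_mono' measurableSet_Ioc fun t ht => ?_
          refine eext_mono hB (ENNReal.div_le_div_right (hlow t ht.1 ?_) _)
          refine ENNReal.ofReal_le_of_le_toReal ?_
          have := ht.2
          rw [hτ'] at this
          linarith
      _ ≤ _ := (lintegral_mono_set fun t ht => ht.1).trans hBint
  have e3 : ENNReal.ofReal τ' = τ / 2 := by
    rw [hτ', ENNReal.ofReal_div_of_pos two_pos, ENNReal.ofReal_toReal hτt]; simp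
  rw [e3] at hfinal
  have h20 : τ / 2 ≠ 0 := by simp [hτ0]
  have h2t : τ / 2 ≠ ∞ := ENNReal.div_ne_top hτt two_ne_zero
  have := (ENNReal.le_div_iff_mul_le (Or.inl h20) (Or.inl h2t)).2 hfinal
  refine this.trans (le_of_eq ?_)
  rw [one_div, ENNReal.inv_div (Or.inl (by simp)) (Or.inl two_ne_zero), hτ, ENNReal.rpow_neg,
    div_eq_mul_inv, inv_inv]

lemma HData.optimal {m n : ℕ} {A : ℝ → ℝ≥0∞} (h : HData m n A) {B : ℝ → ℝ≥0∞} (hB : IsYoung B)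
    (hex : ∃ C' : ℝ≥0∞, 0 < C' ∧ C' < ∞ ∧
            ∀ f : ℝ → ℝ≥0∞, Measurable f →
              luxNorm B (hardyOp m n f) ≤ C' * luxNorm A f) :
    ∃ c : ℝ≥0∞, 0 < c ∧ c < ∞ ∧
            ∀ g : ℝ → ℝ≥0∞, Measurable g → luxNorm B g ≤ c * luxNorm (Am m n A) g := by
  obtain ⟨C, hC0, hCt, hin⟩ := hex
  set L := C * 2 + 1 with hL
  have hC2 : C * 2 ≠ ∞ := ENNReal.mul_ne_top hCt.ne (by simp)
  have hLt : L ≠ ∞ := ENNReal.add_ne_top.2 ⟨hC2, by simp⟩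
  have hL0 : L ≠ 0 := by simp [hL]
  have hCL : C * 2 < L := ENNReal.lt_add_right hC2 one_ne_zero
  have hY := h.young
  have key1 : ∀ y : ℝ, 0 < y → eext B (ENNReal.ofReal y / 2 / L) ≤ 2 * Dm m n A y := by
    intro y hy
    by_cases hyH : ENNReal.ofReal y < Hinfty m n A
    · obtain ⟨r, hr, h1, h2, h3⟩ := h.spec hy hyH
      have hy0 : ENNReal.ofReal y ≠ 0 := by simpa using hy
      rw [h3]
      by_cases har : aa A r = ∞
      · rw [har, ENNReal.mul_top hy0, ENNReal.top_rpow_of_pos h.expo.p0, ENNReal.mul_top two_ne_zero]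
        exact le_top
      · refine test_fun h.expo h.hA h.A0 hr har measurableSet_Ioc subset_rfl hy0
          ENNReal.ofReal_ne_top ?_ hB hCL hin
        rw [← h2, h.Hm_pow]
        rfl
    · rw [Dm, if_neg hyH, ENNReal.mul_top two_ne_zero]; exact le_top
  have key2 : ∀ x : ℝ, 0 ≤ x → eext B (ENNReal.ofReal x / (8 * L)) ≤ Am m n A x := by
    intro x hx
    rcases eq_or_lt_of_le hx with h0 | h0
    · rw [← h0]
      simp [eext, hB.map_zero]
    have h1 := key1 (x / 4) (by positivity)
    have h2 := h.Dm_le_Am (y := x / 4) (by positivity)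
    have h3 := young_scale hY (l := 1 / 2) (x := x) (by norm_num) (by norm_num) hx
    have e1 : 2 * (x / 4) = 1 / 2 * x := by ring
    have e2 : ENNReal.ofReal (x / 4) / 2 / L = ENNReal.ofReal x / (8 * L) := by
      rw [ENNReal.ofReal_div_of_pos (by norm_num)]
      simp only [div_eq_mul_inv]
      rw [ENNReal.mul_inv (Or.inl (by simp)) (Or.inl (by simp)), mul_assoc, mul_assoc,
        ← mul_assoc (ENNReal.ofReal 4)⁻¹, ← ENNReal.mul_inv (Or.inl (by simp)) (Or.inl (by simp))]
      congr 3
      rw [show (ENNReal.ofReal 4 : ℝ≥0∞) = 4 by simp]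
      norm_num
    rw [e2] at h1
    refine h1.trans ?_
    rw [e1] at h2
    calc 2 * Dm m n A (x / 4) ≤ 2 * (ENNReal.ofReal (1 / 2) * Am m n A x) := by
          gcongr
          exact h2.trans h3
      _ = Am m n A x := by
          rw [← mul_assoc]
          have : (2:ℝ≥0∞) * ENNReal.ofReal (1 / 2) = 1 := by
            rw [show (2:ℝ≥0∞) = ENNReal.ofReal 2 by simp, ← ENNReal.ofReal_mul (by norm_num)]
            norm_num
          rw [this, one_mul]
  have hc0 : 8 * L ≠ 0 := mul_ne_zero (by norm_num) hL0
  have hct : 8 * L ≠ ∞ := ENNReal.mul_ne_top (by simp) hLt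
  refine ⟨8 * L, pos_iff_ne_zero.2 hc0, lt_top_iff_ne_top.2 hct, ?_⟩
  intro g hg
  refine lux_compare hc0 hct fun l hl0 hlt hint => ?_
  refine le_trans (lintegral_mono fun t => ?_) hint
  have e : g t / (8 * L * l) = g t / l / (8 * L) := by
    simp only [div_eq_mul_inv]
    rw [ENNReal.mul_inv (Or.inl hc0) (Or.inl hct)]
    ring
  simp only
  rw [e]
  by_cases hgt : g t / l = ∞
  · rw [hgt]; simp [eext]
  · have := key2 (g t / l).toReal ENNReal.toReal_nonneg
    rw [ENNReal.ofReal_toReal hgt] at this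
    rw [eext.eq_def (Am m n A), if_neg hgt]
    exact this

lemma TT_const_top (h : Expo α p q) {c : ℝ≥0∞} (hc : c ≠ 0) {t : ℝ} (ht : 0 < t) :
    TT α (fun _ => c) t = ∞ := by
  unfold TT
  rw [lintegral_const_mul _ (ww_meas α)]
  have : (∫⁻ s in Ioi t, ww α s) = ∞ := by
    by_contra hne
    have h1 : IntegrableOn (fun s : ℝ => s ^ (α - 1)) (Ioi t) := by
      refine (lintegral_ofReal_ne_top_iff_integrable ?_ ?_).1 hne
      · exact (by fun_prop : Measurable fun s : ℝ => s ^ (α - 1)).aestronglyMeasurable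
      · refine (ae_restrict_iff' measurableSet_Ioi).2 (Eventually.of_forall fun x hx => ?_)
        exact Real.rpow_nonneg (ht.trans hx).le _
    rw [integrableOn_Ioi_rpow_iff ht] at h1
    linarith [h.a0]
  rw [this, ENNReal.mul_top hc]

lemma exists_Lam {A : ℝ → ℝ≥0∞} (hA : IsYoung A) (hq : 0 < q)
    (hA0 : ∀ s : ℝ, 0 < s → A s ≠ 0) {r : ℝ} (hr : 0 < r) (hG : GG A q r = ∞) {M : ℝ≥0∞}
    (hM : M ≠ ∞) : ∃ Λ : Set ℝ, MeasurableSet Λ ∧ Λ ⊆ Ioc 0 r ∧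
      (∫⁻ s in Λ, (aa A s)⁻¹ ^ q) = M := by
  have ham := aa_measurable hA
  obtain ⟨u, hu1, hu2, hu3⟩ := exists_seq_strictAnti_tendsto (0:ℝ)
  have h1 : GG A q r = ⨆ k, ∫⁻ s in Ioc (u k) r, (aa A s)⁻¹ ^ q := by
    have e : Ioc 0 r = ⋃ k, Ioc (u k) r := by
      ext y
      simp only [mem_iUnion, mem_Ioc]
      constructor
      · rintro ⟨h0, h2⟩
        obtain ⟨k, hk⟩ := ((hu3.eventually (gt_mem_nhds h0))).exists
        exact ⟨k, hk, h2⟩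
      · rintro ⟨k, h0, h2⟩
        exact ⟨(hu2 k).trans h0, h2⟩
    have hmon : Monotone fun k => Ioc (u k) r := fun i j hij =>
      Ioc_subset_Ioc_left (hu1.antitone hij)
    have := hmon.measure_iUnion (μ := volume.withDensity fun s => (aa A s)⁻¹ ^ q)
    rw [← e, withDensity_apply _ measurableSet_Ioc] at this
    rw [GG, this]
    refine iSup_congr fun k => ?_
    rw [withDensity_apply _ measurableSet_Ioc]
  rw [hG] at h1
  obtain ⟨k, hk⟩ := lt_iSup_iff.1 (h1 ▸ (lt_top_iff_ne_top.2 hM) : M < _)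
  set ε := u k
  have hε : 0 < ε := hu2 k
  set g : ℝ → ℝ≥0∞ := (Ioi ε).indicator fun s => (aa A s)⁻¹ ^ q with hg
  have hgm : Measurable g := Measurable.indicator (by fun_prop) measurableSet_Ioi
  have hgi : ∀ t : ℝ, (∫⁻ s in Ioc (0:ℝ) t, g s) = ∫⁻ s in Ioc ε t, (aa A s)⁻¹ ^ q := by
    intro t
    rw [hg, lintegral_indicator measurableSet_Ioi, Measure.restrict_restrict measurableSet_Ioi]
    congr 2
    ext x
    simp only [mem_inter_iff, mem_Ioi, mem_Ioc]
    constructor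
    · rintro ⟨a, b, c⟩; exact ⟨a, c⟩
    · rintro ⟨a, c⟩; exact ⟨a, hε.trans a, c⟩
  have hfin : ∀ t : ℝ, (∫⁻ s in Ioc (0:ℝ) t, g s) ≠ ∞ := by
    intro t
    rw [hgi]
    refine ne_top_of_le_ne_top (b := (aa A ε)⁻¹ ^ q * ENNReal.ofReal (t - ε)) ?_ ?_
    · refine ENNReal.mul_ne_top (ENNReal.rpow_ne_top_of_nonneg hq.le ?_) ENNReal.ofReal_ne_top
      simpa using aa_ne_zero hA0 hε
    · rw [← Real.volume_Ioc, ← setLIntegral_const]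
      refine setLIntegral_mono' measurableSet_Ioc fun x hx => ?_
      exact ENNReal.rpow_le_rpow (ENNReal.inv_le_inv.2 (aa_mono hA hε hx.1.le)) hq.le
  have hcont := cont_prim hgm hfin
  have hiv := intermediate_value_Icc hr.le hcont.continuousOn
  have hMm : M ∈ Icc (∫⁻ s in Ioc (0:ℝ) 0, g s) (∫⁻ s in Ioc (0:ℝ) r, g s) := by
    refine ⟨by simp, ?_⟩
    rw [hgi]; exact hk.le
  obtain ⟨t, ht, hte⟩ := hiv hMm
  refine ⟨Ioc ε t, measurableSet_Ioc, fun x hx => ⟨hε.trans hx.1, hx.2.trans ht.2⟩, ?_⟩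
  rw [← hgi]; exact hte

lemma no_target {m n : ℕ} (hm : 1 ≤ m) (hmn : m < n) {A : ℝ → ℝ≥0∞} (hA : IsYoung A)
    (hG : ∀ t0 : ℝ, 0 < t0 → GG A ((m:ℝ)/((n:ℝ)-m)) t0 = ∞) : ¬ ExistsOrliczTarget m n A := by
  rintro ⟨B, hB, C, hC0, hCt, hin⟩
  have h := expo_mn hm hmn
  set α := (m:ℝ)/n
  set p := (n:ℝ)/((n:ℝ)-m)
  set q := (m:ℝ)/((n:ℝ)-m)
  have hin' : ∀ f : ℝ → ℝ≥0∞, Measurable f → luxNorm B (TT α f) ≤ C * luxNorm A f := hin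
  by_cases hA0 : ∀ s : ℝ, 0 < s → A s ≠ 0
  · set L := C * 2 + 1 with hL
    have hC2 : C * 2 ≠ ∞ := ENNReal.mul_ne_top hCt.ne (by simp)
    have hLt : L ≠ ∞ := ENNReal.add_ne_top.2 ⟨hC2, by simp⟩
    have hL0 : L ≠ 0 := by simp [hL]
    have hCL : C * 2 < L := ENNReal.lt_add_right hC2 one_ne_zero
    obtain ⟨x, hx, hBx⟩ := hB.not_zero
    have hxe : ENNReal.ofReal x ≠ 0 := by simpa using hx
    set K := ENNReal.ofReal x * L * 2 with hK
    have hK0 : K ≠ 0 := mul_ne_zero (mul_ne_zero hxe hL0) two_ne_zero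
    have hKt : K ≠ ∞ := ENNReal.mul_ne_top (ENNReal.mul_ne_top ENNReal.ofReal_ne_top hLt) (by simp)
    have hKL : K / 2 / L = ENNReal.ofReal x := by
      rw [hK, ENNReal.mul_div_cancel_right two_ne_zero (by simp),
        ENNReal.mul_div_cancel_right hL0 hLt]
    set β := min (B x) 1 with hβ
    have hβ0 : β ≠ 0 := by
      have : 0 < β := lt_min (pos_iff_ne_zero.2 hBx) one_pos
      exact this.ne'
    have hβt : β ≠ ∞ := ne_top_of_le_ne_top ENNReal.one_ne_top (min_le_right _ _)
    set δ := β / 4 / K with hδ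
    have hδ0 : δ ≠ 0 := by
      rw [hδ, ne_eq, ENNReal.div_eq_zero_iff, ENNReal.div_eq_zero_iff]
      simp [hβ0, hKt]
    have hδt : δ ≠ ∞ := ENNReal.div_ne_top (ENNReal.div_ne_top hβt (by simp)) hK0
    have hr : ∃ r : ℝ, 0 < r ∧ aa A r < δ := by
      by_contra hcon
      push Not at hcon
      have : GG A q 1 ≤ δ⁻¹ ^ q * ENNReal.ofReal (1 - 0) := by
        rw [← Real.volume_Ioc, ← setLIntegral_const]
        refine setLIntegral_mono' measurableSet_Ioc fun s hs => ?_
        exact ENNReal.rpow_le_rpow (ENNReal.inv_le_inv.2 (hcon s hs.1)) h.q0.le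
      rw [hG 1 one_pos] at this
      refine absurd (top_le_iff.1 this) (ENNReal.mul_ne_top ?_ ENNReal.ofReal_ne_top)
      exact ENNReal.rpow_ne_top_of_nonneg h.q0.le (by simpa using hδ0)
    obtain ⟨r, hr0, hrδ⟩ := hr
    obtain ⟨Λ, hΛ1, hΛ2, hΛ3⟩ := exists_Lam hA h.q0 hA0 hr0 (hG r hr0)
      (ENNReal.rpow_ne_top_of_nonneg h.p0.le hKt : K ^ p ≠ ∞)
    have ht := test_fun h hA hA0 hr0 (hrδ.trans_le le_top).ne hΛ1 hΛ2 hK0 hKt hΛ3 hB hCL hin'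
    rw [hKL, eext_ofReal B hx.le] at ht
    have hKδ : K * aa A r ≤ β / 4 := by
      calc K * aa A r ≤ K * δ := by gcongr
        _ = β / 4 := by rw [hδ, ENNReal.mul_div_cancel hK0 hKt]
    have hβ1 : β / 4 ≤ 1 := by
      refine ENNReal.div_le_of_le_mul ?_
      rw [one_mul]
      exact (min_le_right _ _).trans (by norm_num)
    have h5 : (K * aa A r) ^ p ≤ β / 4 := by
      calc (K * aa A r) ^ p ≤ (K * aa A r) ^ (1:ℝ) := by
            refine ENNReal.rpow_le_rpow_of_exponent_ge (hKδ.trans hβ1) ?_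
            rw [h.pq]; linarith [h.q0]
        _ ≤ β / 4 := by rw [ENNReal.rpow_one]; exact hKδ
    have h6 : B x ≤ β / 2 := by
      refine ht.trans ((mul_le_mul_right h5 2).trans (le_of_eq ?_))
      simp only [div_eq_mul_inv]
      rw [mul_left_comm]
      congr 1
      rw [show (4:ℝ≥0∞) = 2 * 2 by norm_num, ENNReal.mul_inv (by simp) (by simp), ← mul_assoc,
        ENNReal.mul_inv_cancel two_ne_zero (by simp), one_mul]
    have h7 : β / 2 < β := ENNReal.half_lt_self hβ0 hβt
    exact absurd (h6.trans_lt h7) (not_lt.2 (min_le_left _ _))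
  · push Not at hA0
    obtain ⟨s, hs, hAs⟩ := hA0
    have hse : ENNReal.ofReal s ≠ 0 := by simpa using hs
    have h1 : luxNorm A (fun _ => ENNReal.ofReal s) ≤ 1 := by
      refine lux_le one_ne_zero ?_
      simp only [div_one]
      rw [eext_ofReal A hs.le, hAs]
      simp
    have h2 : luxNorm B (TT α fun _ => ENNReal.ofReal s) < C + 1 := by
      refine (hin' _ measurable_const).trans_lt ?_
      refine lt_of_le_of_lt (mul_le_mul_right h1 C) ?_
      rw [mul_one]
      exact ENNReal.lt_add_right hCt.ne one_ne_zero
    have h3 := lux_lt hB h2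
    have hC1 : C + 1 ≠ ∞ := ENNReal.add_ne_top.2 ⟨hCt.ne, ENNReal.one_ne_top⟩
    have h4 : (∫⁻ t in Ioi (0:ℝ), eext B (TT α (fun _ => ENNReal.ofReal s) t / (C + 1))) = ∞ := by
      have : (∫⁻ t in Ioi (0:ℝ), eext B (TT α (fun _ => ENNReal.ofReal s) t / (C + 1)))
          = ∫⁻ t in Ioi (0:ℝ), ∞ := by
        refine setLIntegral_congr_fun measurableSet_Ioi fun t ht => ?_
        rw [TT_const_top h hse ht, ENNReal.top_div_of_ne_top hC1]
        simp [eext]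
      rw [this, setLIntegral_const, Real.volume_Ioi]
      simp
    rw [h4] at h3
    exact absurd h3 (by simp)

end

/-- optimal Orlicz target space: general construction. -/
theorem statement15 (n m : ℕ) (hn : 2 ≤ n) (hm : 1 ≤ m) (hmn : m < n)
    (A : ℝ → ℝ≥0∞) (hA : IsYoung A) :
    ((∃ t0 : ℝ, 0 < t0 ∧
        (∫⁻ s in Set.Ioc (0:ℝ) t0,
          (ENNReal.ofReal s / A s) ^ ((m : ℝ)/((n : ℝ) - (m : ℝ)))) < ∞) →
      IsYoung (Am m n A)
      ∧ (∃ C : ℝ≥0∞, 0 < C ∧ C < ∞ ∧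
          ∀ f : ℝ → ℝ≥0∞, Measurable f →
            luxNorm (Am m n A) (hardyOp m n f) ≤ C * luxNorm A f)
      ∧ (∀ B : ℝ → ℝ≥0∞, IsYoung B →
          (∃ C' : ℝ≥0∞, 0 < C' ∧ C' < ∞ ∧
            ∀ f : ℝ → ℝ≥0∞, Measurable f →
              luxNorm B (hardyOp m n f) ≤ C' * luxNorm A f) →
          ∃ c : ℝ≥0∞, 0 < c ∧ c < ∞ ∧
            ∀ g : ℝ → ℝ≥0∞, Measurable g → luxNorm B g ≤ c * luxNorm (Am m n A) g))
    ∧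
    ((∀ t0 : ℝ, 0 < t0 →
        (∫⁻ s in Set.Ioc (0:ℝ) t0,
          (ENNReal.ofReal s / A s) ^ ((m : ℝ)/((n : ℝ) - (m : ℝ)))) = ∞) →
      ¬ ExistsOrliczTarget m n A) := by
  refine ⟨fun hfin => ?_, fun hinf => ?_⟩
  · have h : HData m n A := ⟨hA, hm, hmn, by
      obtain ⟨t0, ht0, hlt⟩ := hfin
      exact ⟨t0, ht0, by rwa [GG_eq] at hlt⟩⟩
    exact ⟨h.young, h.hardy, fun B hB hex => h.optimal hB hex⟩
  · refine no_target hm hmn hA fun t0 ht0 => ?_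
    have := hinf t0 ht0
    rwa [GG_eq] at this

end
end
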